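/- Let d ≥ 1 and n_1, …, n_d ≥ 1 be integers and let E = ℝ^{n_1} × ⋯ × ℝ^{n_d}. For each j let φ_j : ℝ^{n_j} → ℂ be a C^∞ function with ∫ φ_j = 0 such that for every multi-index α there is C_α with |∂^α φ_j(x)| ≤ C_α (1+‖x‖)^{-n_j-1/2-|α|}. For T = (t_1,…,t_d) ∈ (0,∞)^d define Φ_T(x_1,…,x_d) = ∏_{j=1}^d t_j^{-n_j} φ_j(x_j/t_j). Then for every 1 < p < ∞ there is a constant C_p such that for every Schwartz function f on E, ‖ (∫_{(0,∞)^d} |(f ⋆ Φ_T)(x)|² dT/(t_1⋯t_d))^{1/2} ‖_{L^p(E)} ≤ C_p ‖f‖_{L^p(E)}. -/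

import Mathlib

open MeasureTheory
set_option linter.all false

namespace LP

/-- A dyadic system of cells on a measure space. -/
structure DySys (X : Type*) [MeasurableSpace X] (μ : Measure X) where
  cell : ℤ → X → Set X
  m : ℤ → ℝ
  D : ℝ
  mem_self : ∀ k x, x ∈ cell k x
  eq_of_mem : ∀ k x y, y ∈ cell k x → cell k y = cell k x
  nested : ∀ k x, cell (k+1) x ⊆ cell k x
  meas_rel : ∀ k, MeasurableSet {p : X × X | p.2 ∈ cell k p.1}
  m_pos : ∀ k, 0 < m k
  vol : ∀ k x, μ (cell k x) = ENNReal.ofReal (m k)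
  doubling : ∀ k, m k ≤ D * m (k+1)

namespace DySys

variable {X : Type*} [MeasurableSpace X] {μ : Measure X} (S : DySys X μ)
variable {G : Type*} [NormedAddCommGroup G] [NormedSpace ℝ G]

/-- average over the cell -/
noncomputable def E (k : ℤ) (f : X → G) (x : X) : G := (S.m k)⁻¹ • ∫ y in S.cell k x, f y ∂μ

/-- `ENNReal` average over the cell -/
noncomputable def A (k : ℤ) (f : X → ENNReal) (x : X) : ENNReal :=
  (ENNReal.ofReal (S.m k))⁻¹ * ∫⁻ y in S.cell k x, f y ∂μ

lemma mem_comm {k : ℤ} {x y : X} : y ∈ S.cell k x ↔ x ∈ S.cell k y := by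
  constructor
  · intro h; rw [S.eq_of_mem k x y h]; exact S.mem_self k x
  · intro h; rw [S.eq_of_mem k y x h]; exact S.mem_self k y

lemma D_pos : 0 < S.D := by
  have h1 := S.doubling 0
  have h2 := S.m_pos 0
  have h3 := S.m_pos (0+1)
  by_contra h
  push Not at h
  nlinarith

lemma meas_cell (k : ℤ) (x : X) : MeasurableSet (S.cell k x) :=
  (S.meas_rel k).preimage (measurable_const.prodMk measurable_id)

lemma vol_lt_top (k : ℤ) (x : X) : μ (S.cell k x) < ⊤ := by
  rw [S.vol]; exact ENNReal.ofReal_lt_top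

lemma real_vol (k : ℤ) (x : X) : μ.real (S.cell k x) = S.m k := by
  rw [measureReal_def, S.vol, ENNReal.toReal_ofReal (S.m_pos k).le]

lemma nested_le {k l : ℤ} (h : k ≤ l) (x : X) : S.cell l x ⊆ S.cell k x := by
  induction l, h using Int.leInduction with
  | base => exact subset_rfl
  | succ l _ ih => exact (S.nested l x).trans ih

lemma E_congr (k : ℤ) (f : X → G) {x y : X} (h : y ∈ S.cell k x) : S.E k f y = S.E k f x := by
  unfold E; rw [S.eq_of_mem k x y h]

lemma A_congr (k : ℤ) (f : X → ENNReal) {x y : X} (h : y ∈ S.cell k x) :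
    S.A k f y = S.A k f x := by
  unfold A; rw [S.eq_of_mem k x y h]

lemma E_const (k : ℤ) [CompleteSpace G] (c : G) (x : X) : S.E k (fun _ => c) x = c := by
  unfold E
  rw [setIntegral_const, S.real_vol, smul_smul, inv_mul_cancel₀ (S.m_pos k).ne', one_smul]

lemma E_add {k : ℤ} {f g : X → G} {x : X} (hf : IntegrableOn f (S.cell k x) μ)
    (hg : IntegrableOn g (S.cell k x) μ) :
    S.E k (fun y => f y + g y) x = S.E k f x + S.E k g x := by
  unfold E; rw [integral_add hf hg, smul_add]

lemma E_sub {k : ℤ} {f g : X → G} {x : X} (hf : IntegrableOn f (S.cell k x) μ)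
    (hg : IntegrableOn g (S.cell k x) μ) :
    S.E k (fun y => f y - g y) x = S.E k f x - S.E k g x := by
  unfold E; rw [integral_sub hf hg, smul_sub]

lemma E_const_mul {k : ℤ} (c : ℝ) (f : X → ℝ) (x : X)  :
    S.E k (fun y => c * f y) x = c * S.E k f x := by
  unfold E; rw [integral_const_mul]; simp only [smul_eq_mul]; ring

lemma E_congr_ae {k : ℤ} {f g : X → G} {x : X} (h : ∀ᵐ y ∂μ, y ∈ S.cell k x → f y = g y) :
    S.E k f x = S.E k g x := by
  unfold E; rw [setIntegral_congr_ae (S.meas_cell k x) h]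

lemma E_congr_on {k : ℤ} {f g : X → G} {x : X} (h : ∀ y ∈ S.cell k x, f y = g y) :
    S.E k f x = S.E k g x := S.E_congr_ae (Filter.Eventually.of_forall h)

lemma E_mono_ae {k : ℤ} {f g : X → ℝ} {x : X} (hf : IntegrableOn f (S.cell k x) μ)
    (hg : IntegrableOn g (S.cell k x) μ) (h : ∀ᵐ y ∂μ, y ∈ S.cell k x → f y ≤ g y) :
    S.E k f x ≤ S.E k g x := by
  unfold E
  refine smul_le_smul_of_nonneg_left ?_ (inv_nonneg.2 (S.m_pos k).le)
  exact setIntegral_mono_on_ae hf hg (S.meas_cell k x) h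

lemma E_nonneg {k : ℤ} {f : X → ℝ} {x : X} (h : ∀ y, 0 ≤ f y) : 0 ≤ S.E k f x := by
  unfold E
  exact smul_nonneg (inv_nonneg.2 (S.m_pos k).le) (integral_nonneg h)

lemma integrableOn_of_bdd {k : ℤ} {f : X → G} {x : X} (hf : AEStronglyMeasurable f μ) (C : ℝ)
    (h : ∀ᵐ y ∂μ, y ∈ S.cell k x → ‖f y‖ ≤ C) : IntegrableOn f (S.cell k x) μ :=
  Measure.integrableOn_of_bounded (M := C) (S.vol_lt_top k x).ne hf
    ((ae_restrict_iff' (S.meas_cell k x)).2 h)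

lemma stronglyMeasurable_E [SFinite μ] (k : ℤ) {f : X → G} (hf : StronglyMeasurable f) :
    StronglyMeasurable (S.E k f) := by
  unfold E
  have : (fun x => ∫ y in S.cell k x, f y ∂μ)
      = fun x => ∫ y, ({p : X × X | p.2 ∈ S.cell k p.1}.indicator (fun p => f p.2)) (x, y) ∂μ := by
    funext x
    rw [← integral_indicator (S.meas_cell k x)]
    rfl
  have h2 : StronglyMeasurable (fun x => ∫ y in S.cell k x, f y ∂μ) := by
    rw [this]
    exact StronglyMeasurable.integral_prod_right'
      ((hf.comp_measurable measurable_snd).indicator (S.meas_rel k))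
  exact h2.const_smul _

lemma measurable_A [SFinite μ] (k : ℤ) {f : X → ENNReal} (hf : Measurable f) :
    Measurable (S.A k f) := by
  unfold A
  have : (fun x => ∫⁻ y in S.cell k x, f y ∂μ)
      = fun x => ∫⁻ y, ({p : X × X | p.2 ∈ S.cell k p.1}.indicator (fun p => f p.2)) (x, y) ∂μ := by
    funext x
    rw [← lintegral_indicator (S.meas_cell k x)]
    rfl
  have h2 : Measurable (fun x => ∫⁻ y in S.cell k x, f y ∂μ) := by
    rw [this]
    exact Measurable.lintegral_prod_right'
      ((hf.comp measurable_snd).indicator (S.meas_rel k))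
  exact h2.const_mul _

lemma lintegral_A [SFinite μ] (k : ℤ) {f : X → ENNReal} (hf : Measurable f) :
    ∫⁻ x, S.A k f x ∂μ = ∫⁻ x, f x ∂μ := by
  unfold A
  have hm : ENNReal.ofReal (S.m k) ≠ 0 := by simpa using S.m_pos k
  rw [lintegral_const_mul' _ _ (by simpa using S.m_pos k)]
  have : (fun x => ∫⁻ y in S.cell k x, f y ∂μ)
      = fun x => ∫⁻ y, ({p : X × X | p.2 ∈ S.cell k p.1}.indicator (fun p => f p.2)) (x, y) ∂μ := by
    funext x
    rw [← lintegral_indicator (S.meas_cell k x)]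
    rfl
  have hme : Measurable (Function.uncurry fun x y =>
      ({p : X × X | p.2 ∈ S.cell k p.1}.indicator (fun p => f p.2)) (x, y)) :=
    ((hf.comp measurable_snd).indicator (S.meas_rel k))
  rw [this, lintegral_lintegral_swap hme.aemeasurable]
  have h3 : ∀ y, ∫⁻ x, ({p : X × X | p.2 ∈ S.cell k p.1}.indicator (fun p => f p.2)) (x, y) ∂μ
      = ENNReal.ofReal (S.m k) * f y := by
    intro y
    have : (fun x => ({p : X × X | p.2 ∈ S.cell k p.1}.indicator (fun p => f p.2)) (x, y))
      = (S.cell k y).indicator (fun _ => f y) := by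
      funext x
      by_cases h : x ∈ S.cell k y
      · rw [Set.indicator_of_mem h, Set.indicator_of_mem]
        exact S.mem_comm.1 h
      · rw [Set.indicator_of_notMem h, Set.indicator_of_notMem]
        exact fun h' => h (S.mem_comm.1 h')
    rw [this, lintegral_indicator (S.meas_cell k y), setLIntegral_const, S.vol, mul_comm]
  simp_rw [h3]
  rw [lintegral_const_mul' _ _ ENNReal.ofReal_ne_top, ← mul_assoc,
    ENNReal.inv_mul_cancel hm ENNReal.ofReal_ne_top, one_mul]

lemma A_mul_right (k : ℤ) {f g : X → ENNReal} (hf : Measurable f)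
    (x : X) (hg : ∀ y ∈ S.cell k x, g y = g x) :
    S.A k (fun y => f y * g y) x = S.A k f x * g x := by
  unfold A
  rw [setLIntegral_congr_fun (g := fun y => f y * g x) (S.meas_cell k x)
    (fun y hy => by simp only; rw [hg y hy]), lintegral_mul_const _ hf, mul_assoc]

lemma lintegral_A_mul [SFinite μ] (k : ℤ) {f g : X → ENNReal} (hf : Measurable f)
    (hg : Measurable g) (hc : ∀ x, ∀ y ∈ S.cell k x, g y = g x) :
    ∫⁻ x, S.A k f x * g x ∂μ = ∫⁻ x, f x * g x ∂μ := by
  rw [← S.lintegral_A k (f := fun x => f x * g x) (hf.mul hg)]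
  refine lintegral_congr fun x => ?_
  rw [← S.A_mul_right k hf x (hc x)]

lemma A_ofReal (k : ℤ) {f : X → ℝ} (h0 : ∀ y, 0 ≤ f y) (x : X)
    (hf : IntegrableOn f (S.cell k x) μ) :
    S.A k (fun y => ENNReal.ofReal (f y)) x = ENNReal.ofReal (S.E k f x) := by
  unfold A E
  rw [smul_eq_mul, ENNReal.ofReal_mul (inv_nonneg.2 (S.m_pos k).le),
    ofReal_integral_eq_lintegral_ofReal hf (Filter.Eventually.of_forall h0),
    ENNReal.ofReal_inv_of_pos (S.m_pos k)]

lemma lintegral_le_of_E [SFinite μ] (k : ℤ) {g h : X → ℝ} (hg : Measurable g) (hh : Measurable h)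
    (hg0 : ∀ x, 0 ≤ g x) (hh0 : ∀ x, 0 ≤ h x)
    (hgi : ∀ x, IntegrableOn g (S.cell k x) μ) (hhi : ∀ x, IntegrableOn h (S.cell k x) μ)
    (hle : ∀ x, S.E k g x ≤ S.E k h x) :
    ∫⁻ x, ENNReal.ofReal (g x) ∂μ ≤ ∫⁻ x, ENNReal.ofReal (h x) ∂μ := by
  rw [← S.lintegral_A k hg.ennreal_ofReal, ← S.lintegral_A k hh.ennreal_ofReal]
  refine lintegral_mono fun x => ?_
  rw [S.A_ofReal k hg0 x (hgi x), S.A_ofReal k hh0 x (hhi x)]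
  exact ENNReal.ofReal_le_ofReal (hle x)

/-- tower property -/
lemma E_tower [SFinite μ] {k l : ℤ} (hkl : k ≤ l) {f : X → G} [CompleteSpace G] (x : X)
    (hf : IntegrableOn f (S.cell k x) μ) : S.E k (S.E l f) x = S.E k f x := by
  set P := S.cell k x with hP
  have hsub : ∀ y ∈ P, S.cell l y ⊆ P := by
    intro y hy
    rw [hP, ← S.eq_of_mem k x y hy]; exact S.nested_le hkl y
  have h1 : ∀ y ∈ P, S.E l f y = (S.m l)⁻¹ •
      ∫ z in P, ({p : X × X | p.2 ∈ S.cell l p.1}.indicator (fun p => f p.2)) (y, z) ∂μ := by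
    intro y hy
    unfold E
    have : (fun z => ({p : X × X | p.2 ∈ S.cell l p.1}.indicator (fun p => f p.2)) (y, z))
      = (S.cell l y).indicator f := by
      funext z; rfl
    rw [this, setIntegral_indicator (S.meas_cell l y), Set.inter_eq_right.2 (hsub y hy)]
  unfold E at h1 ⊢
  congr 1
  rw [← hP, setIntegral_congr_fun (S.meas_cell k x) h1, integral_smul]
  haveI : IsFiniteMeasure (μ.restrict P) := ⟨by simpa using S.vol_lt_top k x⟩
  have hintg : Integrable (Function.uncurry fun y z =>
      ({p : X × X | p.2 ∈ S.cell l p.1}.indicator (fun p => f p.2)) (y, z))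
      ((μ.restrict P).prod (μ.restrict P)) := by
    have : (Function.uncurry fun y z =>
      ({p : X × X | p.2 ∈ S.cell l p.1}.indicator (fun p => f p.2)) (y, z))
      = ({p : X × X | p.2 ∈ S.cell l p.1}.indicator (fun p => f p.2)) := by
      funext p; rfl
    rw [this]
    exact (Integrable.comp_snd hf _).indicator (S.meas_rel l)
  rw [integral_integral_swap hintg]
  have h3 : ∀ z ∈ P, ∫ y in P, ({p : X × X | p.2 ∈ S.cell l p.1}.indicator (fun p => f p.2)) (y, z) ∂μ
      = S.m l • f z := by
    intro z hz
    have : (fun y => ({p : X × X | p.2 ∈ S.cell l p.1}.indicator (fun p => f p.2)) (y, z))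
      = (S.cell l z).indicator (fun _ => f z) := by
      funext y
      by_cases h : y ∈ S.cell l z
      · rw [Set.indicator_of_mem h, Set.indicator_of_mem]
        exact S.mem_comm.1 h
      · rw [Set.indicator_of_notMem h, Set.indicator_of_notMem]
        exact fun h' => h (S.mem_comm.1 h')
    rw [this, setIntegral_indicator (S.meas_cell l z), Set.inter_eq_right.2 (hsub z hz),
      setIntegral_const, S.real_vol]
  rw [setIntegral_congr_fun (S.meas_cell k x) h3, integral_smul, smul_smul,
    inv_mul_cancel₀ (S.m_pos l).ne', one_smul]

end DySys
end LP

open MeasureTheory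
set_option linter.all false

namespace LP
namespace DySys

variable {X : Type*} [MeasurableSpace X] {μ : Measure X} (S : DySys X μ)

/-- admissible weights: `A_2` plus a reverse Hölder inequality for the dual weight. -/
structure Wt (w σ : X → ℝ) (Q r Cr : ℝ) : Prop where
  mw : Measurable w
  ms : Measurable σ
  w0 : ∀ x, 0 ≤ w x
  s0 : ∀ x, 0 ≤ σ x
  one : ∀ᵐ x ∂μ, w x * σ x = 1
  iw : ∀ k x, IntegrableOn w (S.cell k x) μ
  is : ∀ k x, IntegrableOn σ (S.cell k x) μ
  r1 : 1 < r
  ir : ∀ k x, IntegrableOn (fun y => σ y ^ r) (S.cell k x) μ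
  A2 : ∀ k x, S.E k w x * S.E k σ x ≤ Q
  RH : ∀ k x, S.E k (fun y => σ y ^ r) x ≤ Cr * (S.E k σ x) ^ r

lemma xlogx_ineq {a b : ℝ} (ha : 0 ≤ a) (hb : 0 < b) :
    a * Real.log b + a - b + (√a - √b) ^ 2 ≤ a * Real.log a := by
  rcases ha.eq_or_lt with rfl | ha
  · simp [Real.sq_sqrt hb.le]
  have h1 : 0 < √a := Real.sqrt_pos.2 ha
  have h2 : 0 < √b := Real.sqrt_pos.2 hb
  have e1 : √a * √a = a := Real.mul_self_sqrt ha.le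
  have e2 : √b * √b = b := Real.mul_self_sqrt hb.le
  have h3 := Real.one_sub_inv_le_log_of_pos (div_pos h1 h2)
  have h4 : Real.log (√a / √b) = (Real.log a - Real.log b) / 2 := by
    rw [Real.log_div h1.ne' h2.ne', Real.log_sqrt ha.le, Real.log_sqrt hb.le]; ring
  rw [h4, inv_div] at h3
  have h5 : a * (1 - √b / √a) ≤ a * ((Real.log a - Real.log b) / 2) :=
    mul_le_mul_of_nonneg_left h3 ha.le
  have h6 : a * (1 - √b / √a) = a - √a * √b := by
    field_simp
    nlinarith
  rw [h6] at h5
  nlinarith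

lemma E_child_le {k : ℤ} {g : X → ℝ} (hg : ∀ x, 0 ≤ g x) {x y : X}
    (hi : IntegrableOn g (S.cell k x) μ) (hy : y ∈ S.cell k x) :
    S.E (k+1) g y ≤ S.D * S.E k g x := by
  have hsub : S.cell (k+1) y ⊆ S.cell k x := by
    rw [← S.eq_of_mem k x y hy]; exact S.nested k y
  have h1 : ∫ z in S.cell (k+1) y, g z ∂μ ≤ ∫ z in S.cell k x, g z ∂μ :=
    setIntegral_mono_set hi (Filter.Eventually.of_forall hg) (HasSubset.Subset.eventuallyLE hsub)
  unfold E
  simp only [smul_eq_mul]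
  have h0 : 0 ≤ ∫ z in S.cell k x, g z ∂μ := integral_nonneg hg
  have h2 : (S.m (k+1))⁻¹ ≤ S.D * (S.m k)⁻¹ := by
    have := S.doubling k
    have a := S.m_pos k
    have b := S.m_pos (k+1)
    rw [← div_eq_mul_inv, inv_eq_one_div, div_le_div_iff₀ b a]; linarith
  calc (S.m (k+1))⁻¹ * ∫ z in S.cell (k+1) y, g z ∂μ
      ≤ (S.D * (S.m k)⁻¹) * ∫ z in S.cell k x, g z ∂μ := by
        refine mul_le_mul h2 h1 (integral_nonneg hg) ((inv_nonneg.2 (S.m_pos _).le).trans h2)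
    _ = _ := by ring

namespace Wt
variable {S} {w σ : X → ℝ} {Q r Cr : ℝ}

lemma lin (h : S.Wt w σ Q r Cr) (lam : ℝ) : ∀ᵐ y ∂μ, 2 * lam - lam ^ 2 * w y ≤ σ y := by
  filter_upwards [h.one] with y hy
  have hw : 0 < w y := lt_of_le_of_ne (h.w0 y) (fun h' => by rw [← h'] at hy; simp at hy)
  have : σ y = 1 / w y := by field_simp; linarith
  rw [this, le_div_iff₀ hw]
  nlinarith [sq_nonneg (lam * w y - 1)]

lemma lower (h : S.Wt w σ Q r Cr) (k : ℤ) (x : X) : 0 < S.E k w x ∧ 1 ≤ S.E k w x * S.E k σ x := by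
  have key : ∀ lam : ℝ, 2 * lam - lam ^ 2 * S.E k w x ≤ S.E k σ x := by
    intro lam
    have hc : IntegrableOn (fun _ : X => 2 * lam) (S.cell k x) μ :=
      integrableOn_const (S.vol_lt_top k x).ne
    have := S.E_mono_ae (f := fun y => 2 * lam - lam ^ 2 * w y) (hc.sub ((h.iw k x).const_mul (lam ^ 2))) (h.is k x)
      ((h.lin lam).mono fun y hy _ => hy)
    rw [S.E_sub hc ((h.iw k x).const_mul (lam ^ 2)), S.E_const, S.E_const_mul] at this
    exact this
  have hw : 0 < S.E k w x := by
    refine lt_of_le_of_ne (S.E_nonneg h.w0) (fun h' => ?_)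
    have := key (S.E k σ x + 1)
    rw [← h'] at this
    have h2 : 0 ≤ S.E k σ x := S.E_nonneg h.s0
    linarith
  refine ⟨hw, ?_⟩
  have := key (1 / S.E k w x)
  have h3 : 2 * (1 / S.E k w x) - (1 / S.E k w x) ^ 2 * S.E k w x = 1 / S.E k w x := by
    field_simp; ring
  rw [h3, div_le_iff₀ hw] at this
  linarith

lemma spos (h : S.Wt w σ Q r Cr) (k : ℤ) (x : X) : 0 < S.E k σ x := by
  obtain ⟨h1, h2⟩ := h.lower k x
  exact pos_of_mul_pos_right (by linarith) h1.le

lemma Cr_nonneg (h : S.Wt w σ Q r Cr) : ∀ (x : X), 0 ≤ Cr := by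
  intro x
  have h1 := h.RH 0 x
  have h2 : 0 ≤ S.E 0 (fun y => σ y ^ r) x := S.E_nonneg fun y => Real.rpow_nonneg (h.s0 y) _
  have h3 : 0 < (S.E 0 σ x) ^ r := Real.rpow_pos_of_pos (h.spos 0 x) _
  exact nonneg_of_mul_nonneg_left (h2.trans h1) h3

lemma inv_child (h : S.Wt w σ Q r Cr) {k : ℤ} {x y : X} (hy : y ∈ S.cell k x) :
    (S.E (k+1) σ y)⁻¹ ≤ S.D * S.E k w x := by
  obtain ⟨h1, h2⟩ := h.lower (k+1) y
  refine le_trans ?_ (S.E_child_le h.w0 (h.iw k x) hy)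
  rw [inv_le_iff_one_le_mul₀ (h.spos _ _)]
  exact h2

lemma ilog (h : S.Wt w σ Q r Cr) (k : ℤ) (x : X) : IntegrableOn (fun y => σ y * Real.log (σ y)) (S.cell k x) μ := by
  have hr : 0 < r - 1 := by linarith [h.r1]
  have hc : IntegrableOn (fun _ : X => (1:ℝ)) (S.cell k x) μ :=
      integrableOn_const (S.vol_lt_top k x).ne
  have hb := hc.add ((h.ir k x).const_mul (1 / (r - 1)))
  refine Integrable.mono' hb (h.ms.mul (Real.measurable_log.comp h.ms)).aestronglyMeasurable ?_
  refine Filter.Eventually.of_forall fun y => ?_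
  simp only [Pi.add_apply, Real.norm_eq_abs]
  have hp : 0 ≤ 1 / (r - 1) * σ y ^ r := by have := Real.rpow_nonneg (h.s0 y) r; positivity
  rcases le_or_gt (σ y) 1 with h1 | h1
  · rcases (h.s0 y).eq_or_lt with h0 | h0
    · rw [← h0] at hp ⊢; simp only [zero_mul, abs_zero]; linarith
    · have := Real.abs_log_mul_self_lt (σ y) h0 h1
      rw [mul_comm]; linarith
  · have hs : 0 < σ y := by linarith
    have hl := Real.log_le_rpow_div hs.le hr
    have hl0 := Real.log_pos h1
    rw [abs_of_nonneg (by positivity)]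
    have e : σ y * (σ y ^ (r-1) / (r-1)) = 1 / (r - 1) * σ y ^ r := by
      have : σ y ^ r = σ y ^ (r-1) * σ y := by
        rw [← Real.rpow_add_one hs.ne']; congr 1; ring
      rw [this]; ring
    have := mul_le_mul_of_nonneg_left hl hs.le
    rw [e] at this; linarith

/-- supersolution for the Carleson embedding -/
noncomputable def Nn (S : DySys X μ) (σ : X → ℝ) (k : ℤ) (x : X) : ℝ :=
  S.E k σ x + (S.E k (fun y => σ y * Real.log (σ y)) x - S.E k σ x * Real.log (S.E k σ x))

lemma Nn_lower (h : S.Wt w σ Q r Cr) (k : ℤ) (x : X) : S.E k σ x ≤ Nn S σ k x := by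
  set s := S.E k σ x with hs
  have hsp : 0 < s := h.spos k x
  have hc : IntegrableOn (fun _ : X => s) (S.cell k x) μ :=
      integrableOn_const (S.vol_lt_top k x).ne
  have h1 := S.E_mono_ae (f := fun y => (Real.log s + 1) * σ y - s)
    (((h.is k x).const_mul (Real.log s + 1)).sub hc) (h.ilog k x)
    (Filter.Eventually.of_forall fun y _ => by
      have := xlogx_ineq (h.s0 y) hsp
      nlinarith [sq_nonneg (√(σ y) - √s)])
  rw [S.E_sub ((h.is k x).const_mul (Real.log s + 1)) hc, S.E_const, S.E_const_mul, ← hs] at h1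
  unfold Nn
  rw [← hs]
  nlinarith

lemma Nn_upper (h : S.Wt w σ Q r Cr) (k : ℤ) (x : X) : Nn S σ k x ≤ (1 + Cr / (r - 1)) * S.E k σ x := by
  have hr : 0 < r - 1 := by linarith [h.r1]
  set s := S.E k σ x with hs
  have hsp : 0 < s := h.spos k x
  have h1 := S.E_mono_ae (f := fun y => σ y * Real.log (σ y))
    (g := fun y => Real.log s * σ y + (s ^ (1 - r) / (r-1)) * σ y ^ r) (h.ilog k x)
    (((h.is k x).const_mul (Real.log s)).add ((h.ir k x).const_mul _))
    (Filter.Eventually.of_forall fun y _ => by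
      rcases (h.s0 y).eq_or_lt with h0 | h0
      · rw [← h0]; simp; rw [Real.zero_rpow (by linarith)]; simp
      · have hl := Real.log_le_rpow_div (div_pos h0 hsp).le hr
        rw [Real.log_div h0.ne' hsp.ne', Real.div_rpow h0.le hsp.le] at hl
        have := mul_le_mul_of_nonneg_left hl h0.le
        have e : σ y * (σ y ^ (r-1) / s ^ (r-1) / (r-1)) = (s ^ (1 - r) / (r-1)) * σ y ^ r := by
          have e1 : σ y ^ r = σ y ^ (r-1) * σ y := by
            rw [← Real.rpow_add_one h0.ne']; congr 1; ring
          have e2 : s ^ (1 - r) = (s ^ (r-1))⁻¹ := by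
            rw [← Real.rpow_neg hsp.le]; congr 1; ring
          rw [e1, e2]; ring
        rw [e] at this; linarith)
  rw [S.E_add ((h.is k x).const_mul (Real.log s)) ((h.ir k x).const_mul _), S.E_const_mul,
    S.E_const_mul, ← hs] at h1
  have h2 := h.RH k x
  rw [← hs] at h2
  have h3 : s ^ (1 - r) / (r-1) * S.E k (fun y => σ y ^ r) x ≤ s ^ (1 - r) / (r-1) * (Cr * s ^ r) :=
    mul_le_mul_of_nonneg_left h2 (by positivity)
  have h4 : s ^ (1 - r) / (r-1) * (Cr * s ^ r) = Cr / (r - 1) * s := by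
    have : s ^ (1 - r) * s ^ r = s := by
      rw [← Real.rpow_add hsp]; simp
    calc _ = Cr / (r-1) * (s ^ (1 - r) * s ^ r) := by ring
      _ = _ := by rw [this]
  unfold Nn
  rw [← hs]
  nlinarith

end Wt
end DySys
end LP

open MeasureTheory
set_option linter.all false

namespace LP
namespace DySys

variable {X : Type*} [MeasurableSpace X] {μ : Measure X} (S : DySys X μ)

lemma abs_xlogx {a : ℝ} (ha : 0 ≤ a) : |a * Real.log a| ≤ 1 + a ^ 2 := by
  rcases ha.eq_or_lt with rfl | h0
  · simp
  rcases le_or_gt a 1 with h1 | h1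
  · have := Real.abs_log_mul_self_lt a h0 h1
    rw [mul_comm]; nlinarith
  · have h2 := Real.log_pos h1
    have h3 := Real.log_le_sub_one_of_pos h0
    rw [abs_of_nonneg (by positivity)]
    nlinarith

lemma E_abs_le {k : ℤ} {f : X → ℝ} {B : ℝ} (hB : ∀ y, |f y| ≤ B) (x : X) : |S.E k f x| ≤ B := by
  unfold E
  rw [smul_eq_mul, abs_mul, abs_of_pos (inv_pos.2 (S.m_pos k)), inv_mul_le_iff₀ (S.m_pos k)]
  have := norm_setIntegral_le_of_norm_le_const (f := f) (C := B) (s := S.cell k x) (μ := μ)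
    (S.vol_lt_top k x) (fun y _ => hB y)
  rw [S.real_vol] at this
  rw [mul_comm]; exact this

namespace Wt
variable {S} {w σ : X → ℝ} {Q r Cr : ℝ}

lemma tele1 (h : S.Wt w σ Q r Cr) [SFinite μ] {f : X → ℝ} (hf : Measurable f) {B : ℝ} (hB : ∀ x, |f x| ≤ B) (k : ℤ) :
    ∫⁻ x, ENNReal.ofReal (S.E (k+1) σ x *
        (S.E (k+1) f x / S.E (k+1) σ x - S.E k f x / S.E k σ x) ^ 2) ∂μ
      + ∫⁻ x, ENNReal.ofReal ((S.E k f x) ^ 2 / S.E k σ x) ∂μ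
      ≤ ∫⁻ x, ENNReal.ofReal ((S.E (k+1) f x) ^ 2 / S.E (k+1) σ x) ∂μ := by
  have mF : ∀ k, Measurable (S.E k f) := fun k =>
    (S.stronglyMeasurable_E k hf.stronglyMeasurable).measurable
  have ms : ∀ k, Measurable (S.E k σ) := fun k =>
    (S.stronglyMeasurable_E k h.ms.stronglyMeasurable).measurable
  have hs := h.spos
  have mg1 : Measurable fun x => S.E (k+1) σ x *
        (S.E (k+1) f x / S.E (k+1) σ x - S.E k f x / S.E k σ x) ^ 2 :=
    (ms _).mul ((((mF _).div (ms _)).sub ((mF _).div (ms _))).pow_const 2)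
  have mg2 : ∀ k, Measurable fun x => (S.E k f x) ^ 2 / S.E k σ x :=
    fun k => ((mF _).pow_const 2).div (ms _)
  have p1 : ∀ x, 0 ≤ S.E (k+1) σ x *
        (S.E (k+1) f x / S.E (k+1) σ x - S.E k f x / S.E k σ x) ^ 2 :=
    fun x => mul_nonneg (hs _ _).le (sq_nonneg _)
  have p2 : ∀ k x, 0 ≤ (S.E k f x) ^ 2 / S.E k σ x := fun k x => div_nonneg (sq_nonneg _) (hs _ _).le
  rw [← lintegral_add_left mg1.ennreal_ofReal]
  simp_rw [← ENNReal.ofReal_add (p1 _) (p2 k _)]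
  -- integrability on cells
  have iF : ∀ x, IntegrableOn (S.E (k+1) f) (S.cell k x) μ := fun x =>
    S.integrableOn_of_bdd (mF _).aestronglyMeasurable B
      (Filter.Eventually.of_forall fun y _ => S.E_abs_le hB y)
  have is : ∀ x, IntegrableOn (S.E (k+1) σ) (S.cell k x) μ := fun x =>
    S.integrableOn_of_bdd (ms _).aestronglyMeasurable (S.D * S.E k σ x)
      (Filter.Eventually.of_forall fun y hy => by
        rw [Real.norm_of_nonneg (hs _ _).le]
        exact S.E_child_le h.s0 (h.is k x) hy)
  have ih : ∀ x, IntegrableOn (fun x => (S.E (k+1) f x) ^ 2 / S.E (k+1) σ x) (S.cell k x) μ := fun x =>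
    S.integrableOn_of_bdd (mg2 _).aestronglyMeasurable (B ^ 2 * (S.D * S.E k w x))
      (Filter.Eventually.of_forall fun y hy => by
        rw [Real.norm_of_nonneg (p2 _ _), div_eq_mul_inv]
        refine mul_le_mul ?_ (h.inv_child hy) (inv_nonneg.2 (hs _ _).le) (sq_nonneg _)
        exact sq_le_sq' (by linarith [abs_le.1 (S.E_abs_le (k := k+1) hB y)])
          (abs_le.1 (S.E_abs_le (k := k+1) hB y)).2)
  have key : ∀ x, ∀ y ∈ S.cell k x, S.E (k+1) σ y *
        (S.E (k+1) f y / S.E (k+1) σ y - S.E k f y / S.E k σ y) ^ 2 + (S.E k f y) ^ 2 / S.E k σ y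
      = ((S.E (k+1) f y) ^ 2 / S.E (k+1) σ y - 2 * (S.E k f x / S.E k σ x) * S.E (k+1) f y)
        + ((S.E k f x / S.E k σ x) ^ 2 * S.E (k+1) σ y + (S.E k f x) ^ 2 / S.E k σ x) := by
    intro x y hy
    rw [S.E_congr k f hy, S.E_congr k σ hy]
    have := (hs (k+1) y).ne'
    have := (hs k x).ne'
    field_simp
    ring
  have ic : ∀ x, IntegrableOn (fun _ : X => (S.E k f x) ^ 2 / S.E k σ x) (S.cell k x) μ :=
    fun x => integrableOn_const (S.vol_lt_top k x).ne
  have i1 : ∀ x, IntegrableOn (fun y => (S.E (k+1) f y) ^ 2 / S.E (k+1) σ y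
      - 2 * (S.E k f x / S.E k σ x) * S.E (k+1) f y) (S.cell k x) μ :=
    fun x => (ih x).sub ((iF x).const_mul _)
  have i2 : ∀ x, IntegrableOn (fun y => (S.E k f x / S.E k σ x) ^ 2 * S.E (k+1) σ y
      + (S.E k f x) ^ 2 / S.E k σ x) (S.cell k x) μ :=
    fun x => ((is x).const_mul _).add (ic x)
  refine S.lintegral_le_of_E k (mg1.add (mg2 k)) (mg2 _) (fun x => add_nonneg (p1 x) (p2 _ x))
    (p2 _) (fun x => ?_) ih (fun x => ?_)
  · exact ((i1 x).add (i2 x)).congr_fun (fun y hy => (key x y hy).symm) (S.meas_cell k x)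
  · have i0 : ∀ x, IntegrableOn f (S.cell k x) μ := fun x =>
      S.integrableOn_of_bdd hf.aestronglyMeasurable B (Filter.Eventually.of_forall fun y _ => hB y)
    rw [S.E_congr_on (key x), S.E_add (i1 x) (i2 x), S.E_sub (ih x) ((iF x).const_mul _),
      S.E_add ((is x).const_mul _) (ic x), S.E_const, S.E_const_mul, S.E_const_mul,
      S.E_tower (by omega) x (i0 x), S.E_tower (by omega) x (h.is k x)]
    have := (hs k x).ne'
    apply le_of_eq
    field_simp
    ring

lemma tele2 (h : S.Wt w σ Q r Cr) [SFinite μ] {f : X → ℝ} (hf : Measurable f) {B : ℝ} (hB : ∀ x, |f x| ≤ B) (k : ℤ) :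
    ∫⁻ x, ENNReal.ofReal ((S.E k f x / Nn S σ k x) ^ 2 / ((1 + √S.D) ^ 2 * S.E k σ x) *
        (S.E (k+1) σ x - S.E k σ x) ^ 2) ∂μ
      + ∫⁻ x, ENNReal.ofReal ((S.E k f x) ^ 2 / Nn S σ k x) ∂μ
      ≤ ∫⁻ x, ENNReal.ofReal ((S.E (k+1) f x) ^ 2 / Nn S σ (k+1) x) ∂μ := by
  have mF : ∀ k, Measurable (S.E k f) := fun k =>
    (S.stronglyMeasurable_E k hf.stronglyMeasurable).measurable
  have ms : ∀ k, Measurable (S.E k σ) := fun k =>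
    (S.stronglyMeasurable_E k h.ms.stronglyMeasurable).measurable
  have ml : ∀ k, Measurable (S.E k (fun y => σ y * Real.log (σ y))) := fun k =>
    (S.stronglyMeasurable_E k (h.ms.mul (Real.measurable_log.comp h.ms)).stronglyMeasurable).measurable
  have mN : ∀ k, Measurable (Nn S σ k) := fun k =>
    (ms k).add ((ml k).sub ((ms k).mul (Real.measurable_log.comp (ms k))))
  have hs := h.spos
  have hN : ∀ k x, 0 < Nn S σ k x := fun k x => (hs k x).trans_le (h.Nn_lower k x)
  set c0 := (1 + √S.D) ^ 2 with hc0
  have hc0p : 0 < c0 := by positivity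
  have mg1 : Measurable fun x => (S.E k f x / Nn S σ k x) ^ 2 / (c0 * S.E k σ x) *
        (S.E (k+1) σ x - S.E k σ x) ^ 2 :=
    ((((mF k).div (mN k)).pow_const 2).div ((ms k).const_mul _)).mul
      (((ms _).sub (ms _)).pow_const 2)
  have mg2 : ∀ k, Measurable fun x => (S.E k f x) ^ 2 / Nn S σ k x :=
    fun k => ((mF _).pow_const 2).div (mN _)
  have p1 : ∀ x, 0 ≤ (S.E k f x / Nn S σ k x) ^ 2 / (c0 * S.E k σ x) *
        (S.E (k+1) σ x - S.E k σ x) ^ 2 := fun x =>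
    mul_nonneg (div_nonneg (sq_nonneg _) (mul_nonneg hc0p.le (hs _ _).le)) (sq_nonneg _)
  have p2 : ∀ k x, 0 ≤ (S.E k f x) ^ 2 / Nn S σ k x := fun k x => div_nonneg (sq_nonneg _) (hN _ _).le
  rw [← lintegral_add_left mg1.ennreal_ofReal]
  simp_rw [← ENNReal.ofReal_add (p1 _) (p2 k _)]
  have iF : ∀ x, IntegrableOn (S.E (k+1) f) (S.cell k x) μ := fun x =>
    S.integrableOn_of_bdd (mF _).aestronglyMeasurable B
      (Filter.Eventually.of_forall fun y _ => S.E_abs_le hB y)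
  have sb : ∀ x, ∀ y ∈ S.cell k x, S.E (k+1) σ y ≤ S.D * S.E k σ x := fun x y hy =>
    S.E_child_le h.s0 (h.is k x) hy
  have is : ∀ x, IntegrableOn (S.E (k+1) σ) (S.cell k x) μ := fun x =>
    S.integrableOn_of_bdd (ms _).aestronglyMeasurable (S.D * S.E k σ x)
      (Filter.Eventually.of_forall fun y hy => by
        rw [Real.norm_of_nonneg (hs _ _).le]
        exact sb x y hy)
  have isl : ∀ x, IntegrableOn (fun y => S.E (k+1) σ y * Real.log (S.E (k+1) σ y)) (S.cell k x) μ :=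
    fun x => S.integrableOn_of_bdd ((ms _).mul (Real.measurable_log.comp (ms _))).aestronglyMeasurable
      (1 + (S.D * S.E k σ x) ^ 2)
      (Filter.Eventually.of_forall fun y hy => by
        refine (abs_xlogx (hs _ _).le).trans ?_
        have := sb x y hy
        have := hs (k+1) y
        gcongr)
  have iN : ∀ x, IntegrableOn (Nn S σ (k+1)) (S.cell k x) μ := fun x =>
    S.integrableOn_of_bdd (mN _).aestronglyMeasurable ((1 + Cr / (r - 1)) * (S.D * S.E k σ x))
      (Filter.Eventually.of_forall fun y hy => by
        rw [Real.norm_of_nonneg (hN _ _).le]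
        refine (h.Nn_upper _ _).trans (mul_le_mul_of_nonneg_left (sb x y hy) ?_)
        have := h.Cr_nonneg x
        have : 0 < r - 1 := by linarith [h.r1]
        positivity)
  have il : ∀ x, IntegrableOn (S.E (k+1) (fun y => σ y * Real.log (σ y))) (S.cell k x) μ := by
    intro x
    have := ((iN x).sub (is x)).add (isl x)
    refine this.congr_fun (fun y _ => ?_) (S.meas_cell k x)
    simp only [Pi.add_apply, Pi.sub_apply, Nn]; ring
  have ih : ∀ x, IntegrableOn (fun x => (S.E (k+1) f x) ^ 2 / Nn S σ (k+1) x) (S.cell k x) μ := fun x =>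
    S.integrableOn_of_bdd (mg2 _).aestronglyMeasurable (B ^ 2 * (S.D * S.E k w x))
      (Filter.Eventually.of_forall fun y hy => by
        rw [Real.norm_of_nonneg (p2 _ _), div_eq_mul_inv]
        refine mul_le_mul ?_ ((inv_anti₀ (hs _ _) (h.Nn_lower _ _)).trans (h.inv_child hy))
          (inv_nonneg.2 (hN _ _).le) (sq_nonneg _)
        exact sq_le_sq' (by linarith [abs_le.1 (S.E_abs_le (k := k+1) hB y)])
          (abs_le.1 (S.E_abs_le (k := k+1) hB y)).2)
  have iq : ∀ x, IntegrableOn (fun y => (S.E (k+1) σ y - S.E k σ x) ^ 2) (S.cell k x) μ := fun x =>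
    S.integrableOn_of_bdd (((ms _).sub_const _).pow_const 2).aestronglyMeasurable
      ((S.D * S.E k σ x) ^ 2 + (S.E k σ x) ^ 2)
      (Filter.Eventually.of_forall fun y hy => by
        rw [Real.norm_of_nonneg (sq_nonneg _)]
        have := sb x y hy
        have := hs (k+1) y
        have := hs k x
        nlinarith)
  have ic : ∀ (x : X) (c : ℝ), IntegrableOn (fun _ : X => c) (S.cell k x) μ :=
    fun x c => integrableOn_const (S.vol_lt_top k x).ne
  have key : ∀ x, ∀ y ∈ S.cell k x, (S.E k f y / Nn S σ k y) ^ 2 / (c0 * S.E k σ y) *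
        (S.E (k+1) σ y - S.E k σ y) ^ 2 + (S.E k f y) ^ 2 / Nn S σ k y
      = ((S.E k f x / Nn S σ k x) ^ 2 / (c0 * S.E k σ x)) * (S.E (k+1) σ y - S.E k σ x) ^ 2
        + (S.E k f x) ^ 2 / Nn S σ k x := by
    intro x y hy
    have : Nn S σ k y = Nn S σ k x := by
      unfold Nn; rw [S.E_congr k σ hy, S.E_congr k _ hy]
    rw [S.E_congr k f hy, S.E_congr k σ hy, this]
  have i0 : ∀ x, IntegrableOn f (S.cell k x) μ := fun x =>
    S.integrableOn_of_bdd hf.aestronglyMeasurable B (Filter.Eventually.of_forall fun y _ => hB y)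
  refine S.lintegral_le_of_E k (mg1.add (mg2 k)) (mg2 _) (fun x => add_nonneg (p1 x) (p2 _ x))
    (p2 _) (fun x => ?_) ih (fun x => ?_)
  · have i6 : IntegrableOn (fun y => ((S.E k f x / Nn S σ k x) ^ 2 / (c0 * S.E k σ x)) *
        (S.E (k+1) σ y - S.E k σ x) ^ 2 + (S.E k f x) ^ 2 / Nn S σ k x) (S.cell k x) μ :=
      ((iq x).const_mul _).add (ic x _)
    exact i6.congr_fun (fun y hy => (key x y hy).symm) (S.meas_cell k x)
  · rw [S.E_congr_on (key x), S.E_add ((iq x).const_mul _) (ic x _), S.E_const, S.E_const_mul]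
    set s := S.E k σ x with hsx
    set N := Nn S σ k x with hNx
    set F := S.E k f x with hFx
    have hsp : 0 < s := hs k x
    have hNp : 0 < N := hN k x
    set lam := F / N with hlam
    -- lower bound for `E (F'^2/N')`
    have h1 : S.E k (fun y => 2 * lam * S.E (k+1) f y - lam ^ 2 * Nn S σ (k+1) y) x
        ≤ S.E k (fun y => (S.E (k+1) f y) ^ 2 / Nn S σ (k+1) y) x := by
      refine S.E_mono_ae (((iF x).const_mul _).sub ((iN x).const_mul _)) (ih x)
        (Filter.Eventually.of_forall fun y _ => ?_)
      rw [le_div_iff₀ (hN _ _)]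
      nlinarith [sq_nonneg (S.E (k+1) f y - lam * Nn S σ (k+1) y)]
    rw [S.E_sub ((iF x).const_mul _) ((iN x).const_mul _), S.E_const_mul, S.E_const_mul,
      S.E_tower (by omega) x (i0 x), ← hFx] at h1
    have h2 : S.E k (Nn S σ (k+1)) x = s + (S.E k (fun y => σ y * Real.log (σ y)) x
        - S.E k (fun y => S.E (k+1) σ y * Real.log (S.E (k+1) σ y)) x) := by
      have : S.E k (Nn S σ (k+1)) x = S.E k (fun y => S.E (k+1) σ y +
        (S.E (k+1) (fun y => σ y * Real.log (σ y)) y - S.E (k+1) σ y * Real.log (S.E (k+1) σ y))) x := rfl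
      have i3 : IntegrableOn (fun y => S.E (k+1) (fun y => σ y * Real.log (σ y)) y
          - S.E (k+1) σ y * Real.log (S.E (k+1) σ y)) (S.cell k x) μ := (il x).sub (isl x)
      rw [this, S.E_add (is x) i3, S.E_sub (il x) (isl x),
        S.E_tower (by omega) x (h.is k x), S.E_tower (by omega) x (h.ilog k x)]
    have h3 : S.E k (fun y => ((Real.log s + 1) * S.E (k+1) σ y - s)
        + 1 / (c0 * s) * (S.E (k+1) σ y - s) ^ 2) x
        ≤ S.E k (fun y => S.E (k+1) σ y * Real.log (S.E (k+1) σ y)) x := by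
      refine S.E_mono_ae ((((is x).const_mul _).sub (ic x s)).add ((iq x).const_mul _)) (isl x)
        (Filter.Eventually.of_forall fun y hy => ?_)
      have ha := hs (k+1) y
      have hb := sb x y hy
      have hx := xlogx_ineq ha.le hsp
      set a := S.E (k+1) σ y
      have q1 : √a ≤ √S.D * √s := by
        rw [← Real.sqrt_mul S.D_pos.le]; exact Real.sqrt_le_sqrt hb
      have e1 : √a * √a = a := Real.mul_self_sqrt ha.le
      have e2 : √s * √s = s := Real.mul_self_sqrt hsp.le
      have e3 : (a - s) ^ 2 = (√a - √s) ^ 2 * (√a + √s) ^ 2 := by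
        rw [← mul_pow]; congr 1; nlinarith
      have e4 : (√a + √s) ^ 2 ≤ c0 * s := by
        have : (√a + √s) ≤ (1 + √S.D) * √s := by nlinarith
        calc (√a + √s) ^ 2 ≤ ((1 + √S.D) * √s) ^ 2 := by gcongr
          _ = c0 * s := by rw [mul_pow, Real.sq_sqrt hsp.le]
      have e5 : 1 / (c0 * s) * (a - s) ^ 2 ≤ (√a - √s) ^ 2 := by
        rw [e3, one_div, inv_mul_le_iff₀ (by positivity), mul_comm (c0 * s)]
        exact mul_le_mul_of_nonneg_left e4 (sq_nonneg _)
      linarith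
    have i4 : IntegrableOn (fun y => (Real.log s + 1) * S.E (k+1) σ y - s) (S.cell k x) μ :=
      ((is x).const_mul _).sub (ic x s)
    have i5 : IntegrableOn (fun y => 1 / (c0 * s) * (S.E (k+1) σ y - s) ^ 2) (S.cell k x) μ :=
      (iq x).const_mul _
    rw [S.E_add i4 i5,
      S.E_sub ((is x).const_mul _) (ic x s), S.E_const, S.E_const_mul, S.E_const_mul,
      S.E_tower (by omega) x (h.is k x), ← hsx] at h3
    have hNe : N = s + (S.E k (fun y => σ y * Real.log (σ y)) x - s * Real.log s) := rfl
    rw [h2] at h1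
    refine le_trans ?_ h1
    set V := S.E k (fun y => (S.E (k+1) σ y - s) ^ 2) x
    set L1 := S.E k (fun y => σ y * Real.log (σ y)) x
    set L2 := S.E k (fun y => S.E (k+1) σ y * Real.log (S.E (k+1) σ y)) x
    have h4 : 1 / (c0 * s) * V ≤ L2 - s * Real.log s := by linarith
    have hF : F = lam * N := by rw [hlam]; field_simp
    have e6 : F ^ 2 / N = lam ^ 2 * N := by rw [hF]; field_simp
    have e7 : lam ^ 2 / (c0 * s) * V = lam ^ 2 * (1 / (c0 * s) * V) := by ring
    rw [e6, e7]
    have h5 := mul_le_mul_of_nonneg_left h4 (sq_nonneg lam)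
    have e8 : 2 * lam * F = 2 * lam ^ 2 * N := by rw [hF]; ring
    rw [e8]
    have e9 : lam ^ 2 * (s + (L1 - L2)) = lam ^ 2 * N - lam ^ 2 * (L2 - s * Real.log s) := by
      rw [hNe]; ring
    rw [e9]
    linarith

end Wt
end DySys
end LP

open MeasureTheory
set_option linter.all false

namespace LP
namespace DySys

variable {X : Type*} [MeasurableSpace X] {μ : Measure X} (S : DySys X μ)

lemma ofReal_integral_le {ν : Measure X} {g : X → ℝ} (hg : Integrable g ν) :
    ENNReal.ofReal (∫ x, g x ∂ν) ≤ ∫⁻ x, ENNReal.ofReal (g x) ∂ν := by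
  have h1 : ∫ x, g x ∂ν ≤ ∫ x, max (g x) 0 ∂ν :=
    integral_mono hg hg.pos_part fun x => le_max_left _ _
  refine (ENNReal.ofReal_le_ofReal h1).trans ?_
  rw [ofReal_integral_eq_lintegral_ofReal hg.pos_part
    (Filter.Eventually.of_forall fun x => le_max_right _ _)]
  exact lintegral_mono fun x => by simp

lemma ofReal_E_le {k : ℤ} {g : X → ℝ} {x : X} (hg : IntegrableOn g (S.cell k x) μ) :
    ENNReal.ofReal (S.E k g x) ≤ S.A k (fun y => ENNReal.ofReal (g y)) x := by
  unfold E A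
  rw [smul_eq_mul, ENNReal.ofReal_mul (inv_nonneg.2 (S.m_pos k).le),
    ENNReal.ofReal_inv_of_pos (S.m_pos k)]
  gcongr
  exact ofReal_integral_le hg

lemma tele_sum {T a : ℤ → ENNReal} (h : ∀ k, T k + a k ≤ a (k+1)) (b : ℤ) (N : ℕ) :
    ∑ i ∈ Finset.range N, T (b + i) ≤ a (b + N) := by
  suffices H : ∑ i ∈ Finset.range N, T (b + i) + a b ≤ a (b + N) from le_self_add.trans H
  induction N with
  | zero => simp
  | succ N ih =>
    rw [Finset.sum_range_succ]
    calc _ = T (b + N) + (∑ i ∈ Finset.range N, T (b + i) + a b) := by ring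
      _ ≤ T (b + N) + a (b + N) := by gcongr
      _ ≤ a (b + N + 1) := h _
      _ = _ := by push_cast; rw [add_assoc]

namespace Wt
variable {S} {w σ : X → ℝ} {Q r Cr : ℝ}

lemma terminal (h : S.Wt w σ Q r Cr) [SFinite μ] {f : X → ℝ} (hf : Measurable f) {B : ℝ} (hB : ∀ x, |f x| ≤ B) (k : ℤ) :
    ∫⁻ x, ENNReal.ofReal ((S.E k f x) ^ 2 / S.E k σ x) ∂μ
      ≤ ∫⁻ x, ENNReal.ofReal (f x ^ 2 * w x) ∂μ := by
  have mfw : Measurable fun x => ENNReal.ofReal (f x ^ 2 * w x) :=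
    ((hf.pow_const 2).mul h.mw).ennreal_ofReal
  rw [← S.lintegral_A k mfw]
  refine lintegral_mono fun x => ?_
  have i0 : IntegrableOn f (S.cell k x) μ :=
    S.integrableOn_of_bdd hf.aestronglyMeasurable B (Filter.Eventually.of_forall fun y _ => hB y)
  set lam := S.E k f x / S.E k σ x with hlam
  have hs := h.spos k x
  have i1 : IntegrableOn (fun y => 2 * lam * f y - lam ^ 2 * σ y) (S.cell k x) μ :=
    (i0.const_mul _).sub ((h.is k x).const_mul _)
  have e : S.E k f x ^ 2 / S.E k σ x = S.E k (fun y => 2 * lam * f y - lam ^ 2 * σ y) x := by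
    rw [S.E_sub (i0.const_mul _) ((h.is k x).const_mul _), S.E_const_mul, S.E_const_mul, hlam]
    field_simp; ring
  simp only
  rw [e]
  refine (S.ofReal_E_le i1).trans ?_
  unfold A
  refine mul_le_mul_right ?_ _
  refine lintegral_mono_ae (ae_restrict_of_ae ?_)
  filter_upwards [h.one] with y hy
  apply ENNReal.ofReal_le_ofReal
  have hw : 0 < w y := lt_of_le_of_ne (h.w0 y) (fun h' => by rw [← h'] at hy; simp at hy)
  have : σ y = 1 / w y := by field_simp; linarith
  rw [this]
  have e2 : f y ^ 2 * w y - (2 * lam * f y - lam ^ 2 * (1 / w y))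
    = (f y * w y - lam) ^ 2 / w y := by field_simp; ring
  have : 0 ≤ (f y * w y - lam) ^ 2 / w y := by positivity
  linarith

lemma Q_pos (h : S.Wt w σ Q r Cr) (x : X) : 0 < Q := by
  have h1 := h.A2 0 x
  have h2 := (h.lower 0 x).2
  linarith

lemma dyadic_pt (h : S.Wt w σ Q r Cr) (k : ℤ) (f : X → ℝ) (x : X) :
    (S.E (k+1) f x - S.E k f x) ^ 2 * S.E (k+1) w x
     ≤ 2 * Q * (S.E (k+1) σ x *
        (S.E (k+1) f x / S.E (k+1) σ x - S.E k f x / S.E k σ x) ^ 2)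
      + 2 * (1 + Cr / (r - 1)) ^ 2 * S.D * Q * (1 + √S.D) ^ 2 *
        ((S.E k f x / Nn S σ k x) ^ 2 / ((1 + √S.D) ^ 2 * S.E k σ x) *
        (S.E (k+1) σ x - S.E k σ x) ^ 2) := by
  have hs := h.spos k x
  have hs' := h.spos (k+1) x
  have hw' := (h.lower (k+1) x).1
  have hw := (h.lower k x).1
  have ha := h.A2 k x
  have ha' := h.A2 (k+1) x
  have hd := S.E_child_le (k := k) h.w0 (h.iw k x) (S.mem_self k x)
  have hN1 := h.Nn_lower k x
  have hN2 := h.Nn_upper k x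
  have hQ := h.Q_pos x
  have hD := S.D_pos
  set s := S.E k σ x
  set s' := S.E (k+1) σ x
  set W := S.E k w x
  set W' := S.E (k+1) w x
  set N := Nn S σ k x
  set F := S.E k f x
  set F' := S.E (k+1) f x
  set K := 1 + Cr / (r - 1)
  have hN : 0 < N := hs.trans_le hN1
  have e1 : (F' - F) = (F' / s' - F / s) * s' + (F / s) * (s' - s) := by field_simp; ring
  have h1 : (F' - F) ^ 2 ≤ 2 * ((F' / s' - F / s) ^ 2 * s' ^ 2) + 2 * ((F / s) ^ 2 * (s' - s) ^ 2) := by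
    rw [e1]; nlinarith [sq_nonneg ((F' / s' - F / s) * s' - (F / s) * (s' - s))]
  have h2 : (F' / s' - F / s) ^ 2 * s' ^ 2 * W' ≤ Q * (s' * (F' / s' - F / s) ^ 2) := by
    have : 0 ≤ s' * (F' / s' - F / s) ^ 2 := by positivity
    nlinarith
  have h3 : (F / s) ^ 2 * W' ≤ K ^ 2 * S.D * Q * (F / N) ^ 2 / s := by
    rw [le_div_iff₀ hs]
    have h31 : W' * s ≤ S.D * Q := by
      calc W' * s ≤ S.D * W * s := by gcongr
        _ = S.D * (W * s) := by ring
        _ ≤ _ := by gcongr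
    have h32 : (F / s) ^ 2 ≤ K ^ 2 * (F / N) ^ 2 := by
      rw [← mul_pow]
      apply sq_le_sq.2
      rw [abs_div, abs_mul, abs_div, abs_of_pos hs, abs_of_pos hN]
      have hK : 0 ≤ K := by nlinarith
      rw [abs_of_nonneg hK, div_le_iff₀ hs]
      have : K * (|F| / N) * s = |F| * (K * s / N) := by ring
      rw [this]
      have : 1 ≤ K * s / N := by rw [le_div_iff₀ hN]; linarith
      nlinarith [abs_nonneg F]
    calc (F / s) ^ 2 * W' * s = (F / s) ^ 2 * (W' * s) := by ring
      _ ≤ (K ^ 2 * (F / N) ^ 2) * (S.D * Q) := by gcongr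
      _ = _ := by ring
  have hc : (1 + √S.D) ≠ 0 := by positivity
  have e3 : 2 * K ^ 2 * S.D * Q * (1 + √S.D) ^ 2 * ((F / N) ^ 2 / ((1 + √S.D) ^ 2 * s) * (s' - s) ^ 2)
    = 2 * ((K ^ 2 * S.D * Q * (F / N) ^ 2 / s) * (s' - s) ^ 2) := by field_simp
  rw [e3]
  have h4 := mul_le_mul_of_nonneg_right h3 (sq_nonneg (s' - s))
  have h5 := mul_le_mul_of_nonneg_right h1 hw'.le
  nlinarith

/-- constant -/
noncomputable def _root_.LP.Cdy (Q r Cr D : ℝ) : ℝ :=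
  2 * Q + 2 * (1 + Cr / (r - 1)) ^ 2 * D * Q * (1 + √D) ^ 2

lemma dyadic_fin (h : S.Wt w σ Q r Cr) [SFinite μ] {f : X → ℝ} (hf : Measurable f) {B : ℝ} (hB : ∀ x, |f x| ≤ B)
    (a : ℤ) (N : ℕ) :
    ∑ i ∈ Finset.range N, ∫⁻ x, ENNReal.ofReal ((S.E (a+i+1) f x - S.E (a+i) f x) ^ 2)
        * ENNReal.ofReal (w x) ∂μ
      ≤ ENNReal.ofReal (Cdy Q r Cr S.D) * ∫⁻ x, ENNReal.ofReal (f x ^ 2 * w x) ∂μ := by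
  rcases isEmpty_or_nonempty X with hX | ⟨⟨x0⟩⟩
  · simp [lintegral_of_isEmpty]
  have hQ := h.Q_pos x0
  have hD := S.D_pos
  have mF : ∀ k, Measurable (S.E k f) := fun k =>
    (S.stronglyMeasurable_E k hf.stronglyMeasurable).measurable
  have ms : ∀ k, Measurable (S.E k σ) := fun k =>
    (S.stronglyMeasurable_E k h.ms.stronglyMeasurable).measurable
  have t1 := tele_sum (fun k => h.tele1 hf hB k) a N
  have t2 := tele_sum (fun k => h.tele2 hf hB k) a N
  have t1' := t1.trans (h.terminal hf hB _)
  have hle : ∫⁻ x, ENNReal.ofReal ((S.E (a+N) f x) ^ 2 / Nn S σ (a+N) x) ∂μ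
      ≤ ∫⁻ x, ENNReal.ofReal (f x ^ 2 * w x) ∂μ := by
    refine (lintegral_mono fun x => ?_).trans (h.terminal hf hB (a + N))
    apply ENNReal.ofReal_le_ofReal
    exact div_le_div_of_nonneg_left (sq_nonneg _) (h.spos _ _) (h.Nn_lower _ _)
  have t2' := t2.trans hle
  set K2 := 2 * (1 + Cr / (r - 1)) ^ 2 * S.D * Q * (1 + √S.D) ^ 2 with hK2
  have hK2p : 0 ≤ K2 := by positivity
  have step : ∀ k, ∫⁻ x, ENNReal.ofReal ((S.E (k+1) f x - S.E k f x) ^ 2)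
        * ENNReal.ofReal (w x) ∂μ ≤
      ENNReal.ofReal (2 * Q) * ∫⁻ x, ENNReal.ofReal (S.E (k+1) σ x *
        (S.E (k+1) f x / S.E (k+1) σ x - S.E k f x / S.E k σ x) ^ 2) ∂μ
      + ENNReal.ofReal K2 * ∫⁻ x, ENNReal.ofReal ((S.E k f x / Nn S σ k x) ^ 2 / ((1 + √S.D) ^ 2 * S.E k σ x) *
        (S.E (k+1) σ x - S.E k σ x) ^ 2) ∂μ := by
    intro k
    have md : Measurable fun x => ENNReal.ofReal ((S.E (k+1) f x - S.E k f x) ^ 2) :=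
      (((mF _).sub (mF _)).pow_const 2).ennreal_ofReal
    simp_rw [mul_comm _ (ENNReal.ofReal (w _))]
    rw [← S.lintegral_A_mul (k+1) h.mw.ennreal_ofReal md (fun x y hy => by
      rw [S.E_congr (k+1) f hy, S.E_congr k f (S.nested k x hy)])]
    rw [← lintegral_const_mul' _ _ ENNReal.ofReal_ne_top, ← lintegral_const_mul' _ _ ENNReal.ofReal_ne_top,
      ← lintegral_add_left]
    · refine lintegral_mono fun x => ?_
      simp only
      have hs' := h.spos (k+1) x
      have hs := h.spos k x
      rw [S.A_ofReal (k+1) h.w0 x (h.iw _ x), ← ENNReal.ofReal_mul (h.lower _ _).1.le,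
        ← ENNReal.ofReal_mul (by positivity), ← ENNReal.ofReal_mul hK2p,
        ← ENNReal.ofReal_add (by positivity) (by positivity)]
      apply ENNReal.ofReal_le_ofReal
      rw [mul_comm]
      exact h.dyadic_pt k f x
    · exact (((ms _).mul ((((mF _).div (ms _)).sub ((mF _).div (ms _))).pow_const 2)).ennreal_ofReal).const_mul _
  refine (Finset.sum_le_sum fun (i : ℕ) _ => step (a + i)).trans ?_
  rw [Finset.sum_add_distrib, ← Finset.mul_sum, ← Finset.mul_sum]
  refine (add_le_add (mul_le_mul_right t1' _) (mul_le_mul_right t2' _)).trans ?_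
  rw [← add_mul, ← ENNReal.ofReal_add (by positivity) hK2p]
  rfl

lemma dyadic_real (h : S.Wt w σ Q r Cr) [SFinite μ] {f : X → ℝ} (hf : Measurable f) {B : ℝ} (hB : ∀ x, |f x| ≤ B) :
    ∑' k : ℤ, ∫⁻ x, ENNReal.ofReal ((S.E (k+1) f x - S.E k f x) ^ 2)
        * ENNReal.ofReal (w x) ∂μ
      ≤ ENNReal.ofReal (Cdy Q r Cr S.D) * ∫⁻ x, ENNReal.ofReal (f x ^ 2) * ENNReal.ofReal (w x) ∂μ := by
  simp_rw [← ENNReal.ofReal_mul (sq_nonneg (f _))]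
  rw [ENNReal.tsum_eq_iSup_sum]
  refine iSup_le fun s => ?_
  obtain ⟨a, N, hs⟩ : ∃ (a : ℤ) (N : ℕ), s ⊆ (Finset.range N).image (fun i : ℕ => a + (i:ℤ)) := by
    obtain ⟨a, ha⟩ := s.bddBelow
    obtain ⟨b, hb⟩ := s.bddAbove
    refine ⟨a, (b - a).toNat + 1, fun k hk => ?_⟩
    have h1 := ha hk
    have h2 := hb hk
    simp only [Finset.mem_image, Finset.mem_range]
    exact ⟨(k - a).toNat, by omega, by omega⟩
  refine (Finset.sum_le_sum_of_subset hs).trans ?_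
  rw [Finset.sum_image (by intro i _ j _ hij; simpa using hij)]
  exact h.dyadic_fin hf hB a N

lemma enorm_sq_eq (h : S.Wt w σ Q r Cr) (z : ℂ) : ‖z‖ₑ ^ 2 = ENNReal.ofReal (z.re ^ 2) + ENNReal.ofReal (z.im ^ 2) := by
  rw [← ENNReal.ofReal_add (sq_nonneg _) (sq_nonneg _), ← ofReal_norm, ← ENNReal.ofReal_pow (norm_nonneg _),
    Complex.sq_norm, Complex.normSq_apply]
  congr 1; ring

lemma dyadic_complex (h : S.Wt w σ Q r Cr) [SFinite μ] {f : X → ℂ} (hf : Measurable f) {B : ℝ} (hB : ∀ x, ‖f x‖ ≤ B) :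
    ∑' k : ℤ, ∫⁻ x, ‖S.E (k+1) f x - S.E k f x‖ₑ ^ 2 * ENNReal.ofReal (w x) ∂μ
      ≤ ENNReal.ofReal (Cdy Q r Cr S.D) * ∫⁻ x, ‖f x‖ₑ ^ 2 * ENNReal.ofReal (w x) ∂μ := by
  have mr : Measurable fun x => (f x).re := Complex.measurable_re.comp hf
  have mi : Measurable fun x => (f x).im := Complex.measurable_im.comp hf
  have i0 : ∀ k x, IntegrableOn f (S.cell k x) μ := fun k x =>
    S.integrableOn_of_bdd hf.aestronglyMeasurable B (Filter.Eventually.of_forall fun y _ => hB y)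
  have er : ∀ k x, (S.E k f x).re = S.E k (fun y => (f y).re) x := by
    intro k x
    unfold E
    rw [Complex.smul_re]
    congr 1
    exact (Complex.reCLM.integral_comp_comm (i0 k x)).symm
  have ei : ∀ k x, (S.E k f x).im = S.E k (fun y => (f y).im) x := by
    intro k x
    unfold E
    rw [Complex.smul_im]
    congr 1
    exact (Complex.imCLM.integral_comp_comm (i0 k x)).symm
  have mF : ∀ k, Measurable (S.E k (fun y => (f y).re)) := fun k =>
    (S.stronglyMeasurable_E k mr.stronglyMeasurable).measurable
  simp_rw [enorm_sq_eq h, Complex.sub_re, Complex.sub_im, er, ei, add_mul]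
  have m1 : ∀ k, Measurable fun x => ENNReal.ofReal ((S.E (k+1) (fun y => (f y).re) x - S.E k (fun y => (f y).re) x) ^ 2)
     * ENNReal.ofReal (w x) := fun k => (((mF _).sub (mF _)).pow_const 2).ennreal_ofReal.mul h.mw.ennreal_ofReal
  simp_rw [lintegral_add_left (m1 _)]
  have m2 : Measurable fun x => ENNReal.ofReal ((f x).re ^ 2) * ENNReal.ofReal (w x) :=
    (mr.pow_const 2).ennreal_ofReal.mul h.mw.ennreal_ofReal
  rw [ENNReal.tsum_add, lintegral_add_left m2, mul_add]
  exact add_le_add (h.dyadic_real mr (B := B) fun x => (Complex.abs_re_le_norm _).trans (hB x))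
    (h.dyadic_real mi (B := B) fun x => (Complex.abs_im_le_norm _).trans (hB x))

end Wt
end DySys
end LP

open MeasureTheory
set_option linter.all false

namespace LP

lemma young_max {q : ℝ} (hq : 1 < q) (a s : ENNReal) :
    (max s a) ^ q + ENNReal.ofReal (q / (q-1)) * (a * s ^ (q-1))
      ≤ s ^ q + ENNReal.ofReal (q / (q-1)) * (a * (max s a) ^ (q-1)) := by
  have hq1 : 0 < q - 1 := by linarith
  have hq0 : 0 < q := by linarith
  rcases le_total a s with h | h
  · rw [max_eq_left h]
  · rw [max_eq_right h]
    have hc : Real.HolderConjugate q (q / (q-1)) := Real.HolderConjugate.conjExponent hq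
    have hy := ENNReal.young_inequality a (s ^ (q-1)) hc
    rw [← ENNReal.rpow_mul] at hy
    have e1 : (q-1) * (q/(q-1)) = q := by field_simp
    rw [e1] at hy
    have e2 : a * a ^ (q-1) = a ^ q := by
      nth_rw 1 [← ENNReal.rpow_one a]
      rw [← ENNReal.rpow_add_of_nonneg _ _ zero_le_one hq1.le]; congr 1; ring
    rw [e2]
    set c := ENNReal.ofReal (q / (q-1)) with hcdef
    have hc0 : c ≠ 0 := by rw [hcdef]; simp; positivity
    have hct : c ≠ ⊤ := ENNReal.ofReal_ne_top
    have e3 : c / ENNReal.ofReal q = ENNReal.ofReal (1 / (q-1)) := by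
      rw [hcdef, ← ENNReal.ofReal_div_of_pos hq0]; congr 1; field_simp
    have e4 : c = 1 + ENNReal.ofReal (1/(q-1)) := by
      rw [hcdef, ← ENNReal.ofReal_one, ← ENNReal.ofReal_add zero_le_one (by positivity)]
      congr 1; field_simp; ring
    calc a ^ q + c * (a * s ^ (q-1)) ≤ a ^ q + c * (a ^ q / ENNReal.ofReal q + s ^ q / c) := by gcongr
      _ = a ^ q + ((c / ENNReal.ofReal q) * a ^ q + s ^ q) := by
        rw [mul_add, ENNReal.mul_div_cancel hc0 hct]
        congr 2
        rw [div_eq_mul_inv, div_eq_mul_inv]; ring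
      _ = s ^ q + c * a ^ q := by rw [e3, e4]; ring

namespace DySys

variable {X : Type*} [MeasurableSpace X] {μ : Measure X} (S : DySys X μ)

lemma A_rpow_le {q : ℝ} (hq : 1 < q) (k : ℤ) {h : X → ENNReal} (hh : Measurable h) (x : X) :
    (S.A k h x) ^ q ≤ S.A k (fun y => h y ^ q) x := by
  have hq0 : 0 < q := by linarith
  have hc : Real.HolderConjugate q (q / (q-1)) := Real.HolderConjugate.conjExponent hq
  have := ENNReal.lintegral_mul_le_Lp_mul_Lq (μ.restrict (S.cell k x)) hc
    (hh.aemeasurable) (aemeasurable_const (b := (1:ENNReal)))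
  simp only [Pi.mul_apply, mul_one, ENNReal.one_rpow, lintegral_const, one_mul,
    Measure.restrict_apply_univ, S.vol] at this
  unfold A
  set m := ENNReal.ofReal (S.m k) with hm
  have hm0 : m ≠ 0 := by rw [hm]; simpa using S.m_pos k
  have hmt : m ≠ ⊤ := ENNReal.ofReal_ne_top
  calc (m⁻¹ * ∫⁻ y in S.cell k x, h y ∂μ) ^ q
      ≤ (m⁻¹ * ((∫⁻ y in S.cell k x, h y ^ q ∂μ) ^ (1/q) * m ^ (1 / (q/(q-1))))) ^ q := by gcongr
    _ = m⁻¹ * ∫⁻ y in S.cell k x, h y ^ q ∂μ := by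
      rw [ENNReal.mul_rpow_of_nonneg _ _ hq0.le, ENNReal.mul_rpow_of_nonneg _ _ hq0.le,
        ← ENNReal.rpow_mul, ← ENNReal.rpow_mul, one_div_mul_cancel hq0.ne', ENNReal.rpow_one,
        ← ENNReal.rpow_neg_one m, ← ENNReal.rpow_mul]
      have : m ^ (-1 * q) * (∫⁻ y in S.cell k x, h y ^ q ∂μ) * m ^ (1 / (q/(q-1)) * q)
        = (m ^ (-1 * q) * m ^ (1 / (q/(q-1)) * q)) * ∫⁻ y in S.cell k x, h y ^ q ∂μ := by ring
      rw [← mul_assoc, this, ← ENNReal.rpow_add _ _ hm0 hmt]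
      congr 2
      have : q - 1 ≠ 0 := by linarith
      field_simp; ring

/-- partial maximal function -/
noncomputable def Mx (a : ℤ) (N : ℕ) (h : X → ENNReal) (x : X) : ENNReal :=
  (Finset.range (N+1)).sup fun i => S.A (a + i) h x

lemma Mx_succ (a : ℤ) (N : ℕ) (h : X → ENNReal) (x : X) :
    S.Mx a (N+1) h x = max (S.Mx a N h x) (S.A (a + (N+1 : ℕ)) h x) := by
  unfold Mx
  rw [Finset.range_add_one (n := N+1), Finset.sup_insert, sup_comm]

lemma Mx_congr (a : ℤ) (N : ℕ) (h : X → ENNReal) {x y : X} (hy : y ∈ S.cell (a + N) x) :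
    S.Mx a N h y = S.Mx a N h x := by
  unfold Mx
  refine Finset.sup_congr rfl fun i hi => ?_
  apply S.A_congr
  exact S.nested_le (by have := Finset.mem_range.1 hi; omega) x hy

lemma measurable_Mx [SFinite μ] (a : ℤ) (N : ℕ) {h : X → ENNReal} (hh : Measurable h) :
    Measurable (S.Mx a N h) := by
  induction N with
  | zero => 
    have : S.Mx a 0 h = S.A a h := by funext x; simp [Mx]
    rw [this]; exact S.measurable_A a hh
  | succ N ih =>
    have : S.Mx a (N+1) h = fun x => max (S.Mx a N h x) (S.A (a + (N+1 : ℕ)) h x) := by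
      funext x; exact S.Mx_succ a N h x
    rw [this]; exact ih.max (S.measurable_A _ hh)

lemma doob1 [SFinite μ] {q : ℝ} (hq : 1 < q) (a : ℤ) (N : ℕ) {h : X → ENNReal} (hh : Measurable h) :
    ∫⁻ x, (S.Mx a N h x) ^ q ∂μ ≤
      ENNReal.ofReal (q / (q-1)) * ∫⁻ x, h x * (S.Mx a N h x) ^ (q-1) ∂μ := by
  have hq1 : 0 < q - 1 := by linarith
  have sw : ∀ (N : ℕ) (k : ℤ), a + N ≤ k → ∫⁻ x, S.A k h x * (S.Mx a N h x) ^ (q-1) ∂μ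
      = ∫⁻ x, h x * (S.Mx a N h x) ^ (q-1) ∂μ := fun N k hk =>
    S.lintegral_A_mul k hh ((S.measurable_Mx a N hh).pow_const _) (fun x y hy => by
      rw [S.Mx_congr a N h (S.nested_le hk x hy)])
  set c := ENNReal.ofReal (q / (q-1)) with hc
  have hc1 : 1 ≤ c := by
    rw [hc, ← ENNReal.ofReal_one]; apply ENNReal.ofReal_le_ofReal
    rw [le_div_iff₀ hq1]; linarith
  induction N with
  | zero =>
    rw [← sw 0 a (by simp)]
    refine le_trans ?_ (le_mul_of_one_le_left zero_le hc1)
    refine lintegral_mono fun x => ?_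
    have : S.Mx a 0 h x = S.A a h x := by simp [Mx]
    rw [this]
    nth_rw 2 [← ENNReal.rpow_one (S.A a h x)]
    rw [← ENNReal.rpow_add_of_nonneg _ _ zero_le_one hq1.le]
    apply le_of_eq; congr 1; ring
  | succ N ih =>
    by_cases hfin : ∫⁻ x, h x * (S.Mx a N h x) ^ (q-1) ∂μ = ⊤
    · have : ∫⁻ x, h x * (S.Mx a (N+1) h x) ^ (q-1) ∂μ = ⊤ := by
        rw [← top_le_iff, ← hfin]
        refine lintegral_mono fun x => ?_
        gcongr
        rw [S.Mx_succ]; exact le_max_left _ _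
      rw [this, ENNReal.mul_top (by intro h0; rw [h0] at hc1; simp at hc1)]
      exact le_top
    · have hk := sw N (a + (N+1 : ℕ)) (by push_cast; omega)
      have hk' := sw (N+1) (a + (N+1 : ℕ)) le_rfl
      have m1 : Measurable fun x => S.Mx a (N+1) h x ^ q := (S.measurable_Mx a (N+1) hh).pow_const _
      have m2 : Measurable fun x => S.Mx a N h x ^ q := (S.measurable_Mx a N hh).pow_const _
      have hpt : ∫⁻ x, (S.Mx a (N+1) h x) ^ q ∂μ + c * ∫⁻ x, S.A (a + (N+1 : ℕ)) h x * (S.Mx a N h x) ^ (q-1) ∂μ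
        ≤ ∫⁻ x, (S.Mx a N h x) ^ q ∂μ + c * ∫⁻ x, S.A (a + (N+1 : ℕ)) h x * (S.Mx a (N+1) h x) ^ (q-1) ∂μ := by
        rw [← lintegral_const_mul' _ _ ENNReal.ofReal_ne_top, ← lintegral_const_mul' _ _ ENNReal.ofReal_ne_top,
          ← lintegral_add_left m1, ← lintegral_add_left m2]
        refine lintegral_mono fun x => ?_
        simp only [S.Mx_succ]
        exact young_max hq _ _
      rw [hk, hk'] at hpt
      have hfin' : c * ∫⁻ x, h x * (S.Mx a N h x) ^ (q-1) ∂μ ≠ ⊤ := ENNReal.mul_ne_top ENNReal.ofReal_ne_top hfin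
      have h2 : ∫⁻ x, (S.Mx a (N+1) h x) ^ q ∂μ + c * ∫⁻ x, h x * (S.Mx a N h x) ^ (q-1) ∂μ
        ≤ c * ∫⁻ x, h x * (S.Mx a (N+1) h x) ^ (q-1) ∂μ + c * ∫⁻ x, h x * (S.Mx a N h x) ^ (q-1) ∂μ := by
        refine hpt.trans ?_
        rw [add_comm]
        gcongr
      exact (ENNReal.add_le_add_iff_right hfin').1 h2

lemma doob2 [SFinite μ] {q : ℝ} (hq : 1 < q) (a : ℤ) (N : ℕ) {h : X → ENNReal} (hh : Measurable h) :
    ∫⁻ x, (S.Mx a N h x) ^ q ∂μ ≤ ENNReal.ofReal (q / (q-1)) ^ q * ∫⁻ x, h x ^ q ∂μ := by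
  have hq1 : 0 < q - 1 := by linarith
  have hq0 : 0 < q := by linarith
  have hc : Real.HolderConjugate q (q / (q-1)) := Real.HolderConjugate.conjExponent hq
  by_cases hH : ∫⁻ x, h x ^ q ∂μ = ⊤
  · rw [hH, ENNReal.mul_top]
    · exact le_top
    · simp only [ne_eq, ENNReal.rpow_eq_zero_iff, hq0, ENNReal.ofReal_eq_zero, and_true, not_or, not_and]
      push Not
      exact ⟨by positivity, fun h => absurd h ENNReal.ofReal_ne_top⟩
  have hI : ∫⁻ x, (S.Mx a N h x) ^ q ∂μ ≠ ⊤ := by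
    have : ∫⁻ x, (S.Mx a N h x) ^ q ∂μ ≤ ∫⁻ x, ∑ i ∈ Finset.range (N+1), S.A (a + i) (fun y => h y ^ q) x ∂μ := by
      refine lintegral_mono fun x => ?_
      obtain ⟨i, hi, he⟩ := Finset.exists_mem_eq_sup (Finset.range (N+1)) ⟨0, by simp⟩
        (fun i : ℕ => S.A (a + i) h x)
      unfold Mx
      rw [he]
      exact (S.A_rpow_le hq _ hh x).trans
        (Finset.single_le_sum (f := fun i : ℕ => S.A (a + i) (fun y => h y ^ q) x) (fun _ _ => zero_le) hi)
    refine ne_top_of_le_ne_top ?_ this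
    rw [lintegral_finsetSum _ (fun i _ => S.measurable_A _ (hh.pow_const _))]
    simp_rw [S.lintegral_A _ (hh.pow_const q)]
    simp [ENNReal.mul_eq_top, hH]
  have h1 := S.doob1 hq a N hh
  have h2 := ENNReal.lintegral_mul_le_Lp_mul_Lq μ hc hh.aemeasurable
    ((S.measurable_Mx a N hh).pow_const (q-1)).aemeasurable
  simp only [Pi.mul_apply, ← ENNReal.rpow_mul] at h2
  have e1 : (q-1) * (q/(q-1)) = q := by field_simp
  rw [e1] at h2
  set I := ∫⁻ x, (S.Mx a N h x) ^ q ∂μ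
  set H := ∫⁻ x, h x ^ q ∂μ
  set c := ENNReal.ofReal (q / (q-1)) with hc
  by_cases hI0 : I = 0
  · rw [hI0]; exact zero_le
  have h3 : I ≤ c * H ^ (1/q) * I ^ (1 / (q/(q-1))) := by
    refine h1.trans ?_
    rw [mul_assoc]; gcongr
  have e2 : I = I ^ (1/q) * I ^ (1 / (q/(q-1))) := by
    rw [← ENNReal.rpow_add _ _ hI0 hI]
    nth_rw 1 [← ENNReal.rpow_one I]; congr 1; field_simp; ring
  have h4 : I ^ (1/q) ≤ c * H ^ (1/q) := by
    have h3 := e2.symm.le.trans h3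
    refine (ENNReal.mul_le_mul_iff_left ?_ ?_).1 h3
    · simp [ENNReal.rpow_eq_zero_iff, hI0, hI]
    · refine ENNReal.rpow_ne_top_of_nonneg (by positivity) hI
  calc I = (I ^ (1/q)) ^ q := by rw [← ENNReal.rpow_mul, one_div_mul_cancel hq0.ne', ENNReal.rpow_one]
    _ ≤ (c * H ^ (1/q)) ^ q := by gcongr
    _ = c ^ q * H := by
      rw [ENNReal.mul_rpow_of_nonneg _ _ hq0.le, ← ENNReal.rpow_mul, one_div_mul_cancel hq0.ne', ENNReal.rpow_one]

lemma iSup_Mx (h : X → ENNReal) (x : X) : ⨆ k : ℤ, S.A k h x = ⨆ N : ℕ, S.Mx (-N) (2*N) h x := by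
  apply le_antisymm
  · refine iSup_le fun k => ?_
    refine le_trans ?_ (le_iSup _ k.natAbs)
    unfold Mx
    have := Finset.le_sup (f := fun i : ℕ => S.A (-(k.natAbs:ℤ) + i) h x) (s := Finset.range (2*k.natAbs+1))
      (b := (k + k.natAbs).toNat) (by rw [Finset.mem_range]; omega)
    refine le_trans (le_of_eq ?_) this
    congr 1
    omega
  · refine iSup_le fun N => Finset.sup_le fun i _ => le_iSup (fun k : ℤ => S.A k h x) _

theorem doob [SFinite μ] {q : ℝ} (hq : 1 < q) {h : X → ENNReal} (hh : Measurable h) :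
    ∫⁻ x, (⨆ k : ℤ, S.A k h x) ^ q ∂μ ≤ ENNReal.ofReal (q / (q-1)) ^ q * ∫⁻ x, h x ^ q ∂μ := by
  have hq0 : 0 < q := by linarith
  have mono : ∀ x, Monotone fun N : ℕ => S.Mx (-(N:ℤ)) (2*N) h x := by
    intro x N M hNM
    refine Finset.sup_le fun i hi => ?_
    have := Finset.mem_range.1 hi
    refine le_trans (le_of_eq ?_) (Finset.le_sup (f := fun i : ℕ => S.A (-(M:ℤ) + i) h x)
      (b := i + (M - N)) (by rw [Finset.mem_range]; omega))
    congr 1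
    omega
  simp_rw [S.iSup_Mx]
  have e : ∀ x, (⨆ N : ℕ, S.Mx (-N) (2*N) h x) ^ q = ⨆ N : ℕ, (S.Mx (-N) (2*N) h x) ^ q := fun x =>
    (ENNReal.orderIsoRpow q hq0).map_iSup _
  simp_rw [e]
  rw [lintegral_iSup (fun N => (S.measurable_Mx _ _ hh).pow_const q)
    (fun N M hNM x => ENNReal.rpow_le_rpow (mono x hNM) hq0.le)]
  exact iSup_le fun N => S.doob2 hq _ _ hh

end DySys
end LP

open MeasureTheory
set_option linter.all false

namespace LP

/-- offset -/
noncomputable def off (k : ℤ) (b : Bool) : ℝ := (-1:ℝ)^k * (if b then 1 else 0) / 3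

/-- grid index -/
noncomputable def gidx (k : ℤ) (b : Bool) (t : ℝ) : ℤ := ⌊(2:ℝ)^k * t - off k b⌋

lemma neg_one_zpow_int (k : ℤ) : ∃ e : ℤ, (-1:ℝ)^k = e ∧ (e = 1 ∨ e = -1) := by
  rcases Int.even_or_odd k with h | h
  · exact ⟨1, by rw [h.neg_one_zpow]; simp, Or.inl rfl⟩
  · exact ⟨-1, by rw [h.neg_one_zpow]; simp, Or.inr rfl⟩

lemma gidx_nested (k : ℤ) (b : Bool) : ∃ F : ℤ → ℤ, ∀ t, gidx k b t = F (gidx (k+1) b t) := by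
  obtain ⟨e, he, _⟩ := neg_one_zpow_int k
  refine ⟨fun z => (z - e * (if b then 1 else 0)) / 2, fun t => ?_⟩
  unfold gidx off
  have h1 : ((-1:ℝ))^(k+1) = - e := by rw [zpow_add₀ (by norm_num), he]; simp
  have h2 : ((2:ℝ))^(k+1) = 2 * 2^k := by rw [zpow_add₀ (by norm_num)]; ring
  rw [h1, h2, he]
  have := Int.floor_div_natCast (k := ℝ) (((2 * 2^k * t - (-e) * (if b then 1 else 0) / 3)) - ((e * (if b then 1 else 0) : ℤ) : ℝ)) 2
  rw [Int.floor_sub_intCast] at this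
  refine Eq.trans ?_ this
  congr 1
  push_cast
  split_ifs <;> ring

lemma gidx_eq_iff (k : ℤ) (b : Bool) (t : ℝ) (z : ℤ) :
    gidx k b t = z ↔ t ∈ Set.Ico (2^(-k) * (z + off k b)) (2^(-k) * (z + off k b) + 2^(-k)) := by
  unfold gidx
  have h : (0:ℝ) < 2^k := by positivity
  rw [Int.floor_eq_iff, Set.mem_Ico, zpow_neg, inv_mul_le_iff₀ h]
  have : ((2:ℝ)^k)⁻¹ * (z + off k b) + (2^k)⁻¹ = (2^k)⁻¹ * (z + off k b + 1) := by ring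
  rw [this, lt_inv_mul_iff₀ h]
  constructor <;> rintro ⟨h1, h2⟩ <;> constructor <;> linarith

lemma measurable_gidx (k : ℤ) (b : Bool) : Measurable (gidx k b) := by
  unfold gidx
  exact Int.measurable_floor.comp ((measurable_id.const_mul _).sub_const _)

/-- shifted dyadic grid -/
noncomputable def grid (n : ℕ) (α : Fin n → Bool) :
    DySys (EuclideanSpace ℝ (Fin n)) volume where
  cell k x := {y | ∀ i, gidx k (α i) (y i) = gidx k (α i) (x i)}
  m k := (2^(-k))^n
  D := 2^n
  mem_self k x := fun i => rfl
  eq_of_mem k x y h := by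
    ext z
    exact forall_congr' fun i => by rw [h i]
  nested k x := by
    intro y hy i
    obtain ⟨F, hF⟩ := gidx_nested k (α i)
    rw [hF, hF, hy i]
  meas_rel k := by
    have : {p : EuclideanSpace ℝ (Fin n) × EuclideanSpace ℝ (Fin n) | p.2 ∈
        {y : EuclideanSpace ℝ (Fin n) | ∀ i, gidx k (α i) (y i) = gidx k (α i) (p.1 i)}}
        = ⋂ i, {p | gidx k (α i) (p.2 i) = gidx k (α i) (p.1 i)} := by
      ext p; simp
    rw [this]
    refine MeasurableSet.iInter fun i => measurableSet_eq_fun ?_ ?_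
    · exact (measurable_gidx _ _).comp (by fun_prop)
    · exact (measurable_gidx _ _).comp (by fun_prop)
  m_pos k := by positivity
  vol k x := by
    have e : {y : EuclideanSpace ℝ (Fin n) | ∀ i, gidx k (α i) (y i) = gidx k (α i) (x i)}
      = (MeasurableEquiv.toLp 2 (Fin n → ℝ)).symm ⁻¹' (Set.univ.pi fun i =>
        Set.Ico (2^(-k) * (gidx k (α i) (x i) + off k (α i)))
          (2^(-k) * (gidx k (α i) (x i) + off k (α i)) + 2^(-k))) := by
      ext y
      simp only [Set.mem_setOf_eq, Set.mem_preimage, Set.mem_univ_pi, gidx_eq_iff k _ (y _)]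
      rfl
    rw [e, (EuclideanSpace.volume_preserving_symm_measurableEquiv_toLp (Fin n)).measure_preimage
      (MeasurableSet.univ_pi fun i => measurableSet_Ico).nullMeasurableSet, Real.volume_pi_Ico]
    simp only [add_sub_cancel_left, Finset.prod_const, Finset.card_univ, Fintype.card_fin]
    rw [ENNReal.ofReal_pow (by positivity)]
  doubling k := by
    apply le_of_eq
    rw [← mul_pow]
    congr 1
    rw [neg_add, zpow_add₀ (by norm_num)]; norm_num; ring

lemma norm_le_of_coord {n : ℕ} (v : EuclideanSpace ℝ (Fin n)) {c : ℝ} (hc : 0 ≤ c)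
    (h : ∀ i, |v i| ≤ c) : ‖v‖ ≤ n * c := by
  rw [EuclideanSpace.norm_eq]
  apply Real.sqrt_le_iff.2
  refine ⟨by positivity, ?_⟩
  calc ∑ i, ‖v i‖ ^ 2 ≤ ∑ i : Fin n, c ^ 2 := by
        gcongr with i; exact h i
    _ = n * c ^ 2 := by simp
    _ ≤ (n * c) ^ 2 := by
      rw [mul_pow]
      gcongr
      exact_mod_cast Nat.le_self_pow (by norm_num) n

lemma grid_diam {n : ℕ} {α : Fin n → Bool} {k : ℤ} {x y : EuclideanSpace ℝ (Fin n)}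
    (h : y ∈ (grid n α).cell k x) : ‖y - x‖ ≤ n * 2^(-k) := by
  refine norm_le_of_coord _ (by positivity) fun i => ?_
  have h1 := (gidx_eq_iff k (α i) (y i) _).1 (h i)
  have h2 := (gidx_eq_iff k (α i) (x i) _).1 rfl
  rw [PiLp.sub_apply, abs_le]
  constructor <;> linarith [h1.1, h1.2, h2.1, h2.2]

lemma grid_cover {n : ℕ} {k : ℤ} {ρ : ℝ} (hρ : 2^k * ρ ≤ 1/12)
    (x : EuclideanSpace ℝ (Fin n)) : ∃ α : Fin n → Bool, ∀ y, ‖y - x‖ ≤ ρ → y ∈ (grid n α).cell k x := by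
  have h2 : (0:ℝ) < 2^k := by positivity
  suffices H : ∀ i, ∃ b : Bool, ∀ t : ℝ, |t - x i| ≤ ρ → gidx k b t = gidx k b (x i) by
    choose α hα using H
    refine ⟨α, fun y hy i => hα i _ ?_⟩
    exact le_trans (by simpa using PiLp.norm_apply_le (y - x) i) hy
  intro i
  have key : ∀ (b : Bool), (∃ z : ℤ, z + 1/12 ≤ 2^k * x i - off k b ∧ 2^k * x i - off k b < z + 11/12) →
      ∀ t : ℝ, |t - x i| ≤ ρ → gidx k b t = gidx k b (x i) := by
    rintro b ⟨z, hz1, hz2⟩ t ht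
    have h3 : |2^k * t - 2^k * x i| ≤ 1/12 := by
      rw [← mul_sub, abs_mul, abs_of_pos h2]
      exact (mul_le_mul_of_nonneg_left ht h2.le).trans hρ
    have h4 := abs_le.1 h3
    have e1 : gidx k b (x i) = z := Int.floor_eq_iff.2 ⟨by linarith, by linarith⟩
    have e2 : gidx k b t = z := Int.floor_eq_iff.2 ⟨by linarith, by linarith⟩
    rw [e1, e2]
  set u := (2:ℝ)^k * x i with hu
  have f1 := Int.floor_le u
  have f2 := Int.lt_floor_add_one u
  obtain ⟨e, he, he'⟩ := neg_one_zpow_int k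
  have o0 : off k false = 0 := by simp [off]
  have o1 : off k true = e / 3 := by simp [off, he]
  by_cases c1 : ⌊u⌋ + 1/12 ≤ u
  · by_cases c2 : u < ⌊u⌋ + 11/12
    · exact ⟨false, key _ ⟨⌊u⌋, by rw [o0]; linarith, by rw [o0]; linarith⟩⟩
    · refine ⟨true, key _ ?_⟩
      rw [o1]
      rcases he' with rfl | rfl
      · exact ⟨⌊u⌋, by push_cast; linarith, by push_cast; linarith⟩
      · exact ⟨⌊u⌋ + 1, by push_cast; linarith, by push_cast; linarith⟩
  · refine ⟨true, key _ ?_⟩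
    rw [o1]
    rcases he' with rfl | rfl
    · exact ⟨⌊u⌋ - 1, by push_cast; linarith, by push_cast; linarith⟩
    · exact ⟨⌊u⌋, by push_cast; linarith, by push_cast; linarith⟩

end LP

open MeasureTheory
set_option linter.all false

namespace LP

lemma cs_lintegral {X : Type*} [MeasurableSpace X] {μ : Measure X} {f g : X → ENNReal}
    (hf : AEMeasurable f μ) (hg : AEMeasurable g μ) :
    (∫⁻ x, f x * g x ∂μ) ^ 2 ≤ (∫⁻ x, f x ^ 2 ∂μ) * ∫⁻ x, g x ^ 2 ∂μ := by
  have := ENNReal.lintegral_mul_le_Lp_mul_Lq μ Real.HolderConjugate.two_two hf hg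
  simp only [Pi.mul_apply, ENNReal.rpow_two] at this
  calc _ ≤ ((∫⁻ x, f x ^ 2 ∂μ) ^ (1/2:ℝ) * (∫⁻ x, g x ^ 2 ∂μ) ^ (1/2:ℝ)) ^ 2 := by gcongr
    _ = _ := by
      rw [mul_pow, ← ENNReal.rpow_two, ← ENNReal.rpow_two, ← ENNReal.rpow_mul, ← ENNReal.rpow_mul]
      norm_num

lemma cs_tsum {ι : Type*} (w a : ι → ENNReal) :
    (∑' i, w i * a i) ^ 2 ≤ (∑' i, w i) * ∑' i, w i * a i ^ 2 := by
  letI : MeasurableSpace ι := ⊤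
  have hm : ∀ f : ι → ENNReal, Measurable f := fun f => measurable_from_top
  have e : ∀ i, w i = w i ^ (1/2:ℝ) * w i ^ (1/2:ℝ) := fun i => by
    rw [← ENNReal.rpow_add_of_nonneg _ _ (by norm_num) (by norm_num)]; norm_num
  have := cs_lintegral (μ := Measure.count) (f := fun i => w i ^ (1/2:ℝ))
    (g := fun i => w i ^ (1/2:ℝ) * a i) (hm _).aemeasurable (hm _).aemeasurable
  simp only [lintegral_count] at this
  simp only [mul_pow, ← mul_assoc, ← e] at this
  have e2 : ∀ i, (w i ^ (1/2:ℝ)) ^ 2 = w i := fun i => by rw [sq, ← e]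
  simpa only [e2] using this

namespace DySys
variable {X : Type*} [MeasurableSpace X] {μ : Measure X} (S : DySys X μ)

lemma E_mul_const_on {k : ℤ} (f g : X → ℂ) (x : X) (hg : ∀ y ∈ S.cell k x, g y = g x) :
    S.E k (fun y => f y * g y) x = S.E k f x * g x := by
  rw [S.E_congr_on (g := fun y => f y * g x) (fun y hy => by rw [hg y hy])]
  unfold E
  rw [integral_mul_const, smul_mul_assoc]

lemma E_norm_le {k : ℤ} {f : X → ℂ} {B : ℝ} {x : X} (hB : ∀ y ∈ S.cell k x, ‖f y‖ ≤ B) :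
    ‖S.E k f x‖ ≤ B := by
  unfold E
  rw [norm_smul, Real.norm_of_nonneg (inv_pos.2 (S.m_pos k)).le, inv_mul_le_iff₀ (S.m_pos k)]
  have := norm_setIntegral_le_of_norm_le_const (f := f) (C := B) (s := S.cell k x) (μ := μ)
    (S.vol_lt_top k x) (fun y hy => hB y hy)
  rw [S.real_vol] at this
  rw [mul_comm]; exact this

variable {S}

lemma intOn {f : X → ℂ} (hf : Measurable f) {B : ℝ} (hB : ∀ x, ‖f x‖ ≤ B) (k : ℤ) (x : X) :
    IntegrableOn f (S.cell k x) μ :=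
  S.integrableOn_of_bdd hf.aestronglyMeasurable B (Filter.Eventually.of_forall fun y _ => hB y)

variable (S)
lemma measE [SFinite μ] {f : X → ℂ} (hf : Measurable f) (k : ℤ) : Measurable (S.E k f) :=
    (S.stronglyMeasurable_E k hf.stronglyMeasurable).measurable

lemma orth [SFinite μ] {k l : ℤ} (hkl : k ≤ l) {f g : X → ℂ} (hf : Measurable f) (hg : Measurable g)
    {B B' : ℝ} (hB : ∀ x, ‖f x‖ ≤ B) (hB' : ∀ x, ‖g x‖ ≤ B') (x : X) :
    ∫ y in S.cell k x, (S.E (l+1) f y - S.E l f y) * S.E l g y ∂μ = 0 := by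
  have bE : ∀ l y, ‖S.E l f y‖ ≤ B := fun l y => S.E_norm_le fun z _ => hB z
  have bE' : ∀ l y, ‖S.E l g y‖ ≤ B' := fun l y => S.E_norm_le fun z _ => hB' z
  have mD : Measurable fun y => (S.E (l+1) f y - S.E l f y) * S.E l g y :=
    ((S.measE hf _).sub (S.measE hf _)).mul (S.measE hg _)
  have bD : ∀ y, ‖(S.E (l+1) f y - S.E l f y) * S.E l g y‖ ≤ (B + B) * B' := fun y => by
    rw [norm_mul]
    have h1 := norm_sub_le (S.E (l+1) f y) (S.E l f y)
    have h2 := bE (l+1) y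
    have h3 := bE l y
    have h4 := bE' l y
    have h5 := norm_nonneg (S.E l f y)
    gcongr <;> linarith
  have h1 := S.E_tower hkl x (intOn mD bD k x)
  have h2 : ∀ y, S.E l (fun y => (S.E (l+1) f y - S.E l f y) * S.E l g y) y = 0 := by
    intro y
    rw [S.E_mul_const_on (fun y => S.E (l+1) f y - S.E l f y) (S.E l g) y (fun z hz => S.E_congr l g hz),
      S.E_sub (intOn (S.measE hf _) (bE _) l y) (intOn (S.measE hf _) (bE _) l y),
      S.E_tower (by omega) y (intOn hf hB l y), S.E_tower le_rfl y (intOn hf hB l y)]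
    simp
  have h3 : S.E k (S.E l (fun y => (S.E (l+1) f y - S.E l f y) * S.E l g y)) x = 0 := by
    rw [S.E_congr_on (g := fun _ => 0) (fun y _ => h2 y), S.E_const]
  rw [h3] at h1
  unfold E at h1
  have := (smul_eq_zero.1 h1.symm).resolve_left (inv_pos.2 (S.m_pos k)).ne'
  exact this

lemma pairing [SFinite μ] {k : ℤ} {f g : X → ℂ} (hf : Measurable f) (hg : Measurable g)
    {B B' : ℝ} (hB : ∀ x, ‖f x‖ ≤ B) (hB' : ∀ x, ‖g x‖ ≤ B') (x : X)
    (h0 : ∫ y in S.cell k x, g y ∂μ = 0) (ε : ℕ → ℝ)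
    (hε : ∀ (j : ℕ) y, ∀ z ∈ S.cell (k+j) y, ‖g y - g z‖ ≤ ε j)
    (hc : ∀ y, Filter.Tendsto (fun j : ℕ => S.E (k+j) f y) Filter.atTop (nhds (f y))) :
    ‖∫ y in S.cell k x, f y * g y ∂μ‖ₑ ≤
      ∑' j : ℕ, ENNReal.ofReal (ε j) * ∫⁻ y in S.cell k x, ‖S.E (k+j+1) f y - S.E (k+j) f y‖ₑ ∂μ := by
  have bE : ∀ l y, ‖S.E l f y‖ ≤ B := fun l y => S.E_norm_le fun z _ => hB z
  have bE' : ∀ l y, ‖S.E l g y‖ ≤ B' := fun l y => S.E_norm_le fun z _ => hB' z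
  have hB0 : 0 ≤ B := (norm_nonneg _).trans (hB x)
  have ifg : ∀ (l : ℤ), IntegrableOn (fun y => S.E l f y * g y) (S.cell k x) μ := fun l =>
    intOn ((S.measE hf _).mul hg) (B := B * B') (fun y => by
      rw [Pi.mul_apply, norm_mul]; exact mul_le_mul (bE _ _) (hB' _) (norm_nonneg _) hB0) k x
  have ifg' : ∀ (l : ℤ), IntegrableOn (fun y => S.E l f y * S.E l g y) (S.cell k x) μ := fun l =>
    intOn ((S.measE hf _).mul (S.measE hg _)) (B := B * B') (fun y => by
      rw [Pi.mul_apply, norm_mul]; exact mul_le_mul (bE _ _) (bE' _ _) (norm_nonneg _) hB0) k x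
  have ifg'' : ∀ (l : ℤ), IntegrableOn (fun y => S.E (l+1) f y * S.E l g y) (S.cell k x) μ := fun l =>
    intOn ((S.measE hf _).mul (S.measE hg _)) (B := B * B') (fun y => by
      rw [Pi.mul_apply, norm_mul]; exact mul_le_mul (bE _ _) (bE' _ _) (norm_nonneg _) hB0) k x
  have hlim : Filter.Tendsto (fun J : ℕ => ∫ y in S.cell k x, S.E (k+J) f y * g y ∂μ) Filter.atTop
      (nhds (∫ y in S.cell k x, f y * g y ∂μ)) := by
    refine tendsto_integral_of_dominated_convergence (fun _ => B * B')
      (fun J => (ifg (k+J)).1) (integrableOn_const (S.vol_lt_top k x).ne) (fun J => ?_) ?_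
    · refine Filter.Eventually.of_forall fun y => ?_
      rw [norm_mul]; exact mul_le_mul (bE _ _) (hB' _) (norm_nonneg _) hB0
    · exact Filter.Eventually.of_forall fun y => (hc y).mul_const _
  refine le_of_tendsto ((continuous_enorm.tendsto _).comp hlim) (Filter.Eventually.of_forall fun J => ?_)
  simp only [Function.comp]
  have base : ∫ y in S.cell k x, S.E k f y * g y ∂μ = 0 := by
    rw [setIntegral_congr_fun (g := fun y => S.E k f x * g y) (S.meas_cell k x)
      (fun y hy => by simp only; rw [S.E_congr k f hy]), integral_const_mul, h0, mul_zero]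
  refine le_trans ?_ (ENNReal.sum_le_tsum (Finset.range J))
  induction J with
  | zero => simp [base]
  | succ J ih =>
    rw [Finset.sum_range_succ]
    have e : ∫ y in S.cell k x, S.E (k+(J+1:ℕ)) f y * g y ∂μ
      = ∫ y in S.cell k x, S.E (k+J) f y * g y ∂μ
        + ∫ y in S.cell k x, (S.E (k+J+1) f y - S.E (k+J) f y) * (g y - S.E (k+J) g y) ∂μ := by
      have e1 : ∫ y in S.cell k x, (S.E (k+J+1) f y - S.E (k+J) f y) * (g y - S.E (k+J) g y) ∂μ
        = ∫ y in S.cell k x, ((S.E (k+J+1) f y * g y - S.E (k+J) f y * g y)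
          - (S.E (k+J+1) f y - S.E (k+J) f y) * S.E (k+J) g y) ∂μ := by
        congr 1; funext y; ring
      have i1 : IntegrableOn (fun y => S.E (k+J+1) f y * g y - S.E (k+J) f y * g y) (S.cell k x) μ :=
        (ifg _).sub (ifg _)
      have i2 : IntegrableOn (fun y => (S.E (k+J+1) f y - S.E (k+J) f y) * S.E (k+J) g y) (S.cell k x) μ := by
        simp_rw [sub_mul]
        exact (ifg'' _).sub (ifg' _)
      rw [e1, integral_sub i1 i2, S.orth (by omega) hf hg hB hB' x, integral_sub (ifg _) (ifg _)]
      push_cast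
      rw [← add_assoc]; ring
    rw [e]
    refine (enorm_add_le _ _).trans (add_le_add ih ?_)
    refine (enorm_integral_le_lintegral_enorm _).trans ?_
    rw [← lintegral_const_mul' _ _ ENNReal.ofReal_ne_top]
    refine lintegral_mono fun y => ?_
    simp only
    rw [enorm_mul, mul_comm]
    gcongr
    rw [← ofReal_norm]
    apply ENNReal.ofReal_le_ofReal
    have i3 := intOn (S := S) (μ := μ) hg hB' (k+J) y
    have : g y - S.E (k+J) g y = S.E (k+J) (fun z => g y - g z) y := by
      rw [S.E_sub (integrableOn_const (S.vol_lt_top _ y).ne) i3, S.E_const]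
    rw [this]
    exact S.E_norm_le fun z hz => hε J y z hz

namespace Wt
variable {S} {w σ : X → ℝ} {Q r Cr : ℝ}

lemma A_L2 (h : S.Wt w σ Q r Cr) [SFinite μ] (k : ℤ) {g : X → ENNReal} (hg : Measurable g) :
    ∫⁻ x, (S.A k g x) ^ 2 * ENNReal.ofReal (w x) ∂μ
      ≤ ENNReal.ofReal Q * ∫⁻ x, g x ^ 2 * ENNReal.ofReal (w x) ∂μ := by
  have mw := h.mw.ennreal_ofReal
  have msg := h.ms.ennreal_ofReal
  have mg : Measurable fun x => g x ^ 2 * ENNReal.ofReal (w x) := (hg.pow_const 2).mul mw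
  have mA := S.measurable_A k hg
  have h1 : ∀ x, (S.A k g x) ^ 2 ≤ S.A k (fun y => g y ^ 2 * ENNReal.ofReal (w y)) x
      * S.A k (fun y => ENNReal.ofReal (σ y)) x := by
    intro x
    unfold A
    have e : ∫⁻ y in S.cell k x, g y ∂μ = ∫⁻ y in S.cell k x,
        (g y * ENNReal.ofReal (w y) ^ (1/2:ℝ)) * (ENNReal.ofReal (σ y) ^ (1/2:ℝ)) ∂μ := by
      refine lintegral_congr_ae (ae_restrict_of_ae ?_)
      filter_upwards [h.one] with y hy
      rw [mul_assoc, ← ENNReal.mul_rpow_of_nonneg _ _ (by norm_num), ← ENNReal.ofReal_mul (h.w0 y), hy]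
      simp
    have c := cs_lintegral (μ := μ.restrict (S.cell k x))
      (f := fun y => (g y * ENNReal.ofReal (w y) ^ (1/2:ℝ))) (g := fun y => (ENNReal.ofReal (σ y) ^ (1/2:ℝ)))
      (hg.mul (mw.pow_const _)).aemeasurable (msg.pow_const _).aemeasurable
    rw [← e] at c
    have e2 : ∀ a : ENNReal, (a ^ (1/2:ℝ)) ^ 2 = a := fun a => by
      rw [← ENNReal.rpow_two, ← ENNReal.rpow_mul]; norm_num
    simp only [mul_pow, e2] at c
    rw [mul_pow]
    calc _ ≤ (ENNReal.ofReal (S.m k))⁻¹ ^ 2 * ((∫⁻ y in S.cell k x, g y ^ 2 * ENNReal.ofReal (w y) ∂μ)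
          * ∫⁻ y in S.cell k x, ENNReal.ofReal (σ y) ∂μ) := by gcongr
      _ = _ := by ring
  set H := S.A k (fun y => g y ^ 2 * ENNReal.ofReal (w y)) with hH
  have mH : Measurable H := S.measurable_A k mg
  calc ∫⁻ x, (S.A k g x) ^ 2 * ENNReal.ofReal (w x) ∂μ
      = ∫⁻ x, ENNReal.ofReal (w x) * (S.A k g x) ^ 2 ∂μ := by simp_rw [mul_comm]
    _ = ∫⁻ x, S.A k (fun y => ENNReal.ofReal (w y)) x * (S.A k g x) ^ 2 ∂μ :=
      (S.lintegral_A_mul k mw (mA.pow_const 2) (fun x y hy => by rw [S.A_congr k g hy])).symm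
    _ ≤ ∫⁻ x, ENNReal.ofReal Q * H x ∂μ := by
      refine lintegral_mono fun x => ?_
      calc _ ≤ S.A k (fun y => ENNReal.ofReal (w y)) x * (H x * S.A k (fun y => ENNReal.ofReal (σ y)) x) := by
            gcongr; exact h1 x
        _ = ENNReal.ofReal (S.E k w x * S.E k σ x) * H x := by
          rw [S.A_ofReal k h.w0 x (h.iw k x), S.A_ofReal k h.s0 x (h.is k x),
            ENNReal.ofReal_mul (h.lower k x).1.le]; ring
        _ ≤ _ := by gcongr; exact h.A2 k x
    _ = _ := by rw [lintegral_const_mul _ mH, hH, S.lintegral_A k mg]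

end Wt
end DySys
end LP

open MeasureTheory
set_option linter.all false

namespace LP

/-- convolution with the dilated kernel -/
noncomputable def cv {n : ℕ} (f φ : EuclideanSpace ℝ (Fin n) → ℂ) (t : ℝ)
    (x : EuclideanSpace ℝ (Fin n)) : ℂ :=
  ∫ y, f y * ((((t^n)⁻¹ : ℝ) : ℂ) * φ (t⁻¹ • (x - y)))

variable {n : ℕ}

lemma grid_conv (α : Fin n → Bool) {f : EuclideanSpace ℝ (Fin n) → ℂ} (hf : Continuous f)
    {B : ℝ} (hB : ∀ x, ‖f x‖ ≤ B) (k : ℤ) (y : EuclideanSpace ℝ (Fin n)) :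
    Filter.Tendsto (fun j : ℕ => (grid n α).E (k+j) f y) Filter.atTop (nhds (f y)) := by
  rw [Metric.tendsto_atTop]
  intro ε hε
  obtain ⟨δ, hδ, hfδ⟩ := Metric.continuous_iff.1 hf y (ε/2) (by positivity)
  have h1 : Filter.Tendsto (fun j : ℕ => (n:ℝ) * 2^(-k) * (1/2)^j) Filter.atTop (nhds ((n:ℝ) * 2^(-k) * 0)) :=
    (tendsto_pow_atTop_nhds_zero_of_lt_one (by norm_num) (by norm_num)).const_mul _
  rw [mul_zero] at h1
  obtain ⟨J, hJ⟩ := Filter.eventually_atTop.1 (h1.eventually (gt_mem_nhds hδ))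
  refine ⟨J, fun j hj => ?_⟩
  have i1 := DySys.intOn (S := grid n α) hf.measurable hB (k+j) y
  have : (grid n α).E (k+j) f y - f y = (grid n α).E (k+j) (fun z => f z - f y) y := by
    rw [(grid n α).E_sub i1 (integrableOn_const ((grid n α).vol_lt_top _ y).ne), (grid n α).E_const]
  rw [dist_eq_norm, this]
  refine lt_of_le_of_lt ((grid n α).E_norm_le (B := ε/2) fun z hz => ?_) (by linarith)
  rw [← dist_eq_norm]
  refine (hfδ z ?_).le
  rw [dist_eq_norm]
  refine lt_of_le_of_lt (grid_diam hz) (lt_of_le_of_lt (le_of_eq ?_) (hJ j hj))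
  rw [neg_add, zpow_add₀ (by norm_num), mul_assoc, zpow_neg _ (j:ℤ), zpow_natCast]
  simp

lemma integral_dil {G : Type*} [NormedAddCommGroup G] [NormedSpace ℝ G] (θ : EuclideanSpace ℝ (Fin n) → G)
    {t : ℝ} (ht : 0 < t) (x : EuclideanSpace ℝ (Fin n)) :
    ∫ y, θ (t⁻¹ • (x - y)) = t^n • ∫ y, θ y := by
  rw [integral_sub_left_eq_self (fun y => θ (t⁻¹ • y)) volume x, Measure.integral_comp_inv_smul]
  simp [abs_of_pos ht]

lemma cv_pt {θ : EuclideanSpace ℝ (Fin n) → ℂ} {L ρ : ℝ} (hL : 0 ≤ L) (hρ : 0 < ρ)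
    (hlip : ∀ a b, ‖θ a - θ b‖ ≤ L * ‖a - b‖) (hsupp : ∀ a, ρ < ‖a‖ → θ a = 0)
    (h0 : ∫ a, θ a = 0) {f : EuclideanSpace ℝ (Fin n) → ℂ} (hf : Continuous f)
    {B : ℝ} (hB : ∀ x, ‖f x‖ ≤ B) {t : ℝ} (ht : 0 < t) {k : ℤ}
    (hk1 : 2^k * (ρ * t) ≤ 1/12) (hk2 : (2:ℝ)^(-k) ≤ 24 * ρ * t) (x : EuclideanSpace ℝ (Fin n)) :
    ‖cv f θ t x‖ₑ ≤ ENNReal.ofReal (n * L * (24 * ρ)^(n+1)) *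
      ∑ α : Fin n → Bool, ∑' j : ℕ, ENNReal.ofReal ((1/2)^j) *
        (grid n α).A k (fun y => ‖(grid n α).E (k+j+1) f y - (grid n α).E (k+j) f y‖ₑ) x := by
  obtain ⟨α, hα⟩ := grid_cover hk1 x
  set S := grid n α with hS
  have hθc : Continuous θ := by
    have : LipschitzWith L.toNNReal θ := LipschitzWith.of_dist_le_mul fun a b => by
      rw [dist_eq_norm, dist_eq_norm, Real.coe_toNNReal _ hL]; exact hlip a b
    exact this.continuous
  have hcs : HasCompactSupport θ := HasCompactSupport.of_support_subset_isCompact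
    (isCompact_closedBall 0 ρ) (fun a ha => by
      by_contra h'
      exact ha (hsupp a (by simpa using h')))
  obtain ⟨Bθ, hBθ⟩ := hcs.exists_bound_of_continuous hθc
  set g : EuclideanSpace ℝ (Fin n) → ℂ := fun y => ((((t^n)⁻¹ : ℝ) : ℂ) * θ (t⁻¹ • (x - y))) with hg
  have hgc : Continuous g := by rw [hg]; fun_prop
  have htn : 0 < (t^n)⁻¹ := by positivity
  have hgz : ∀ y, y ∉ S.cell k x → g y = 0 := by
    intro y hy
    have : ρ * t < ‖y - x‖ := by
      by_contra h'
      exact hy (hα y (not_lt.1 h'))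
    have : ρ < ‖t⁻¹ • (x - y)‖ := by
      rw [norm_smul, norm_sub_rev, Real.norm_of_nonneg (by positivity), lt_inv_mul_iff₀ ht]; linarith
    simp only [hg]
    rw [hsupp _ this, mul_zero]
  have e1 : cv f θ t x = ∫ y in S.cell k x, f y * g y := by
    rw [setIntegral_eq_integral_of_forall_compl_eq_zero fun y hy => by rw [hgz y hy, mul_zero]]
    rfl
  have e2 : ∫ y in S.cell k x, g y = 0 := by
    rw [setIntegral_eq_integral_of_forall_compl_eq_zero hgz, hg, integral_const_mul,
      integral_dil θ ht, h0]
    simp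
  have hgB : ∀ y, ‖g y‖ ≤ (t^n)⁻¹ * Bθ := fun y => by
    simp only [hg, norm_mul, Complex.norm_real, Real.norm_of_nonneg htn.le]
    gcongr; exact hBθ _
  have hε : ∀ (j : ℕ) y, ∀ z ∈ S.cell (k+j) y, ‖g y - g z‖ ≤
      (t^n)⁻¹ * (L * (t⁻¹ * (n * 2^(-(k+j))))) := by
    intro j y z hz
    simp only [hg]
    rw [← mul_sub, norm_mul, Complex.norm_real, Real.norm_of_nonneg htn.le]
    gcongr
    refine (hlip _ _).trans ?_
    gcongr
    rw [← smul_sub, norm_smul, Real.norm_of_nonneg (by positivity)]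
    gcongr
    rw [sub_sub_sub_cancel_left]
    exact grid_diam hz
  rw [e1]
  refine (S.pairing hf.measurable hgc.measurable hB hgB x e2 _ hε (grid_conv α hf hB k)).trans ?_
  refine le_trans ?_ (mul_le_mul_right (Finset.single_le_sum (f := fun α : Fin n → Bool => 
    ∑' j : ℕ, ENNReal.ofReal ((1/2)^j) * (grid n α).A k
      (fun y => ‖(grid n α).E (k+j+1) f y - (grid n α).E (k+j) f y‖ₑ) x) (fun _ _ => zero_le)
      (Finset.mem_univ α)) _)
  rw [← ENNReal.tsum_mul_left]
  refine ENNReal.tsum_le_tsum fun j => ?_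
  have hmk : S.m k = (2^(-k))^n := rfl
  unfold DySys.A
  rw [← hS, ← mul_assoc (ENNReal.ofReal ((1/2)^j)), ← mul_assoc (ENNReal.ofReal (n * L * (24 * ρ)^(n+1)))]
  refine mul_le_mul' ?_ le_rfl
  rw [← ENNReal.ofReal_inv_of_pos (S.m_pos k), ← ENNReal.ofReal_mul (by positivity),
    ← ENNReal.ofReal_mul (by positivity)]
  apply ENNReal.ofReal_le_ofReal
  rw [hmk]
  have hp : (0:ℝ) < 2^(-k) := by positivity
  rw [← div_eq_mul_inv, ← mul_div_assoc, le_div_iff₀ (by positivity)]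
  have e3 : (2:ℝ)^(-(k+j)) = 2^(-k) * (1/2)^j := by
    rw [neg_add, zpow_add₀ (by norm_num), zpow_neg _ (j:ℤ), zpow_natCast]; simp only [one_div, inv_pow]
  rw [e3]
  calc (t^n)⁻¹ * (L * (t⁻¹ * (n * (2^(-k) * (1/2)^j)))) * (2^(-k))^n
      = n * L * (2^(-k) / t)^(n+1) * (1/2)^j := by
        generalize (2:ℝ)^(-k) = u
        generalize (1/2:ℝ)^j = v
        rw [div_pow, pow_succ, pow_succ, mul_div_mul_comm]
        simp only [div_eq_mul_inv]; ring
    _ ≤ n * L * (24 * ρ)^(n+1) * (1/2)^j := by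
      gcongr
      rw [div_le_iff₀ ht]; exact hk2

/-- the constant of one step -/
noncomputable def C1 (n : ℕ) (Q r Cr : ℝ) : ℝ :=
  (n * 24^(n+1))^2 * (2^n * 2) * (2^n * 2) * Q * Cdy Q r Cr (2^n)

/-- time block -/
def blk (ρ : ℝ) (k : ℤ) : Set ℝ := Set.Ico (2^(-k) / (24 * ρ)) (2 * (2^(-k) / (24 * ρ)))

lemma blk_cover {ρ : ℝ} (hρ : 0 < ρ) : Set.Ioi (0:ℝ) ⊆ ⋃ k : ℤ, blk ρ k := by
  intro t ht
  have ht : 0 < t := ht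
  obtain ⟨k, hk1, hk2⟩ := exists_mem_Ico_zpow (x := 24 * ρ * t) (y := (2:ℝ)) (by positivity) (by norm_num)
  refine Set.mem_iUnion.2 ⟨-k, ?_, ?_⟩
  · rw [neg_neg, div_le_iff₀ (by positivity)]; linarith
  · rw [neg_neg, mul_div_assoc', lt_div_iff₀ (by positivity)]
    rw [zpow_add₀ (by norm_num)] at hk2
    simp at hk2
    linarith

lemma blk_int {ρ : ℝ} (hρ : 0 < ρ) (k : ℤ) : ∫⁻ t in blk ρ k, (ENNReal.ofReal t)⁻¹ ≤ 1 := by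
  set c := (2:ℝ)^(-k) / (24 * ρ) with hc
  have hcp : 0 < c := by positivity
  calc ∫⁻ t in blk ρ k, (ENNReal.ofReal t)⁻¹ ≤ ∫⁻ t in blk ρ k, (ENNReal.ofReal c)⁻¹ := by
        refine setLIntegral_mono measurable_const fun t ht => ?_
        exact ENNReal.inv_le_inv.2 (ENNReal.ofReal_le_ofReal ht.1)
    _ = 1 := by
      rw [setLIntegral_const]
      unfold blk
      rw [← hc, Real.volume_Ico, show 2 * c - c = c by ring]
      exact ENNReal.inv_mul_cancel (by simpa using hcp) ENNReal.ofReal_ne_top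

theorem one_step {w σ : EuclideanSpace ℝ (Fin n) → ℝ} {Q r Cr : ℝ}
    (hW : ∀ α, (grid n α).Wt w σ Q r Cr)
    {θ : EuclideanSpace ℝ (Fin n) → ℂ} {L ρ : ℝ} (hL : 0 ≤ L) (hρ : 0 < ρ)
    (hlip : ∀ a b, ‖θ a - θ b‖ ≤ L * ‖a - b‖) (hsupp : ∀ a, ρ < ‖a‖ → θ a = 0)
    (h0 : ∫ a, θ a = 0) {f : EuclideanSpace ℝ (Fin n) → ℂ} (hf : Continuous f)
    {B : ℝ} (hB : ∀ x, ‖f x‖ ≤ B) :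
    ∫⁻ x, (∫⁻ t in Set.Ioi (0:ℝ), ‖cv f θ t x‖ₑ ^ 2 * (ENNReal.ofReal t)⁻¹) * ENNReal.ofReal (w x)
      ≤ ENNReal.ofReal (C1 n Q r Cr * (L * ρ^(n+1))^2) * ∫⁻ x, ‖f x‖ₑ ^ 2 * ENNReal.ofReal (w x) := by
  have hQ : 0 < Q := (hW fun _ => false).Q_pos 0
  have mw := (hW fun _ => false).mw.ennreal_ofReal
  set c := ENNReal.ofReal (n * L * (24 * ρ)^(n+1)) with hc
  set a : (Fin n → Bool) → ℤ → ℕ → EuclideanSpace ℝ (Fin n) → ENNReal := fun α k j x =>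
    (grid n α).A k (fun y => ‖(grid n α).E (k+j+1) f y - (grid n α).E (k+j) f y‖ₑ) x with ha
  have mD : ∀ (α : Fin n → Bool) (l : ℤ), Measurable fun y => ‖(grid n α).E (l+1) f y - (grid n α).E l f y‖ₑ := fun α l =>
    (((grid n α).measE hf.measurable _).sub ((grid n α).measE hf.measurable _)).enorm
  have ma : ∀ α k j, Measurable (a α k j) := fun α k j => (grid n α).measurable_A k (mD α _)
  have hsum : ∑' j : ℕ, ENNReal.ofReal ((1/2)^j) = 2 := by
    rw [← ENNReal.ofReal_tsum_of_nonneg (fun j => by positivity) summable_geometric_two, tsum_geometric_two]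
    simp
  -- pointwise
  have pt : ∀ x k, ∀ t ∈ blk ρ k, ‖cv f θ t x‖ₑ ^ 2 ≤
      c^2 * (2^n * 2) * ∑ α, ∑' j : ℕ, ENNReal.ofReal ((1/2)^j) * (a α k j x)^2 := by
    intro x k t ht
    have ht0 : 0 < t := lt_of_lt_of_le (by positivity) ht.1
    have h2 : (0:ℝ) < 2^k := by positivity
    have hk1 : 2^k * (ρ * t) ≤ 1/12 := by
      have := ht.2.le
      rw [zpow_neg] at this
      calc 2^k * (ρ * t) ≤ 2^k * (ρ * (2 * ((2^k)⁻¹ / (24 * ρ)))) := by gcongr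
        _ = 1/12 := by field_simp; norm_num
    have hk2 : (2:ℝ)^(-k) ≤ 24 * ρ * t := by
      have := ht.1
      rw [div_le_iff₀ (by positivity)] at this; linarith
    have h1 := cv_pt hL hρ hlip hsupp h0 hf hB ht0 hk1 hk2 x
    have h3 : (∑ α : Fin n → Bool, ∑' j : ℕ, ENNReal.ofReal ((1/2)^j) * a α k j x)^2
      ≤ (2^n * 2) * ∑ α, ∑' j : ℕ, ENNReal.ofReal ((1/2)^j) * (a α k j x)^2 := by
      have := cs_tsum (ι := (Fin n → Bool) × ℕ) (fun p => ENNReal.ofReal ((1/2)^p.2)) (fun p => a p.1 k p.2 x)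
      rw [ENNReal.tsum_prod', ENNReal.tsum_prod', ENNReal.tsum_prod'] at this
      simp only [tsum_fintype, hsum] at this
      simpa using this
    calc ‖cv f θ t x‖ₑ ^ 2 ≤ (c * ∑ α : Fin n → Bool, ∑' j : ℕ, ENNReal.ofReal ((1/2)^j) * a α k j x)^2 := by
          gcongr
      _ = c^2 * (∑ α : Fin n → Bool, ∑' j : ℕ, ENNReal.ofReal ((1/2)^j) * a α k j x)^2 := by rw [mul_pow]
      _ ≤ c^2 * ((2^n * 2) * ∑ α, ∑' j : ℕ, ENNReal.ofReal ((1/2)^j) * (a α k j x)^2) := by gcongr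
      _ = _ := by ring
  have pt2 : ∀ x, ∫⁻ t in Set.Ioi (0:ℝ), ‖cv f θ t x‖ₑ ^ 2 * (ENNReal.ofReal t)⁻¹ ≤
      ∑' k : ℤ, c^2 * (2^n * 2) * ∑ α, ∑' j : ℕ, ENNReal.ofReal ((1/2)^j) * (a α k j x)^2 := by
    intro x
    refine (lintegral_mono_set (blk_cover hρ)).trans ((lintegral_iUnion_le _ _).trans ?_)
    refine ENNReal.tsum_le_tsum fun k => ?_
    calc _ ≤ ∫⁻ t in blk ρ k, (c^2 * (2^n * 2) * ∑ α, ∑' j : ℕ, ENNReal.ofReal ((1/2)^j) * (a α k j x)^2)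
          * (ENNReal.ofReal t)⁻¹ := by
          refine setLIntegral_mono (by fun_prop) fun t ht => ?_
          gcongr
          exact pt x k t ht
      _ = (c^2 * (2^n * 2) * ∑ α, ∑' j : ℕ, ENNReal.ofReal ((1/2)^j) * (a α k j x)^2)
          * ∫⁻ t in blk ρ k, (ENNReal.ofReal t)⁻¹ := by
          rw [lintegral_const_mul _ (by fun_prop)]
      _ ≤ _ := mul_le_of_le_one_right zero_le (blk_int hρ k)
  set I := ∫⁻ x, ‖f x‖ₑ ^ 2 * ENNReal.ofReal (w x) with hI
  have main : ∀ α (j : ℕ), ∑' k : ℤ, ∫⁻ x, (a α k j x)^2 * ENNReal.ofReal (w x)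
      ≤ ENNReal.ofReal Q * (ENNReal.ofReal (Cdy Q r Cr (2^n)) * I) := by
    intro α j
    calc ∑' k : ℤ, ∫⁻ x, (a α k j x)^2 * ENNReal.ofReal (w x)
        ≤ ∑' k : ℤ, ENNReal.ofReal Q * ∫⁻ x, ‖(grid n α).E (k+j+1) f x - (grid n α).E (k+j) f x‖ₑ^2 * ENNReal.ofReal (w x) :=
          ENNReal.tsum_le_tsum fun k => (hW α).A_L2 k (mD α (k+j))
      _ = ENNReal.ofReal Q * ∑' k : ℤ, ∫⁻ x, ‖(grid n α).E (k+1) f x - (grid n α).E k f x‖ₑ^2 * ENNReal.ofReal (w x) := by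
          rw [ENNReal.tsum_mul_left]
          congr 1
          exact (Equiv.addRight (j:ℤ)).tsum_eq (fun k : ℤ => ∫⁻ x, ‖(grid n α).E (k+1) f x - (grid n α).E k f x‖ₑ^2 * ENNReal.ofReal (w x))
      _ ≤ _ := by
          gcongr
          exact (hW α).dyadic_complex hf.measurable hB
  calc _ ≤ ∫⁻ x, (∑' k : ℤ, c^2 * (2^n * 2) * ∑ α, ∑' j : ℕ, ENNReal.ofReal ((1/2)^j) * (a α k j x)^2)
        * ENNReal.ofReal (w x) := by
        refine lintegral_mono fun x => ?_
        gcongr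
        exact pt2 x
    _ = ∫⁻ x, c^2 * (2^n * 2) * ∑ α, ∑' j : ℕ, ENNReal.ofReal ((1/2)^j) *
          ∑' k : ℤ, (a α k j x)^2 * ENNReal.ofReal (w x) := by
        refine lintegral_congr fun x => ?_
        rw [ENNReal.tsum_mul_left, mul_assoc]
        congr 1
        rw [Summable.tsum_finsetSum (fun _ _ => ENNReal.summable), Finset.sum_mul]
        refine Finset.sum_congr rfl fun α _ => ?_
        rw [ENNReal.tsum_comm, ← ENNReal.tsum_mul_right]
        congr 1; funext j
        rw [ENNReal.tsum_mul_left, mul_assoc, ENNReal.tsum_mul_right]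
    _ = c^2 * (2^n * 2) * ∑ α, ∑' j : ℕ, ENNReal.ofReal ((1/2)^j) *
          ∑' k : ℤ, ∫⁻ x, (a α k j x)^2 * ENNReal.ofReal (w x) := by
        have m0 : ∀ α k j, Measurable fun x => (a α k j x)^2 * ENNReal.ofReal (w x) := fun α k j =>
          ((ma α k j).pow_const 2).mul mw
        have m1 : ∀ α j, Measurable fun x => ∑' k : ℤ, (a α k j x)^2 * ENNReal.ofReal (w x) := fun α j =>
          Measurable.tsum fun k => m0 α k j
        have m2 : ∀ α (j : ℕ), Measurable fun x => ENNReal.ofReal ((1/2)^j) * ∑' k : ℤ, (a α k j x)^2 * ENNReal.ofReal (w x) := fun α j =>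
          (m1 α j).const_mul _
        have m3 : ∀ α, Measurable fun x => ∑' j : ℕ, ENNReal.ofReal ((1/2)^j) * ∑' k : ℤ, (a α k j x)^2 * ENNReal.ofReal (w x) := fun α =>
          Measurable.tsum fun j => m2 α j
        rw [lintegral_const_mul _ (Finset.measurable_sum _ fun α _ => m3 α), lintegral_finsetSum _ (fun α _ => m3 α)]
        congr 1
        refine Finset.sum_congr rfl fun α _ => ?_
        rw [lintegral_tsum fun j => (m2 α j).aemeasurable]
        congr 1; funext j
        rw [lintegral_const_mul _ (m1 α j), lintegral_tsum fun k => (m0 α k j).aemeasurable]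
    _ ≤ c^2 * (2^n * 2) * ∑ α : Fin n → Bool, ∑' j : ℕ, ENNReal.ofReal ((1/2)^j) *
          (ENNReal.ofReal Q * (ENNReal.ofReal (Cdy Q r Cr (2^n)) * I)) := by
        gcongr with α _ j
        exact main α j
    _ = _ := by
        rw [ENNReal.tsum_mul_right, hsum]
        simp only [Finset.sum_const, Finset.card_univ, Fintype.card_pi, Fintype.card_bool, Finset.prod_const,
          Fintype.card_fin, nsmul_eq_mul]
        have hCd : 0 ≤ Cdy Q r Cr (2^n) := by unfold Cdy; positivity
        have e : C1 n Q r Cr * (L * ρ^(n+1))^2 = (n * L * (24 * ρ)^(n+1))^2 * (2^n * 2) * (2^n * 2) * Q * Cdy Q r Cr (2^n) := by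
          unfold C1; rw [mul_pow 24 ρ]; ring
        have e2 : ENNReal.ofReal (2^n * 2) = 2^n * 2 := by
          rw [ENNReal.ofReal_mul (by positivity), ENNReal.ofReal_pow (by positivity)]; simp
        rw [e, ENNReal.ofReal_mul (by positivity), ENNReal.ofReal_mul (by positivity), ENNReal.ofReal_mul (by positivity),
          ENNReal.ofReal_mul (by positivity), ENNReal.ofReal_pow (by positivity), e2, ← hc]
        push_cast
        ring

end LP

open MeasureTheory
set_option linter.all false
namespace LP

variable {n : ℕ}

/-- cutoff -/
noncomputable def chi (n : ℕ) (R : ℝ) (x : EuclideanSpace ℝ (Fin n)) : ℝ := max 0 (min 1 (2 - ‖x‖ / R))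

lemma chi_nonneg (R : ℝ) (x : EuclideanSpace ℝ (Fin n)) : 0 ≤ chi n R x := le_max_left _ _
lemma chi_le_one (R : ℝ) (x : EuclideanSpace ℝ (Fin n)) : chi n R x ≤ 1 := max_le (by norm_num) (min_le_left _ _)
lemma chi_eq_one {R : ℝ} (hR : 0 < R) {x : EuclideanSpace ℝ (Fin n)} (hx : ‖x‖ ≤ R) : chi n R x = 1 := by
  unfold chi
  have : ‖x‖ / R ≤ 1 := (div_le_one hR).2 hx
  rw [min_eq_left (by linarith)]; simp
lemma chi_eq_zero {R : ℝ} (hR : 0 < R) {x : EuclideanSpace ℝ (Fin n)} (hx : 2 * R ≤ ‖x‖) : chi n R x = 0 := by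
  unfold chi
  have : 2 ≤ ‖x‖ / R := (le_div_iff₀ hR).2 hx
  exact max_eq_left ((min_le_right _ _).trans (by linarith))
lemma chi_lip {R : ℝ} (hR : 0 < R) (a b : EuclideanSpace ℝ (Fin n)) : |chi n R a - chi n R b| ≤ R⁻¹ * ‖a - b‖ := by
  unfold chi
  refine (abs_max_sub_max_le_max 0 _ 0 _).trans ?_
  refine max_le (by simp; positivity) ?_
  refine (abs_min_sub_min_le_max 1 _ 1 _).trans ?_
  refine max_le (by simp; positivity) ?_
  rw [show (2 - ‖a‖/R) - (2 - ‖b‖/R) = R⁻¹ * (‖b‖ - ‖a‖) by ring, abs_mul, abs_of_pos (by positivity)]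
  gcongr
  rw [norm_sub_rev]
  exact abs_norm_sub_norm_le b a
lemma chi_cont (R : ℝ) : Continuous (chi n R) := by unfold chi; fun_prop
lemma chi_dil (R : ℝ) (hR : 0 < R) (x : EuclideanSpace ℝ (Fin n)) : chi n R x = chi n 1 (R⁻¹ • x) := by
  unfold chi
  rw [norm_smul, Real.norm_of_nonneg (by positivity)]
  congr 3; simp; ring
lemma chi_supp {R : ℝ} (hR : 0 < R) : HasCompactSupport (chi n R) := by
  refine HasCompactSupport.of_support_subset_isCompact (isCompact_closedBall (0 : EuclideanSpace ℝ (Fin n)) (2*R)) ?_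
  intro x hx
  rw [mem_closedBall_zero_iff]
  by_contra h
  exact hx (chi_eq_zero hR (not_le.1 h).le)
lemma chi_int {R : ℝ} (hR : 0 < R) : Integrable (chi n R) := (chi_cont R).integrable_of_hasCompactSupport (chi_supp hR)

/-- mass -/
noncomputable def cmass (n : ℕ) : ℝ := ∫ x, chi n 1 x
lemma cmass_pos : 0 < cmass n :=
  (chi_cont 1).integral_pos_of_hasCompactSupport_nonneg_nonzero (chi_supp one_pos) (chi_nonneg 1)
    (x := 0) (by rw [chi_eq_one one_pos (by simp)]; norm_num)
lemma chi_mass {R : ℝ} (hR : 0 < R) : ∫ x, chi n R x = R^n * cmass n := by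
  simp_rw [chi_dil R hR]
  rw [Measure.integral_comp_smul]
  simp [cmass, abs_of_pos (pow_pos hR n)]

variable {φ : EuclideanSpace ℝ (Fin n) → ℂ} {K : ℝ}

lemma rp1 {R s : ℝ} (hR : 1 ≤ R) (hs : R ≤ s) (a : ℕ) : (1 + s)^(-(a:ℝ) - 1/2) ≤ (R^a)⁻¹ * R^(-(1/4):ℝ) := by
  have h0 : 0 < R := by linarith
  calc (1 + s)^(-(a:ℝ) - 1/2) ≤ R^(-(a:ℝ) - 1/2) := 
        Real.rpow_le_rpow_of_nonpos h0 (by linarith) (by have : (0:ℝ) ≤ a := by positivity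
                                                         linarith)
    _ ≤ R^(-(a:ℝ) + -(1/4)) := Real.rpow_le_rpow_of_exponent_le hR (by linarith)
    _ = _ := by rw [Real.rpow_add h0, Real.rpow_neg h0.le, Real.rpow_natCast]

/-- Lipschitz away from zero -/
lemma lip_away (hd : Differentiable ℝ φ) (hK : 0 ≤ K)
    (h0 : ∀ x, ‖φ x‖ ≤ K * (1 + ‖x‖)^(-(n:ℝ) - 1/2))
    (h1 : ∀ x, ‖fderiv ℝ φ x‖ ≤ K * (1 + ‖x‖)^(-(n:ℝ) - 1/2 - 1))
    {R : ℝ} (hR : 1 ≤ R) {a b : EuclideanSpace ℝ (Fin n)} (ha : R ≤ ‖a‖) (hb : R ≤ ‖b‖) :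
    ‖φ a - φ b‖ ≤ K * 2^(n+2) * ((R^(n+1))⁻¹ * R^(-(1/4):ℝ)) * ‖a - b‖ := by
  have hR0 : 0 < R := by linarith
  have hq : 0 < R^(-(1/4):ℝ) := by positivity
  by_cases h : ‖b - a‖ ≤ R/2
  · rw [norm_sub_rev, norm_sub_rev a]
    refine (convex_closedBall a (R/2)).norm_image_sub_le_of_norm_fderiv_le (𝕜 := ℝ) (fun x _ => hd x) (fun x hx => ?_)
      (Metric.mem_closedBall_self (by positivity)) (by rwa [mem_closedBall_iff_norm])
    refine (h1 x).trans ?_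
    rw [mul_assoc]
    gcongr
    rw [mem_closedBall_iff_norm] at hx
    have hx2 : R/2 ≤ ‖x‖ := by
      have := norm_sub_norm_le a x
      rw [norm_sub_rev] at this
      linarith
    calc (1 + ‖x‖)^(-(n:ℝ) - 1/2 - 1) ≤ (1/2 * R)^(-(n:ℝ) - 1/2 - 1) := by
          refine Real.rpow_le_rpow_of_nonpos (by positivity) (by linarith) ?_
          have : (0:ℝ) ≤ n := by positivity
          linarith
      _ = (1/2:ℝ)^(-(n:ℝ) - 1/2 - 1) * R^(-(n:ℝ) - 1/2 - 1) := Real.mul_rpow (by norm_num) hR0.le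
      _ ≤ 2^(n+2) * ((R^(n+1))⁻¹ * R^(-(1/4):ℝ)) := by
          gcongr
          · rw [one_div, Real.inv_rpow (by norm_num), ← Real.rpow_neg (by norm_num), ← Real.rpow_natCast 2 (n+2)]
            refine Real.rpow_le_rpow_of_exponent_le (by norm_num) ?_
            push_cast; linarith
          · rw [← Real.rpow_natCast, ← Real.rpow_neg hR0.le, ← Real.rpow_add hR0]
            refine Real.rpow_le_rpow_of_exponent_le hR ?_
            push_cast; linarith
  · push Not at h
    rw [norm_sub_rev] at h
    have hn2 : (1:ℝ) ≤ 2^n := one_le_pow₀ (by norm_num)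
    calc ‖φ a - φ b‖ ≤ ‖φ a‖ + ‖φ b‖ := norm_sub_le _ _
      _ ≤ K * ((R^n)⁻¹ * R^(-(1/4):ℝ)) + K * ((R^n)⁻¹ * R^(-(1/4):ℝ)) := by
        gcongr
        · exact (h0 a).trans (by gcongr; exact rp1 hR ha n)
        · exact (h0 b).trans (by gcongr; exact rp1 hR hb n)
      _ = K * 4 * ((R^(n+1))⁻¹ * R^(-(1/4):ℝ)) * (R/2) := by rw [pow_succ]; field_simp; ring
      _ ≤ K * 2^(n+2) * ((R^(n+1))⁻¹ * R^(-(1/4):ℝ)) * ‖a - b‖ := by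
        gcongr
        rw [pow_add]; nlinarith

/-- global Lipschitz -/
lemma lip_glob (hd : Differentiable ℝ φ) (hK : 0 ≤ K)
    (h1 : ∀ x, ‖fderiv ℝ φ x‖ ≤ K * (1 + ‖x‖)^(-(n:ℝ) - 1/2 - 1))
    (a b : EuclideanSpace ℝ (Fin n)) : ‖φ a - φ b‖ ≤ K * ‖a - b‖ := by
  refine convex_univ.norm_image_sub_le_of_norm_fderiv_le (𝕜 := ℝ) (fun x _ => hd x) (fun x hx => ?_) trivial trivial
  refine (h1 x).trans (mul_le_of_le_one_right hK ?_)
  refine Real.rpow_le_one_of_one_le_of_nonpos (by simp) ?_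
  have : (0:ℝ) ≤ n := by positivity
  linarith

/-- annular piece -/
lemma lip_piece (hd : Differentiable ℝ φ) (hK : 0 ≤ K)
    (h0 : ∀ x, ‖φ x‖ ≤ K * (1 + ‖x‖)^(-(n:ℝ) - 1/2))
    (h1 : ∀ x, ‖fderiv ℝ φ x‖ ≤ K * (1 + ‖x‖)^(-(n:ℝ) - 1/2 - 1))
    {R : ℝ} (hR : 1 ≤ R) (a b : EuclideanSpace ℝ (Fin n)) :
    ‖φ a * ((chi n (2*R) a - chi n R a : ℝ) : ℂ) - φ b * ((chi n (2*R) b - chi n R b : ℝ) : ℂ)‖ ≤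
      K * 2^(n+3) * ((R^(n+1))⁻¹ * R^(-(1/4):ℝ)) * ‖a - b‖ := by
  have hR0 : 0 < R := by linarith
  have hq : 0 < R^(-(1/4):ℝ) := by positivity
  have hn2 : (1:ℝ) ≤ 2^n := one_le_pow₀ (by norm_num)
  set ψ : EuclideanSpace ℝ (Fin n) → ℝ := fun x => chi n (2*R) x - chi n R x with hψ
  have hψ0 : ∀ x, ‖x‖ < R → ψ x = 0 := fun x hx => by
    simp only [hψ]; rw [chi_eq_one (by positivity) (by linarith), chi_eq_one hR0 hx.le]; simp
  have hψ1 : ∀ x, |ψ x| ≤ 1 := fun x => by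
    have := chi_nonneg R x; have := chi_nonneg (2*R) x; have := chi_le_one R x; have := chi_le_one (2*R) x
    simp only [hψ]; rw [abs_le]; constructor <;> linarith
  have hψl : ∀ x y, |ψ x - ψ y| ≤ 2 * R⁻¹ * ‖x - y‖ := fun x y => by
    have e1 := chi_lip hR0 x y
    have e2 := chi_lip (R := 2*R) (by positivity) x y
    have e3 : (2*R)⁻¹ * ‖x - y‖ ≤ R⁻¹ * ‖x - y‖ := by gcongr; linarith
    simp only [hψ]
    calc |chi n (2*R) x - chi n R x - (chi n (2*R) y - chi n R y)| 
        = |(chi n (2*R) x - chi n (2*R) y) - (chi n R x - chi n R y)| := by ring_nf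
      _ ≤ _ := (abs_sub _ _).trans (by linarith)
  have key : ∀ a b, R ≤ ‖a‖ → ‖φ a‖ * |ψ a - ψ b| ≤ K * 2 * ((R^(n+1))⁻¹ * R^(-(1/4):ℝ)) * ‖a - b‖ := by
    intro a b ha
    calc ‖φ a‖ * |ψ a - ψ b| ≤ (K * ((R^n)⁻¹ * R^(-(1/4):ℝ))) * (2 * R⁻¹ * ‖a - b‖) := by
          gcongr
          · exact (h0 a).trans (by gcongr; exact rp1 hR ha n)
          · exact hψl a b
      _ = _ := by rw [pow_succ, mul_inv]; ring
  have hmono : K * 2 * ((R^(n+1))⁻¹ * R^(-(1/4):ℝ)) * ‖a - b‖ ≤ K * 2^(n+3) * ((R^(n+1))⁻¹ * R^(-(1/4):ℝ)) * ‖a - b‖ := by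
    gcongr; rw [pow_add]; linarith
  show ‖φ a * (ψ a : ℂ) - φ b * (ψ b : ℂ)‖ ≤ _
  by_cases ha : ‖a‖ < R
  · by_cases hb : ‖b‖ < R
    · rw [hψ0 a ha, hψ0 b hb]; simp; positivity
    · push Not at hb
      refine le_trans ?_ hmono
      refine le_trans ?_ ((key b a hb).trans_eq (by rw [norm_sub_rev]))
      rw [hψ0 a ha]; simp
  · push Not at ha
    by_cases hb : ‖b‖ < R
    · refine le_trans ?_ hmono
      refine le_trans ?_ (key a b ha)
      rw [hψ0 b hb]; simp
    · push Not at hb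
      have e : φ a * (ψ a : ℂ) - φ b * (ψ b : ℂ) = φ a * ((ψ a - ψ b : ℝ) : ℂ) + (φ a - φ b) * (ψ b : ℂ) := by push_cast; ring
      rw [e]
      refine (norm_add_le _ _).trans ?_
      rw [norm_mul, norm_mul, Complex.norm_real, Complex.norm_real, Real.norm_eq_abs, Real.norm_eq_abs]
      have t1 := key a b ha
      have t2 : ‖φ a - φ b‖ * |ψ b| ≤ K * 2^(n+2) * ((R^(n+1))⁻¹ * R^(-(1/4):ℝ)) * ‖a - b‖ :=
        (mul_le_of_le_one_right (norm_nonneg _) (hψ1 b)).trans (lip_away hd hK h0 h1 hR ha hb)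
      have t3 : K * 2 * ((R^(n+1))⁻¹ * R^(-(1/4):ℝ)) * ‖a - b‖ + K * 2^(n+2) * ((R^(n+1))⁻¹ * R^(-(1/4):ℝ)) * ‖a - b‖ ≤ 
         K * 2^(n+3) * ((R^(n+1))⁻¹ * R^(-(1/4):ℝ)) * ‖a - b‖ := by
        rw [← add_mul, ← add_mul, ← mul_add]
        gcongr
        rw [pow_add, pow_add]; linarith
      linarith

end LP

open MeasureTheory
set_option linter.all false
namespace LP

variable {n : ℕ} {φ : EuclideanSpace ℝ (Fin n) → ℂ} {K : ℝ}

/-- tail mass -/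
noncomputable def Jm (n : ℕ) (K : ℝ) : ℝ := K * ∫ x : EuclideanSpace ℝ (Fin n), (1 + ‖x‖)^(-((n:ℝ) + 1/4))

lemma int_japan : Integrable (fun x : EuclideanSpace ℝ (Fin n) => (1 + ‖x‖)^(-((n:ℝ) + 1/4))) :=
  integrable_one_add_norm (by simp)

lemma Jm_nonneg (hK : 0 ≤ K) : 0 ≤ Jm n K := mul_nonneg hK (integral_nonneg fun x => by positivity)

lemma phi_int (hc : Continuous φ) (hK : 0 ≤ K)
    (h0 : ∀ x, ‖φ x‖ ≤ K * (1 + ‖x‖)^(-(n:ℝ) - 1/2)) : Integrable φ := by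
  refine (int_japan.const_mul K).mono' hc.aestronglyMeasurable (Filter.Eventually.of_forall fun x => (h0 x).trans ?_)
  gcongr
  · simp
  · linarith

lemma tail (hc : Continuous φ) (hK : 0 ≤ K)
    (h0 : ∀ x, ‖φ x‖ ≤ K * (1 + ‖x‖)^(-(n:ℝ) - 1/2)) {R : ℝ} (hR : 1 ≤ R) :
    ∫ x, ‖φ x * ((1 - chi n R x : ℝ) : ℂ)‖ ≤ Jm n K * R^(-(1/4):ℝ) := by
  have hR0 : 0 < R := by linarith
  unfold Jm
  rw [mul_right_comm, ← integral_const_mul]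
  refine integral_mono_of_nonneg (Filter.Eventually.of_forall fun x => norm_nonneg _)
    (int_japan.const_mul _) (Filter.Eventually.of_forall fun x => ?_)
  show ‖φ x * ((1 - chi n R x : ℝ) : ℂ)‖ ≤ _
  rw [norm_mul, Complex.norm_real, Real.norm_of_nonneg (by linarith [chi_le_one R x])]
  by_cases hx : ‖x‖ ≤ R
  · rw [chi_eq_one hR0 hx]; simp; positivity
  · push Not at hx
    have e : 1 - chi n R x ≤ 1 := by linarith [chi_nonneg R x]
    refine (mul_le_of_le_one_right (norm_nonneg _) e).trans ((h0 x).trans ?_)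
    have e1 : (1 + ‖x‖)^(-(n:ℝ) - 1/2) ≤ R^(-(1/4):ℝ) * (1 + ‖x‖)^(-((n:ℝ) + 1/4)) := by
      rw [show -(n:ℝ) - 1/2 = -(1/4) + -((n:ℝ) + 1/4) by ring, Real.rpow_add (by positivity)]
      gcongr ?_ * _
      exact Real.rpow_le_rpow_of_nonpos hR0 (by linarith) (by norm_num)
    calc K * (1 + ‖x‖)^(-(n:ℝ) - 1/2) ≤ K * (R^(-(1/4):ℝ) * (1 + ‖x‖)^(-((n:ℝ) + 1/4))) := by gcongr
      _ = _ := by ring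

/-- mean correction -/
noncomputable def bb (φ : EuclideanSpace ℝ (Fin n) → ℂ) (R : ℝ) : ℂ :=
  (∫ x, φ x * (chi n R x : ℂ)) / ((R^n * cmass n : ℝ) : ℂ)

/-- truncated kernel -/
noncomputable def zeta (φ : EuclideanSpace ℝ (Fin n) → ℂ) (R : ℝ) (x : EuclideanSpace ℝ (Fin n)) : ℂ :=
  φ x * (chi n R x : ℂ) - bb φ R * (chi n R x : ℂ)

/-- pieces -/
noncomputable def theta (φ : EuclideanSpace ℝ (Fin n) → ℂ) : ℕ → EuclideanSpace ℝ (Fin n) → ℂ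
  | 0 => zeta φ 1
  | m+1 => fun x => zeta φ (2^(m+1)) x - zeta φ (2^m) x

lemma theta_sum (φ : EuclideanSpace ℝ (Fin n) → ℂ) (M : ℕ) (x : EuclideanSpace ℝ (Fin n)) :
    ∑ m ∈ Finset.range (M+1), theta φ m x = zeta φ (2^M) x := by
  induction M with
  | zero => simp [theta]
  | succ M ih => rw [Finset.sum_range_succ, ih]; simp [theta]

lemma phichi_int (hc : Continuous φ) {R : ℝ} (hR : 0 < R) : Integrable fun x => φ x * (chi n R x : ℂ) := by
  have h1 : Continuous fun x => (chi n R x : ℂ) := Complex.continuous_ofReal.comp (chi_cont R)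
  refine (hc.mul h1).integrable_of_hasCompactSupport ?_
  refine HasCompactSupport.mul_left ?_
  exact (chi_supp hR).comp_left (g := fun r : ℝ => (r : ℂ)) (by simp)

lemma chiC_int {R : ℝ} (hR : 0 < R) : Integrable fun x => (chi n R x : ℂ) := (chi_int hR).ofReal

lemma zeta_int (hc : Continuous φ) {R : ℝ} (hR : 0 < R) : Integrable (zeta φ R) :=
  (phichi_int hc hR).sub ((chiC_int hR).const_mul _)

lemma zeta_cont (hc : Continuous φ) (R : ℝ) : Continuous (zeta φ R) := by
  have h1 : Continuous fun x => (chi n R x : ℂ) := Complex.continuous_ofReal.comp (chi_cont R)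
  exact (hc.mul h1).sub (continuous_const.mul h1)

lemma zeta_mean (hc : Continuous φ) {R : ℝ} (hR : 0 < R) : ∫ x, zeta φ R x = 0 := by
  unfold zeta
  rw [integral_sub (phichi_int hc hR) ((chiC_int hR).const_mul _), integral_const_mul, integral_complex_ofReal, chi_mass hR]
  unfold bb
  have := (mul_pos (pow_pos hR n) (cmass_pos (n := n))).ne'
  rw [div_mul_cancel₀ _ (by exact_mod_cast this), sub_self]

lemma theta_int (hc : Continuous φ) (m : ℕ) : Integrable (theta φ m) := by
  cases m with
  | zero => exact zeta_int hc one_pos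
  | succ m => exact (zeta_int hc (by positivity)).sub (zeta_int hc (by positivity))

lemma theta_cont (hc : Continuous φ) (m : ℕ) : Continuous (theta φ m) := by
  cases m with
  | zero => exact zeta_cont hc _
  | succ m => exact (zeta_cont hc _).sub (zeta_cont hc _)

lemma theta_mean (hc : Continuous φ) (m : ℕ) : ∫ x, theta φ m x = 0 := by
  cases m with
  | zero => exact zeta_mean hc one_pos
  | succ m =>
    simp only [theta]
    rw [integral_sub (zeta_int hc (by positivity)) (zeta_int hc (by positivity)), zeta_mean hc (by positivity),
      zeta_mean hc (by positivity), sub_zero]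

lemma mass_le (hc : Continuous φ) (hK : 0 ≤ K)
    (h0 : ∀ x, ‖φ x‖ ≤ K * (1 + ‖x‖)^(-(n:ℝ) - 1/2)) (hm : ∫ x, φ x = 0) {R : ℝ} (hR : 1 ≤ R) :
    ‖∫ x, φ x * (chi n R x : ℂ)‖ ≤ Jm n K * R^(-(1/4):ℝ) := by
  have hR0 : 0 < R := by linarith
  have : ∫ x, φ x * (chi n R x : ℂ) = - ∫ x, φ x * ((1 - chi n R x : ℝ) : ℂ) := by
    have e : ∀ x, φ x * ((1 - chi n R x : ℝ) : ℂ) = φ x - φ x * (chi n R x : ℂ) := fun x => by push_cast; ring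
    simp_rw [e]
    rw [integral_sub (phi_int hc hK h0) (phichi_int hc hR0), hm]; simp
  rw [this, norm_neg]
  exact (norm_integral_le_integral_norm _).trans (tail hc hK h0 hR)

lemma bb_le (hc : Continuous φ) (hK : 0 ≤ K)
    (h0 : ∀ x, ‖φ x‖ ≤ K * (1 + ‖x‖)^(-(n:ℝ) - 1/2)) (hm : ∫ x, φ x = 0) {R : ℝ} (hR : 1 ≤ R) :
    ‖bb φ R‖ ≤ Jm n K / cmass n * ((R^n)⁻¹ * R^(-(1/4):ℝ)) := by
  have hR0 : 0 < R := by linarith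
  have hcp := cmass_pos (n := n)
  unfold bb
  rw [norm_div, Complex.norm_real, Real.norm_of_nonneg (by positivity), div_le_iff₀ (by positivity)]
  refine (mass_le hc hK h0 hm hR).trans_eq ?_
  field_simp

lemma bchi_lip (hc : Continuous φ) (hK : 0 ≤ K)
    (h0 : ∀ x, ‖φ x‖ ≤ K * (1 + ‖x‖)^(-(n:ℝ) - 1/2)) (hm : ∫ x, φ x = 0) {R : ℝ} (hR : 1 ≤ R)
    (a b : EuclideanSpace ℝ (Fin n)) :
    ‖bb φ R * (chi n R a : ℂ) - bb φ R * (chi n R b : ℂ)‖ ≤ Jm n K / cmass n * ((R^(n+1))⁻¹ * R^(-(1/4):ℝ)) * ‖a - b‖ := by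
  have hR0 : 0 < R := by linarith
  have hcp := cmass_pos (n := n)
  have := Jm_nonneg (n := n) hK
  rw [← mul_sub, ← Complex.ofReal_sub, norm_mul, Complex.norm_real, Real.norm_eq_abs]
  calc _ ≤ (Jm n K / cmass n * ((R^n)⁻¹ * R^(-(1/4):ℝ))) * (R⁻¹ * ‖a - b‖) := by
        gcongr
        · exact bb_le hc hK h0 hm hR
        · exact chi_lip hR0 a b
    _ = _ := by rw [pow_succ, mul_inv]; ring

/-- the constant -/
noncomputable def Mc (n : ℕ) (K : ℝ) : ℝ := K * 2^(n+3) + 2 * (Jm n K / cmass n)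

/-- decay ratio -/
noncomputable def qq : ℝ := (2:ℝ)^(-(1/4):ℝ)
lemma qq_pos : 0 < qq := by unfold qq; positivity
lemma qq_lt : qq < 1 := Real.rpow_lt_one_of_one_lt_of_neg (by norm_num) (by norm_num)
lemma qq_pow (m : ℕ) : ((2:ℝ)^m)^(-(1/4):ℝ) = qq^m := by
  unfold qq
  rw [← Real.rpow_natCast 2 m, ← Real.rpow_mul (by norm_num), ← Real.rpow_natCast, ← Real.rpow_mul (by norm_num), mul_comm]

lemma theta_props (hd : Differentiable ℝ φ) (hK : 0 ≤ K)
    (h0 : ∀ x, ‖φ x‖ ≤ K * (1 + ‖x‖)^(-(n:ℝ) - 1/2))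
    (h1 : ∀ x, ‖fderiv ℝ φ x‖ ≤ K * (1 + ‖x‖)^(-(n:ℝ) - 1/2 - 1)) (hm : ∫ x, φ x = 0) (m : ℕ) :
    ∃ L ρ : ℝ, 0 ≤ L ∧ 0 < ρ ∧ (∀ a b, ‖theta φ m a - theta φ m b‖ ≤ L * ‖a - b‖) ∧
      (∀ a, ρ < ‖a‖ → theta φ m a = 0) ∧ L * ρ^(n+1) ≤ (Mc n K * 4^(n+1) * qq⁻¹) * qq^m := by
  have hc := hd.continuous
  have hcp := cmass_pos (n := n)
  have hJ := Jm_nonneg (n := n) hK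
  have hn2 : (1:ℝ) ≤ 2^n := one_le_pow₀ (by norm_num)
  have hM : 0 ≤ Mc n K := by unfold Mc; positivity
  have hq := qq_pos
  cases m with
  | zero =>
    refine ⟨Mc n K, 2, hM, by norm_num, fun a b => ?_, fun a ha => ?_, ?_⟩
    · simp only [theta, zeta]
      have e1 := bchi_lip hc hK h0 hm le_rfl a b
      have e2 : ‖φ a * (chi n 1 a : ℂ) - φ b * (chi n 1 b : ℂ)‖ ≤ 2 * K * ‖a - b‖ := by
        have e : φ a * (chi n 1 a : ℂ) - φ b * (chi n 1 b : ℂ) = φ a * ((chi n 1 a - chi n 1 b : ℝ) : ℂ) + (φ a - φ b) * (chi n 1 b : ℂ) := by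
          push_cast; ring
        rw [e]
        refine (norm_add_le _ _).trans ?_
        rw [norm_mul, norm_mul, Complex.norm_real, Complex.norm_real, Real.norm_eq_abs, Real.norm_of_nonneg (chi_nonneg _ _)]
        have t1 : ‖φ a‖ ≤ K := (h0 a).trans (mul_le_of_le_one_right hK (by
          refine Real.rpow_le_one_of_one_le_of_nonpos (by simp) ?_
          have : (0:ℝ) ≤ n := by positivity
          linarith))
        have t2 := chi_lip one_pos a b
        rw [inv_one, one_mul] at t2
        have t3 := lip_glob hd hK h1 a b
        have t4 : ‖φ a‖ * |chi n 1 a - chi n 1 b| ≤ K * ‖a - b‖ := by gcongr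
        have t5 : ‖φ a - φ b‖ * chi n 1 b ≤ K * ‖a - b‖ := (mul_le_of_le_one_right (norm_nonneg _) (chi_le_one _ _)).trans t3
        linarith
      rw [one_pow, inv_one, Real.one_rpow, mul_one, mul_one] at e1
      calc _ = ‖(φ a * (chi n 1 a : ℂ) - φ b * (chi n 1 b : ℂ)) - (bb φ 1 * (chi n 1 a : ℂ) - bb φ 1 * (chi n 1 b : ℂ))‖ := by
              congr 1; ring
        _ ≤ 2 * K * ‖a - b‖ + Jm n K / cmass n * ‖a - b‖ := (norm_sub_le _ _).trans (add_le_add e2 e1)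
        _ ≤ Mc n K * ‖a - b‖ := by
            rw [← add_mul]
            gcongr
            unfold Mc
            have : 0 ≤ Jm n K / cmass n := by positivity
            have : 2 * K ≤ K * 2^(n+3) := by rw [pow_add]; nlinarith
            linarith
    · simp [theta, zeta, chi_eq_zero one_pos (by linarith : 2 * 1 ≤ ‖a‖)]
    · rw [pow_zero, mul_one]
      have : (1:ℝ) ≤ qq⁻¹ := (one_le_inv₀ hq).2 qq_lt.le
      calc Mc n K * 2^(n+1) ≤ Mc n K * 4^(n+1) * 1 := by rw [mul_one]; gcongr; norm_num
        _ ≤ _ := by gcongr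
  | succ m =>
    set R : ℝ := 2^m with hR
    have hR1 : 1 ≤ R := one_le_pow₀ (by norm_num)
    have hR0 : 0 < R := by linarith
    have hR2 : (2:ℝ)^(m+1) = 2 * R := by rw [pow_succ]; ring
    refine ⟨Mc n K * ((R^(n+1))⁻¹ * R^(-(1/4):ℝ)), 4 * R, by positivity, by positivity, fun a b => ?_, fun a ha => ?_, ?_⟩
    · simp only [theta, zeta]
      rw [hR2, ← hR]
      have e0 := lip_piece hd hK h0 h1 hR1 a b
      have e1 := bchi_lip hc hK h0 hm hR1 a b
      have e2 := bchi_lip hc hK h0 hm (R := 2*R) (by linarith) a b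
      have e3 : Jm n K / cmass n * (((2*R)^(n+1))⁻¹ * (2*R)^(-(1/4):ℝ)) * ‖a - b‖ ≤ Jm n K / cmass n * ((R^(n+1))⁻¹ * R^(-(1/4):ℝ)) * ‖a - b‖ := by
        have : (2*R)^(-(1/4):ℝ) ≤ R^(-(1/4):ℝ) := Real.rpow_le_rpow_of_nonpos hR0 (by linarith) (by norm_num)
        gcongr
        linarith
      set u := φ a * ((chi n (2*R) a - chi n R a : ℝ) : ℂ) - φ b * ((chi n (2*R) b - chi n R b : ℝ) : ℂ) with hu
      set v := bb φ R * (chi n R a : ℂ) - bb φ R * (chi n R b : ℂ) with hv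
      set z := bb φ (2*R) * (chi n (2*R) a : ℂ) - bb φ (2*R) * (chi n (2*R) b : ℂ) with hz
      calc _ = ‖(u - z) + v‖ := by congr 1; rw [hu, hv, hz]; push_cast; ring
        _ ≤ ‖u‖ + ‖z‖ + ‖v‖ := (norm_add_le _ _).trans (add_le_add (norm_sub_le _ _) le_rfl)
        _ ≤ _ := (add_le_add (add_le_add e0 (e2.trans e3)) e1)
        _ = _ := by unfold Mc; ring
    · simp only [theta, zeta]
      rw [hR2, ← hR, chi_eq_zero (R := 2*R) (by positivity) (by linarith), chi_eq_zero (R := R) (by positivity) (by linarith)]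
      simp
    · rw [hR, qq_pow, ← hR, mul_pow, pow_succ qq m]
      apply le_of_eq
      have : R^(n+1) ≠ 0 := by positivity
      field_simp

end LP

open MeasureTheory
set_option linter.all false
namespace LP

variable {n : ℕ} {φ f θ : EuclideanSpace ℝ (Fin n) → ℂ} {K B : ℝ}

lemma cv_meas (hf : Continuous f) (hθ : Continuous θ) :
    Measurable fun p : ℝ × EuclideanSpace ℝ (Fin n) => cv f θ p.1 p.2 := by
  unfold cv
  have h : Measurable fun q : (ℝ × EuclideanSpace ℝ (Fin n)) × EuclideanSpace ℝ (Fin n) =>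
      f q.2 * ((((q.1.1^n)⁻¹ : ℝ) : ℂ) * θ (q.1.1⁻¹ • (q.1.2 - q.2))) := by
    have := hf.measurable; have := hθ.measurable
    fun_prop
  exact (h.stronglyMeasurable.integral_prod_right').measurable

lemma cv_meas_comp {Ω : Type*} [MeasurableSpace Ω] (hf : Continuous f) (hθ : Continuous θ) {g : Ω → ℝ}
    {h : Ω → EuclideanSpace ℝ (Fin n)} (hg : Measurable g) (hh : Measurable h) :
    Measurable fun ω => cv f θ (g ω) (h ω) := by
  have := Measurable.comp (cv_meas hf hθ) (hg.prodMk hh)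
  exact this

lemma cv_meas_t (hf : Continuous f) (hθ : Continuous θ) (x : EuclideanSpace ℝ (Fin n)) :
    Measurable fun t : ℝ => ‖cv f θ t x‖ₑ^2 * (ENNReal.ofReal t)⁻¹ := by
  have h1 : Measurable fun t : ℝ => cv f θ t x := cv_meas_comp hf hθ measurable_id measurable_const
  have e : Measurable fun t : ℝ => (ENNReal.ofReal t)⁻¹ := by fun_prop
  exact (h1.enorm.pow_const 2).mul e

lemma cv_meas_G (hf : Continuous f) (hθ : Continuous θ) :
    Measurable fun x => ∫⁻ t in Set.Ioi (0:ℝ), ‖cv f θ t x‖ₑ^2 * (ENNReal.ofReal t)⁻¹ := by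
  have e0 : Measurable fun p : EuclideanSpace ℝ (Fin n) × ℝ => cv f θ p.2 p.1 :=
    cv_meas_comp hf hθ measurable_snd measurable_fst
  have e : Measurable fun p : EuclideanSpace ℝ (Fin n) × ℝ => (ENNReal.ofReal p.2)⁻¹ := by fun_prop
  have e1 : Measurable fun p : EuclideanSpace ℝ (Fin n) × ℝ => ‖cv f θ p.2 p.1‖ₑ^2 * (ENNReal.ofReal p.2)⁻¹ :=
    (e0.enorm.pow_const 2).mul e
  exact Measurable.lintegral_prod_right' (ν := volume.restrict (Set.Ioi (0:ℝ))) e1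

lemma cv_intble (hf : Continuous f) (hB : ∀ x, ‖f x‖ ≤ B) (hθ : Integrable θ) {t : ℝ} (ht : 0 < t)
    (x : EuclideanSpace ℝ (Fin n)) :
    Integrable fun y => f y * ((((t^n)⁻¹ : ℝ) : ℂ) * θ (t⁻¹ • (x - y))) := by
  have h1 : Integrable fun y => θ (t⁻¹ • (x - y)) :=
    ((integrable_comp_smul_iff volume θ (inv_ne_zero ht.ne')).2 hθ).comp_sub_left x
  exact (h1.const_mul _).bdd_mul hf.aestronglyMeasurable (Filter.Eventually.of_forall hB)

lemma cv_norm_le (hf : Continuous f) (hB : ∀ x, ‖f x‖ ≤ B) (hθ : Integrable θ) {t : ℝ} (ht : 0 < t)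
    (x : EuclideanSpace ℝ (Fin n)) : ‖cv f θ t x‖ ≤ B * ∫ y, ‖θ y‖ := by
  unfold cv
  have hB0 : 0 ≤ B := (norm_nonneg _).trans (hB 0)
  have h1 : Integrable fun y => θ (t⁻¹ • (x - y)) :=
    ((integrable_comp_smul_iff volume θ (inv_ne_zero ht.ne')).2 hθ).comp_sub_left x
  calc _ ≤ ∫ y, ‖f y * ((((t^n)⁻¹ : ℝ) : ℂ) * θ (t⁻¹ • (x - y)))‖ := norm_integral_le_integral_norm _
    _ ≤ ∫ y, (B * (t^n)⁻¹) * ‖θ (t⁻¹ • (x - y))‖ := by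
      refine integral_mono (cv_intble hf hB hθ ht x).norm (h1.norm.const_mul _) fun y => ?_
      show ‖f y * ((((t^n)⁻¹ : ℝ) : ℂ) * θ (t⁻¹ • (x - y)))‖ ≤ _
      rw [norm_mul, norm_mul, Complex.norm_real, Real.norm_of_nonneg (by positivity), ← mul_assoc]
      gcongr
      exact hB y
    _ = _ := by
      rw [integral_const_mul, integral_dil (fun z => ‖θ z‖) ht x, smul_eq_mul]
      have : t^n ≠ 0 := by positivity
      field_simp

lemma cv_sub (hf : Continuous f) (hB : ∀ x, ‖f x‖ ≤ B) (hθ : Integrable θ) (hφ : Integrable φ) {t : ℝ} (ht : 0 < t)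
    (x : EuclideanSpace ℝ (Fin n)) : cv f (fun z => φ z - θ z) t x = cv f φ t x - cv f θ t x := by
  unfold cv
  rw [← integral_sub (cv_intble hf hB hφ ht x) (cv_intble hf hB hθ ht x)]
  congr 1; funext y; ring

lemma cv_sum (hf : Continuous f) (hB : ∀ x, ‖f x‖ ≤ B) (s : Finset ℕ) {Θ : ℕ → EuclideanSpace ℝ (Fin n) → ℂ}
    (hθ : ∀ m, Integrable (Θ m)) {t : ℝ} (ht : 0 < t)
    (x : EuclideanSpace ℝ (Fin n)) : cv f (fun z => ∑ m ∈ s, Θ m z) t x = ∑ m ∈ s, cv f (Θ m) t x := by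
  unfold cv
  rw [← integral_finsetSum _ (fun m _ => cv_intble hf hB (hθ m) ht x)]
  congr 1; funext y; rw [Finset.mul_sum, Finset.mul_sum]

lemma zeta_close (hc : Continuous φ) (hK : 0 ≤ K)
    (h0 : ∀ x, ‖φ x‖ ≤ K * (1 + ‖x‖)^(-(n:ℝ) - 1/2)) (hm : ∫ x, φ x = 0) {R : ℝ} (hR : 1 ≤ R) :
    ∫ x, ‖φ x - zeta φ R x‖ ≤ 2 * Jm n K * R^(-(1/4):ℝ) := by
  have hR0 : 0 < R := by linarith
  have hcp := cmass_pos (n := n)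
  have i1 : Integrable fun x => φ x * ((1 - chi n R x : ℝ) : ℂ) := by
    have : (fun x => φ x * ((1 - chi n R x : ℝ) : ℂ)) = fun x => φ x - φ x * (chi n R x : ℂ) := by
      funext x; push_cast; ring
    rw [this]
    exact (phi_int hc hK h0).sub (phichi_int hc hR0)
  have i2 : Integrable fun x => ‖bb φ R‖ * chi n R x := (chi_int hR0).const_mul _
  calc ∫ x, ‖φ x - zeta φ R x‖ ≤ ∫ x, (‖φ x * ((1 - chi n R x : ℝ) : ℂ)‖ + ‖bb φ R‖ * chi n R x) := by
        refine integral_mono ((phi_int hc hK h0).sub (zeta_int hc hR0)).norm (i1.norm.add i2) fun x => ?_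
        show ‖φ x - zeta φ R x‖ ≤ _
        have : φ x - zeta φ R x = φ x * ((1 - chi n R x : ℝ) : ℂ) + bb φ R * (chi n R x : ℂ) := by
          unfold zeta; push_cast; ring
        rw [this]
        refine (norm_add_le _ _).trans_eq ?_
        rw [norm_mul (bb φ R), Complex.norm_real, Real.norm_of_nonneg (chi_nonneg _ _)]
    _ = (∫ x, ‖φ x * ((1 - chi n R x : ℝ) : ℂ)‖) + ‖bb φ R‖ * (R^n * cmass n) := by
        rw [integral_add i1.norm i2, integral_const_mul, chi_mass hR0]
    _ ≤ Jm n K * R^(-(1/4):ℝ) + Jm n K * R^(-(1/4):ℝ) := by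
        refine add_le_add (tail hc hK h0 hR) ?_
        unfold bb
        rw [norm_div, Complex.norm_real, Real.norm_of_nonneg (by positivity), div_mul_cancel₀ _ (by positivity)]
        exact mass_le hc hK h0 hm hR
    _ = _ := by ring

lemma cv_le_tsum (hc : Continuous φ) (hK : 0 ≤ K)
    (h0 : ∀ x, ‖φ x‖ ≤ K * (1 + ‖x‖)^(-(n:ℝ) - 1/2)) (hm : ∫ x, φ x = 0)
    (hf : Continuous f) (hB : ∀ x, ‖f x‖ ≤ B) {t : ℝ} (ht : 0 < t) (x : EuclideanSpace ℝ (Fin n)) :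
    ‖cv f φ t x‖ₑ ≤ ∑' m, ‖cv f (theta φ m) t x‖ₑ := by
  have hφ := phi_int hc hK h0
  have hB0 : 0 ≤ B := (norm_nonneg _).trans (hB 0)
  have key : ∀ M : ℕ, ‖cv f φ t x‖ₑ ≤ ENNReal.ofReal (B * (2 * Jm n K * qq^M)) + ∑' m, ‖cv f (theta φ m) t x‖ₑ := by
    intro M
    have hz := zeta_int hc (R := 2^M) (by positivity)
    have e1 : cv f φ t x = cv f (fun z => φ z - zeta φ (2^M) z) t x + ∑ m ∈ Finset.range (M+1), cv f (theta φ m) t x := by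
      rw [← cv_sum hf hB _ (theta_int hc) ht x, cv_sub hf hB hz hφ ht x]
      have : (fun z => ∑ m ∈ Finset.range (M+1), theta φ m z) = zeta φ (2^M) := by
        funext z; exact theta_sum φ M z
      rw [this]; ring
    rw [e1]
    refine (enorm_add_le _ _).trans (add_le_add ?_ ?_)
    · rw [← ofReal_norm_eq_enorm]
      apply ENNReal.ofReal_le_ofReal
      refine (cv_norm_le hf hB (hφ.sub hz) ht x).trans ?_
      gcongr
      rw [← qq_pow]
      exact zeta_close hc hK h0 hm (one_le_pow₀ (by norm_num))
    · exact (enorm_sum_le _ _).trans (ENNReal.sum_le_tsum _)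
  have lim : Filter.Tendsto (fun M : ℕ => ENNReal.ofReal (B * (2 * Jm n K * qq^M)) + ∑' m, ‖cv f (theta φ m) t x‖ₑ)
      Filter.atTop (nhds (ENNReal.ofReal (B * (2 * Jm n K * 0)) + ∑' m, ‖cv f (theta φ m) t x‖ₑ)) := by
    refine (ENNReal.tendsto_ofReal ?_).add_const _
    exact ((tendsto_pow_atTop_nhds_zero_of_lt_one qq_pos.le qq_lt).const_mul _).const_mul _
  have := ge_of_tendsto' lim key
  simpa using this

/-- The constant for the kernel. -/
noncomputable def Kc (n : ℕ) (K : ℝ) : ℝ := ((1 - qq)⁻¹ * (Mc n K * 4^(n+1) * qq⁻¹))^2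

theorem one_step_gen (hd : Differentiable ℝ φ) (hK : 0 ≤ K)
    (h0 : ∀ x, ‖φ x‖ ≤ K * (1 + ‖x‖)^(-(n:ℝ) - 1/2))
    (h1 : ∀ x, ‖fderiv ℝ φ x‖ ≤ K * (1 + ‖x‖)^(-(n:ℝ) - 1/2 - 1)) (hm : ∫ x, φ x = 0)
    {w σ : EuclideanSpace ℝ (Fin n) → ℝ} {Q r Cr : ℝ}
    (hW : ∀ α, (grid n α).Wt w σ Q r Cr) (hf : Continuous f) (hB : ∀ x, ‖f x‖ ≤ B) :
    ∫⁻ x, (∫⁻ t in Set.Ioi (0:ℝ), ‖cv f φ t x‖ₑ ^ 2 * (ENNReal.ofReal t)⁻¹) * ENNReal.ofReal (w x)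
      ≤ ENNReal.ofReal (C1 n Q r Cr * Kc n K) * ∫⁻ x, ‖f x‖ₑ ^ 2 * ENNReal.ofReal (w x) := by
  have hc := hd.continuous
  have mw := (hW fun _ => false).mw.ennreal_ofReal
  have hQ : 0 < Q := (hW fun _ => false).Q_pos 0
  have hC1 : 0 ≤ C1 n Q r Cr := by unfold C1 Cdy; positivity
  have hq := qq_pos
  have hq1 : 0 < 1 - qq := by linarith [qq_lt]
  set I := ∫⁻ x, ‖f x‖ₑ ^ 2 * ENNReal.ofReal (w x) with hI
  set N := Mc n K * 4^(n+1) * qq⁻¹ with hN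
  have hsum : ∑' m : ℕ, ENNReal.ofReal (qq^m) = ENNReal.ofReal (1 - qq)⁻¹ := by
    rw [← ENNReal.ofReal_tsum_of_nonneg (fun j => by positivity) (summable_geometric_of_lt_one hq.le qq_lt),
      tsum_geometric_of_lt_one hq.le qq_lt]
  set S := ENNReal.ofReal (1 - qq)⁻¹ with hS
  have hinv : ∀ m, ENNReal.ofReal (qq^m) * (ENNReal.ofReal (qq^m))⁻¹ = 1 := fun m =>
    ENNReal.mul_inv_cancel (by simpa using (pow_pos hq m)) ENNReal.ofReal_ne_top
  have pt : ∀ x, ∀ t ∈ Set.Ioi (0:ℝ), ‖cv f φ t x‖ₑ ^ 2 ≤ S * ∑' m, (ENNReal.ofReal (qq^m))⁻¹ * ‖cv f (theta φ m) t x‖ₑ^2 := by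
    intro x t ht
    have := cs_tsum (fun m : ℕ => ENNReal.ofReal (qq^m)) (fun m => (ENNReal.ofReal (qq^m))⁻¹ * ‖cv f (theta φ m) t x‖ₑ)
    rw [hsum] at this
    refine le_trans ?_ (this.trans_eq ?_)
    · gcongr
      refine (cv_le_tsum hc hK h0 hm hf hB ht x).trans_eq ?_
      congr 1; funext m
      rw [← mul_assoc, hinv, one_mul]
    · congr 2; funext m
      rw [mul_pow, sq (ENNReal.ofReal (qq^m))⁻¹, mul_assoc, ← mul_assoc, hinv, one_mul]
  have mG : ∀ m, Measurable fun x => ∫⁻ t in Set.Ioi (0:ℝ), ‖cv f (theta φ m) t x‖ₑ^2 * (ENNReal.ofReal t)⁻¹ := fun m =>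
    cv_meas_G hf (theta_cont hc m)
  have pt2 : ∀ x, ∫⁻ t in Set.Ioi (0:ℝ), ‖cv f φ t x‖ₑ ^ 2 * (ENNReal.ofReal t)⁻¹ ≤
      S * ∑' m, (ENNReal.ofReal (qq^m))⁻¹ * ∫⁻ t in Set.Ioi (0:ℝ), ‖cv f (theta φ m) t x‖ₑ^2 * (ENNReal.ofReal t)⁻¹ := by
    intro x
    have mx : ∀ m, Measurable fun t => ‖cv f (theta φ m) t x‖ₑ^2 * (ENNReal.ofReal t)⁻¹ := fun m =>
      cv_meas_t hf (theta_cont hc m) x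
    have mx2 : ∀ m, Measurable fun t => (ENNReal.ofReal (qq^m))⁻¹ * (‖cv f (theta φ m) t x‖ₑ^2 * (ENNReal.ofReal t)⁻¹) := fun m =>
      (mx m).const_mul _
    calc _ ≤ ∫⁻ t in Set.Ioi (0:ℝ), S * ∑' m, (ENNReal.ofReal (qq^m))⁻¹ * (‖cv f (theta φ m) t x‖ₑ^2 * (ENNReal.ofReal t)⁻¹) := by
          refine setLIntegral_mono' measurableSet_Ioi fun t ht => ?_
          calc _ ≤ (S * ∑' m, (ENNReal.ofReal (qq^m))⁻¹ * ‖cv f (theta φ m) t x‖ₑ^2) * (ENNReal.ofReal t)⁻¹ := by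
                gcongr; exact pt x t ht
            _ = _ := by
              rw [mul_assoc, ← ENNReal.tsum_mul_right]; simp_rw [mul_assoc]
      _ = _ := by
          rw [lintegral_const_mul _ (Measurable.tsum mx2), lintegral_tsum fun m => (mx2 m).aemeasurable]
          congr 2; funext m
          rw [lintegral_const_mul _ (mx m)]
  have m3 : ∀ m, Measurable fun x => (∫⁻ t in Set.Ioi (0:ℝ), ‖cv f (theta φ m) t x‖ₑ^2 * (ENNReal.ofReal t)⁻¹) * ENNReal.ofReal (w x) :=
    fun m => (mG m).mul mw
  have m4 : ∀ m, Measurable fun x => (ENNReal.ofReal (qq^m))⁻¹ * ((∫⁻ t in Set.Ioi (0:ℝ), ‖cv f (theta φ m) t x‖ₑ^2 * (ENNReal.ofReal t)⁻¹) * ENNReal.ofReal (w x)) :=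
    fun m => (m3 m).const_mul _
  calc _ ≤ ∫⁻ x, S * ∑' m, (ENNReal.ofReal (qq^m))⁻¹ * ((∫⁻ t in Set.Ioi (0:ℝ), ‖cv f (theta φ m) t x‖ₑ^2 * (ENNReal.ofReal t)⁻¹) * ENNReal.ofReal (w x)) := by
        refine lintegral_mono fun x => ?_
        calc _ ≤ (S * ∑' m, (ENNReal.ofReal (qq^m))⁻¹ * ∫⁻ t in Set.Ioi (0:ℝ), ‖cv f (theta φ m) t x‖ₑ^2 * (ENNReal.ofReal t)⁻¹) * ENNReal.ofReal (w x) := by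
              gcongr; exact pt2 x
          _ = _ := by
              rw [mul_assoc, ← ENNReal.tsum_mul_right]; simp_rw [mul_assoc]
    _ = S * ∑' m, (ENNReal.ofReal (qq^m))⁻¹ * ∫⁻ x, (∫⁻ t in Set.Ioi (0:ℝ), ‖cv f (theta φ m) t x‖ₑ^2 * (ENNReal.ofReal t)⁻¹) * ENNReal.ofReal (w x) := by
        rw [lintegral_const_mul _ (Measurable.tsum m4), lintegral_tsum fun m => (m4 m).aemeasurable]
        congr 2; funext m
        rw [lintegral_const_mul _ (m3 m)]
    _ ≤ S * ∑' m, (ENNReal.ofReal (qq^m))⁻¹ * (ENNReal.ofReal (C1 n Q r Cr * (N * qq^m)^2) * I) := by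
        gcongr with m
        obtain ⟨L, ρ, hL, hρ, hlip, hsupp, hLρ⟩ := theta_props hd hK h0 h1 hm m
        refine (one_step hW hL hρ hlip hsupp (theta_mean hc m) hf hB).trans ?_
        gcongr
    _ = S * ∑' m, ENNReal.ofReal (qq^m) * (ENNReal.ofReal (C1 n Q r Cr * N^2) * I) := by
        congr 2; funext m
        rw [show C1 n Q r Cr * (N * qq^m)^2 = qq^m * (qq^m * (C1 n Q r Cr * N^2)) by ring, ENNReal.ofReal_mul (by positivity),
          ENNReal.ofReal_mul (by positivity), mul_assoc, ← mul_assoc _ (ENNReal.ofReal (qq^m)), mul_comm _ (ENNReal.ofReal (qq^m)), hinv, one_mul, mul_assoc]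
    _ = _ := by
        rw [ENNReal.tsum_mul_right, hsum]
        have : C1 n Q r Cr * Kc n K = (1-qq)⁻¹ * ((1-qq)⁻¹ * (C1 n Q r Cr * N^2)) := by unfold Kc; rw [← hN]; ring
        have p1 : 0 ≤ (1-qq)⁻¹ := by positivity
        rw [this, ENNReal.ofReal_mul (p := (1-qq)⁻¹) p1, ENNReal.ofReal_mul (p := (1-qq)⁻¹) p1, ← hS]
        ring

end LP

open MeasureTheory
set_option linter.all false
namespace LP
namespace DySys
variable {X : Type*} [MeasurableSpace X] {μ : Measure X} (S : DySys X μ)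

/-- an `A_1` type function -/
structure A1 (u : X → ℝ) (a : ℝ) : Prop where
  mu : Measurable u
  u0 : ∀ x, 0 ≤ u x
  pos : ∀ᵐ x ∂μ, 0 < u x
  iu : ∀ k x, IntegrableOn u (S.cell k x) μ
  a0 : 0 ≤ a
  bd : ∀ k x, ∀ᵐ y ∂μ, y ∈ S.cell k x → S.E k u x ≤ a * u y

variable {S} {u : X → ℝ} {a : ℝ}

lemma A1.Epos (h : S.A1 u a) (k : ℤ) (x : X) : 0 < S.E k u x := by
  unfold DySys.E
  refine smul_pos (inv_pos.2 (S.m_pos k)) ?_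
  rw [setIntegral_pos_iff_support_of_nonneg_ae (Filter.Eventually.of_forall h.u0) (h.iu k x)]
  have : μ (Function.support u ∩ S.cell k x) = μ (S.cell k x) := by
    refine measure_congr ?_
    filter_upwards [h.pos] with y hy
    have : y ∈ Function.support u := hy.ne'
    apply propext
    exact ⟨fun h => h.2, fun h => ⟨this, h⟩⟩
  rw [this, S.vol]
  exact ENNReal.ofReal_pos.2 (S.m_pos k)

lemma A1.wt1 (h : S.A1 u a) : S.Wt u (fun x => (u x)⁻¹) a 2 (a^2) := by
  have hb : ∀ k x, ∀ᵐ y ∂μ, y ∈ S.cell k x → (u y)⁻¹ ≤ a * (S.E k u x)⁻¹ := by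
    intro k x
    filter_upwards [h.pos, h.bd k x] with y hy hby hyc
    have := hby hyc
    have hE := h.Epos k x
    rw [← div_eq_mul_inv, le_div_iff₀ hE, inv_mul_le_iff₀ hy]; linarith
  have his : ∀ k x, IntegrableOn (fun x => (u x)⁻¹) (S.cell k x) μ := by
    intro k x
    refine S.integrableOn_of_bdd h.mu.inv.aestronglyMeasurable (a * (S.E k u x)⁻¹) ?_
    filter_upwards [hb k x] with y hy hyc
    rw [Real.norm_of_nonneg (inv_nonneg.2 (h.u0 y))]; exact hy hyc
  have hir : ∀ k x, IntegrableOn (fun x => (u x)⁻¹ ^ (2:ℝ)) (S.cell k x) μ := by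
    intro k x
    refine S.integrableOn_of_bdd (h.mu.inv.pow_const _).aestronglyMeasurable ((a * (S.E k u x)⁻¹)^2) ?_
    filter_upwards [hb k x] with y hy hyc
    have := inv_nonneg.2 (h.u0 y)
    rw [Real.norm_of_nonneg (by positivity), Real.rpow_two]
    gcongr; exact hy hyc
  have low : ∀ k x, 1 ≤ S.E k u x * S.E k (fun x => (u x)⁻¹) x := by
    intro k x
    have hE := h.Epos k x
    set M := S.E k u x with hM
    have h2 := S.E_mono_ae (k := k) (x := x) (f := fun _ => (2:ℝ)) (g := fun y => M⁻¹ * u y + M * (u y)⁻¹)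
      (integrableOn_const (S.vol_lt_top k x).ne) (((h.iu k x).const_mul _).add ((his k x).const_mul _)) (by
        filter_upwards [h.pos] with y hy _
        have e : M⁻¹ * u y * (M * (u y)⁻¹) = 1 := by field_simp
        have p1 : 0 < M⁻¹ * u y := by positivity
        have p2 : 0 < M * (u y)⁻¹ := by positivity
        nlinarith [sq_nonneg (M⁻¹ * u y - M * (u y)⁻¹)])
    rw [S.E_const, S.E_add ((h.iu k x).const_mul _) ((his k x).const_mul _), S.E_const_mul, S.E_const_mul, ← hM,
      inv_mul_cancel₀ hE.ne'] at h2
    linarith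
  refine ⟨h.mu, h.mu.inv, h.u0, fun x => inv_nonneg.2 (h.u0 x), ?_, h.iu, his, by norm_num, hir, fun k x => ?_, fun k x => ?_⟩
  · filter_upwards [h.pos] with y hy; exact mul_inv_cancel₀ hy.ne'
  · have hE := h.Epos k x
    have := S.E_mono_ae (his k x) (integrableOn_const (C := a * (S.E k u x)⁻¹) (S.vol_lt_top k x).ne) (hb k x)
    rw [S.E_const] at this
    calc _ ≤ S.E k u x * (a * (S.E k u x)⁻¹) := by gcongr
      _ = a := by field_simp
  · have hE := h.Epos k x
    have := S.E_mono_ae (hir k x) (integrableOn_const (C := (a * (S.E k u x)⁻¹)^2) (S.vol_lt_top k x).ne) (by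
      filter_upwards [hb k x] with y hy hyc
      have := inv_nonneg.2 (h.u0 y)
      rw [Real.rpow_two]
      gcongr; exact hy hyc)
    rw [S.E_const] at this
    refine this.trans ?_
    rw [Real.rpow_two, mul_pow]
    gcongr
    rw [inv_le_iff_one_le_mul₀ hE]; linarith [low k x]

lemma A1.wt2 (h : S.A1 u a) {θ : ℝ} (hθ0 : 0 < θ) (hθ1 : θ < 1) :
    S.Wt (fun x => (u x ^ θ)⁻¹) (fun x => u x ^ θ) (a^θ) (1/θ) a := by
  have hr : 1 < 1/θ := by rw [lt_div_iff₀ hθ0]; linarith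
  have hb : ∀ k x, ∀ᵐ y ∂μ, y ∈ S.cell k x → (S.E k u x)^θ ≤ a^θ * u y ^ θ := by
    intro k x
    filter_upwards [h.bd k x] with y hby hyc
    rw [← Real.mul_rpow h.a0 (h.u0 y)]
    exact Real.rpow_le_rpow (h.Epos k x).le (hby hyc) hθ0.le
  have hb' : ∀ k x, ∀ᵐ y ∂μ, y ∈ S.cell k x → (u y ^ θ)⁻¹ ≤ a^θ * ((S.E k u x)^θ)⁻¹ := by
    intro k x
    filter_upwards [h.pos, hb k x] with y hy hby hyc
    have := hby hyc
    have hE := h.Epos k x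
    rw [← div_eq_mul_inv, le_div_iff₀ (by positivity), inv_mul_le_iff₀ (by positivity)]; linarith
  have hj : ∀ k x y, u y ^ θ ≤ (S.E k u x)^θ * (1 - θ + θ * ((S.E k u x)⁻¹ * u y)) := by
    intro k x y
    have hE := h.Epos k x
    have e := Real.geom_mean_le_arith_mean2_weighted hθ0.le (by linarith : 0 ≤ 1 - θ)
      (mul_nonneg (inv_nonneg.2 hE.le) (h.u0 y)) zero_le_one (by ring)
    rw [Real.one_rpow, mul_one, Real.mul_rpow (inv_nonneg.2 hE.le) (h.u0 y), Real.inv_rpow hE.le, inv_mul_le_iff₀ (by positivity)] at e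
    linarith
  have i0 : ∀ k x, IntegrableOn (fun y => (S.E k u x)^θ * (1 - θ + θ * ((S.E k u x)⁻¹ * u y))) (S.cell k x) μ := by
    intro k x
    exact ((integrableOn_const (S.vol_lt_top k x).ne).add (((h.iu k x).const_mul _).const_mul _)).const_mul _
  have his : ∀ k x, IntegrableOn (fun x => u x ^ θ) (S.cell k x) μ := by
    intro k x
    refine (i0 k x).mono' (h.mu.pow_const _).aestronglyMeasurable (Filter.Eventually.of_forall fun y => ?_)
    rw [Real.norm_of_nonneg (Real.rpow_nonneg (h.u0 y) _)]
    exact hj k x y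
  have hiw : ∀ k x, IntegrableOn (fun x => (u x ^ θ)⁻¹) (S.cell k x) μ := by
    intro k x
    refine S.integrableOn_of_bdd (h.mu.pow_const _).inv.aestronglyMeasurable (a^θ * ((S.E k u x)^θ)⁻¹) ?_
    filter_upwards [hb' k x] with y hy hyc
    rw [Real.norm_of_nonneg (inv_nonneg.2 (Real.rpow_nonneg (h.u0 y) _))]; exact hy hyc
  have er : ∀ y, (u y ^ θ)^(1/θ) = u y := fun y => by
    rw [← Real.rpow_mul (h.u0 y), mul_one_div_cancel hθ0.ne', Real.rpow_one]
  refine ⟨(h.mu.pow_const _).inv, h.mu.pow_const _, fun x => inv_nonneg.2 (Real.rpow_nonneg (h.u0 x) _), fun x => Real.rpow_nonneg (h.u0 x) _, ?_, hiw, his, hr, 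
    fun k x => ?_, fun k x => ?_, fun k x => ?_⟩
  · filter_upwards [h.pos] with y hy; exact inv_mul_cancel₀ (by positivity)
  · simp_rw [er]; exact h.iu k x
  · have hE := h.Epos k x
    have e1 := S.E_mono_ae (hiw k x) (integrableOn_const (C := a^θ * ((S.E k u x)^θ)⁻¹) (S.vol_lt_top k x).ne) (hb' k x)
    have e2 := S.E_mono_ae (his k x) (i0 k x) (Filter.Eventually.of_forall fun y _ => hj k x y)
    rw [S.E_const] at e1
    rw [S.E_const_mul, S.E_add (integrableOn_const (S.vol_lt_top k x).ne) (((h.iu k x).const_mul _).const_mul _), S.E_const, S.E_const_mul, S.E_const_mul,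
      inv_mul_cancel₀ hE.ne'] at e2
    have ha := Real.rpow_nonneg h.a0 θ
    have hn : 0 ≤ S.E k (fun x => u x ^ θ) x := S.E_nonneg fun y => Real.rpow_nonneg (h.u0 y) _
    calc _ ≤ (a^θ * ((S.E k u x)^θ)⁻¹) * ((S.E k u x)^θ * (1 - θ + θ * 1)) := by gcongr
      _ = a^θ := by
        have : (S.E k u x)^θ ≠ 0 := by positivity
        field_simp; ring
  · simp_rw [er]
    have hE := h.Epos k x
    have ha := Real.rpow_nonneg h.a0 θ
    have e1 := S.E_mono_ae (integrableOn_const (C := (S.E k u x)^θ) (S.vol_lt_top k x).ne) ((his k x).const_mul (a^θ)) (hb k x)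
    rw [S.E_const, S.E_const_mul] at e1
    have hn : 0 ≤ S.E k (fun x => u x ^ θ) x := S.E_nonneg fun y => Real.rpow_nonneg (h.u0 y) _
    have e2 := Real.rpow_le_rpow (by positivity) e1 (by positivity : 0 ≤ 1/θ)
    rw [Real.mul_rpow ha hn, ← Real.rpow_mul hE.le, ← Real.rpow_mul h.a0, mul_one_div_cancel hθ0.ne', Real.rpow_one, Real.rpow_one] at e2
    exact e2

end DySys

variable {n : ℕ} {φ : EuclideanSpace ℝ (Fin n) → ℂ} {K : ℝ}

/-- the one-variable weighted inequality -/
def Good (φ : EuclideanSpace ℝ (Fin n) → ℂ) (C : ENNReal) (v : EuclideanSpace ℝ (Fin n) → ENNReal) : Prop :=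
  ∀ f : EuclideanSpace ℝ (Fin n) → ℂ, Continuous f → (∃ B : ℝ, ∀ x, ‖f x‖ ≤ B) →
    ∫⁻ x, (∫⁻ t in Set.Ioi (0:ℝ), ‖cv f φ t x‖ₑ ^ 2 * (ENNReal.ofReal t)⁻¹) * v x ≤ C * ∫⁻ x, ‖f x‖ₑ ^ 2 * v x

/-- kernel hypotheses -/
structure Ker (φ : EuclideanSpace ℝ (Fin n) → ℂ) (K : ℝ) : Prop where
  hd : Differentiable ℝ φ
  hK : 0 ≤ K
  h0 : ∀ x, ‖φ x‖ ≤ K * (1 + ‖x‖)^(-(n:ℝ) - 1/2)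
  h1 : ∀ x, ‖fderiv ℝ φ x‖ ≤ K * (1 + ‖x‖)^(-(n:ℝ) - 1/2 - 1)
  hm : ∫ x, φ x = 0

/-- ENNReal `A_1` function -/
structure EA1 (U : EuclideanSpace ℝ (Fin n) → ENNReal) (a : ℝ) : Prop where
  m : Measurable U
  pos : ∀ x, 0 < U x
  a0 : 0 ≤ a
  bd : ∀ α k x, (grid n α).A k U x ≤ ENNReal.ofReal a * U x

lemma EA1.fin {U : EuclideanSpace ℝ (Fin n) → ENNReal} {a : ℝ} (h : EA1 U a) {x₀ : EuclideanSpace ℝ (Fin n)} (hx : U x₀ < ⊤) :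
    ∀ᵐ x, U x < ⊤ := by
  have key : ∀ N : ℕ, ∀ᵐ x, ‖x - x₀‖ ≤ N → U x < ⊤ := by
    intro N
    obtain ⟨k, hk⟩ : ∃ k : ℤ, (2:ℝ)^k * N ≤ 1/12 := by
      obtain ⟨j, hj⟩ := exists_pow_lt_of_lt_one (show (0:ℝ) < 1/(12*(N+1)) by positivity) (by norm_num : (1/2:ℝ) < 1)
      refine ⟨-(j:ℤ), ?_⟩
      rw [zpow_neg, zpow_natCast, ← inv_pow]
      rw [one_div] at hj
      calc (2⁻¹:ℝ)^j * N ≤ 1/(12*(N+1)) * (N+1) := by gcongr; linarith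
        _ = 1/12 := by field_simp
    obtain ⟨α, hα⟩ := grid_cover hk x₀
    have h1 : ∫⁻ y in (grid n α).cell k x₀, U y < ⊤ := by
      have h2 := (h.bd α k x₀).trans_lt (ENNReal.mul_lt_top ENNReal.ofReal_lt_top hx)
      unfold DySys.A at h2
      by_contra h3
      rw [not_lt, top_le_iff] at h3
      rw [h3, ENNReal.mul_top (by simp)] at h2
      exact lt_irrefl _ h2
    have h2 := ae_lt_top h.m h1.ne
    rw [ae_restrict_iff' ((grid n α).meas_cell k x₀)] at h2
    filter_upwards [h2] with y hy hyN
    exact hy (hα y hyN)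
  rw [← ae_all_iff] at key
  filter_upwards [key] with x hx
  obtain ⟨N, hN⟩ := exists_nat_ge ‖x - x₀‖
  exact hx N hN

lemma EA1.toA1 {U : EuclideanSpace ℝ (Fin n) → ENNReal} {a : ℝ} (h : EA1 U a) (hf : ∀ᵐ x, U x < ⊤) (α : Fin n → Bool) :
    (grid n α).A1 (fun x => (U x).toReal) a := by
  set S := grid n α with hS
  have hA : ∀ k x, S.A k U x < ⊤ := by
    intro k x
    obtain ⟨y, hy, hyc⟩ : ∃ y, U y < ⊤ ∧ y ∈ S.cell k x := by
      by_contra hcon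
      push Not at hcon
      have : volume (S.cell k x) = 0 := measure_mono_null (fun y hy => by
        show ¬ (U y < ⊤); intro h'; exact hcon y h' hy) hf
      rw [S.vol] at this
      simp at this
      linarith [S.m_pos k]
    rw [← S.A_congr k U hyc]
    exact (h.bd α k y).trans_lt (ENNReal.mul_lt_top ENNReal.ofReal_lt_top hy)
  have hintg : ∀ k x, ∫⁻ y in S.cell k x, U y ≠ ⊤ := by
    intro k x h3
    have := hA k x
    unfold DySys.A at this
    rw [h3, ENNReal.mul_top (by simp)] at this
    exact lt_irrefl _ this
  have iu : ∀ k x, IntegrableOn (fun x => (U x).toReal) (S.cell k x) volume := fun k x =>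
    integrable_toReal_of_lintegral_ne_top h.m.aemeasurable (hintg k x)
  refine ⟨h.m.ennreal_toReal, fun x => ENNReal.toReal_nonneg, ?_, iu, h.a0, fun k x => ?_⟩
  · filter_upwards [hf] with x hx
    exact ENNReal.toReal_pos (h.pos x).ne' hx.ne
  · filter_upwards [hf] with y hy hyc
    have e1 := S.A_ofReal k (f := fun x => (U x).toReal) (fun x => ENNReal.toReal_nonneg) x (iu k x)
    have e2 : S.A k (fun y => ENNReal.ofReal (U y).toReal) x = S.A k U x := by
      unfold DySys.A
      congr 1
      refine setLIntegral_congr_fun_ae (S.meas_cell k x) ?_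
      filter_upwards [hf] with z hz _
      exact ENNReal.ofReal_toReal hz.ne
    rw [e2] at e1
    have e3 := h.bd α k y
    rw [← hS, S.A_congr k U hyc, e1] at e3
    rw [← ENNReal.ofReal_toReal hy.ne, ← ENNReal.ofReal_mul h.a0] at e3
    exact (ENNReal.ofReal_le_ofReal_iff (mul_nonneg h.a0 ENNReal.toReal_nonneg)).1 e3

/-- constant I -/
noncomputable def CI (n : ℕ) (K a : ℝ) : ℝ := C1 n a 2 (a^2) * Kc n K + 1
/-- constant II -/
noncomputable def CII (n : ℕ) (K a θ : ℝ) : ℝ := C1 n (a^θ) (1/θ) a * Kc n K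

lemma good_I (hφ : Ker φ K) {U : EuclideanSpace ℝ (Fin n) → ENNReal} {a : ℝ} (h : EA1 U a) :
    Good φ (ENNReal.ofReal (CI n K a)) U := by
  intro f hf ⟨B, hB⟩
  by_cases hx : ∃ x₀, U x₀ < ⊤
  · obtain ⟨x₀, hx₀⟩ := hx
    have hfin := h.fin hx₀
    have := one_step_gen hφ.hd hφ.hK hφ.h0 hφ.h1 hφ.hm (fun α => (h.toA1 hfin α).wt1) hf hB
    have e : ∀ F : EuclideanSpace ℝ (Fin n) → ENNReal, ∫⁻ x, F x * ENNReal.ofReal (U x).toReal = ∫⁻ x, F x * U x := by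
      intro F
      refine lintegral_congr_ae ?_
      filter_upwards [hfin] with x hx
      rw [ENNReal.ofReal_toReal hx.ne]
    rw [e, e] at this
    refine this.trans ?_
    gcongr
    unfold CI; linarith
  · push Not at hx
    have hC : 0 < CI n K a := by
      have : 0 ≤ C1 n a 2 (a^2) := by
        have := h.a0
        unfold C1 Cdy; positivity
      have : 0 ≤ Kc n K := by unfold Kc; positivity
      unfold CI; positivity
    have hU : ∀ x, U x = ⊤ := fun x => top_le_iff.1 (hx x)
    simp only [hU]
    by_cases hz : ∀ x, f x = 0
    · have : ∀ t x, cv f φ t x = 0 := fun t x => by simp [cv, hz]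
      simp [this]
    · push Not at hz
      obtain ⟨x₁, hx₁⟩ := hz
      have : ∫⁻ x, ‖f x‖ₑ^2 * ⊤ = ⊤ := by
        have hm : Measurable fun x => ‖f x‖ₑ^2 := (hf.measurable.enorm.pow_const 2)
        rw [lintegral_mul_const _ hm]
        refine ENNReal.mul_top ?_
        intro h0
        rw [lintegral_eq_zero_iff hm] at h0
        have h1 : f =ᵐ[volume] fun _ => 0 := by
          filter_upwards [h0] with x hx
          simpa using hx
        have h2 := (hf.ae_eq_iff_eq volume continuous_const).1 h1
        exact hx₁ (congrFun h2 x₁)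
      rw [this, ENNReal.mul_top (by simpa using hC)]
      exact le_top

lemma good_II (hφ : Ker φ K) {U : EuclideanSpace ℝ (Fin n) → ENNReal} {a θ : ℝ} (hθ0 : 0 < θ) (hθ1 : θ < 1) (h : EA1 U a) :
    Good φ (ENNReal.ofReal (CII n K a θ)) (fun x => U x ^ (-θ)) := by
  intro f hf ⟨B, hB⟩
  by_cases hx : ∃ x₀, U x₀ < ⊤
  · obtain ⟨x₀, hx₀⟩ := hx
    have hfin := h.fin hx₀
    have := one_step_gen hφ.hd hφ.hK hφ.h0 hφ.h1 hφ.hm (fun α => (h.toA1 hfin α).wt2 hθ0 hθ1) hf hB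
    have e : ∀ F : EuclideanSpace ℝ (Fin n) → ENNReal, ∫⁻ x, F x * ENNReal.ofReal ((U x).toReal ^ θ)⁻¹ = ∫⁻ x, F x * U x ^ (-θ) := by
      intro F
      refine lintegral_congr_ae ?_
      filter_upwards [hfin] with x hx
      have hp := ENNReal.toReal_pos (h.pos x).ne' hx.ne
      rw [ENNReal.rpow_neg, ENNReal.ofReal_inv_of_pos (by positivity), ← ENNReal.ofReal_rpow_of_pos hp, ENNReal.ofReal_toReal hx.ne]
    rw [e, e] at this
    exact this
  · push Not at hx
    have hU : ∀ x, U x = ⊤ := fun x => top_le_iff.1 (hx x)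
    have : (⊤ : ENNReal) ^ (-θ) = 0 := ENNReal.top_rpow_of_neg (by linarith)
    simp [hU, this]

end LP

open MeasureTheory
set_option linter.all false
namespace LP

section cons
variable {d : ℕ} {X : Fin (d+1) → Type} [∀ i, MeasurableSpace (X i)] (μ : ∀ i, Measure (X i)) [∀ i, SigmaFinite (μ i)]

lemma cons_eq : (fun p : X 0 × (∀ j : Fin d, X j.succ) => (Fin.cons p.1 p.2 : ∀ i, X i)) = ⇑(MeasurableEquiv.piFinSuccAbove X 0).symm := by
  funext p
  have := DFunLike.congr_fun (Fin.insertNthEquiv_zero X) p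
  exact this.symm

lemma mp_cons : MeasurePreserving (fun p : X 0 × (∀ j : Fin d, X j.succ) => (Fin.cons p.1 p.2 : ∀ i, X i))
    ((μ 0).prod (Measure.pi fun j : Fin d => μ j.succ)) (Measure.pi μ) := by
  have := (measurePreserving_piFinSuccAbove μ 0).symm
  rw [cons_eq]; exact this

lemma emb_cons : MeasurableEmbedding (fun p : X 0 × (∀ j : Fin d, X j.succ) => (Fin.cons p.1 p.2 : ∀ i, X i)) := by
  have := (MeasurableEquiv.piFinSuccAbove X 0).symm.measurableEmbedding
  rw [cons_eq]; exact this

lemma meas_cons {Ω : Type*} [MeasurableSpace Ω] {g : Ω → X 0} {h : Ω → ∀ j : Fin d, X j.succ} (hg : Measurable g) (hh : Measurable h) :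
    Measurable fun ω => (Fin.cons (g ω) (h ω) : ∀ i, X i) := by
  have := (emb_cons (X := X)).measurable.comp (hg.prodMk hh)
  exact this

lemma lintegral_cons {F : (∀ i, X i) → ENNReal} (hF : Measurable F) :
    ∫⁻ x, F x ∂(Measure.pi μ) = ∫⁻ a, ∫⁻ z, F (Fin.cons a z) ∂(Measure.pi fun j : Fin d => μ j.succ) ∂(μ 0) := by
  rw [← (mp_cons μ).lintegral_comp hF]
  exact lintegral_prod _ (hF.comp (mp_cons μ).measurable).aemeasurable

lemma integral_cons {F : (∀ i, X i) → ℂ} (hF : Integrable F (Measure.pi μ)) :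
    ∫ x, F x ∂(Measure.pi μ) = ∫ z, ∫ a, F (Fin.cons a z) ∂(μ 0) ∂(Measure.pi fun j : Fin d => μ j.succ) := by
  rw [← (mp_cons μ).integral_comp emb_cons]
  exact integral_prod_symm _ ((mp_cons μ).integrable_comp_of_integrable hF)

end cons

/-- the product space -/
abbrev EE {d : ℕ} (n : Fin d → ℕ) := (j : Fin d) → EuclideanSpace ℝ (Fin (n j))

/-- product kernel -/
noncomputable def PK {d : ℕ} {n : Fin d → ℕ} (φ : (j : Fin d) → EuclideanSpace ℝ (Fin (n j)) → ℂ) (T : Fin d → ℝ) (z : EE n) : ℂ :=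
  ∏ j, (((T j ^ n j)⁻¹ : ℝ) : ℂ) * φ j ((T j)⁻¹ • z j)

/-- multi-parameter convolution -/
noncomputable def MC {d : ℕ} {n : Fin d → ℕ} (φ : (j : Fin d) → EuclideanSpace ℝ (Fin (n j)) → ℂ) (f : EE n → ℂ) (T : Fin d → ℝ) (x : EE n) : ℂ :=
  ∫ y, f y * PK φ T (x - y)

/-- the measure on parameters -/
noncomputable def tm (d : ℕ) : Measure (Fin d → ℝ) := Measure.pi fun _ => volume.restrict (Set.Ioi (0:ℝ))

lemma tm_eq (d : ℕ) : (volume.restrict {T : Fin d → ℝ | ∀ j, 0 < T j}) = tm d := by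
  unfold tm
  rw [← Measure.restrict_pi_pi, volume_pi]
  congr 1
  ext T; simp

/-- multi-parameter square function -/
noncomputable def MG {d : ℕ} {n : Fin d → ℕ} (φ : (j : Fin d) → EuclideanSpace ℝ (Fin (n j)) → ℂ) (f : EE n → ℂ) (x : EE n) : ENNReal :=
  ∫⁻ T, ‖MC φ f T x‖ₑ^2 * (∏ j, (ENNReal.ofReal (T j))⁻¹) ∂(tm d)

instance (d : ℕ) : SigmaFinite (tm d) := by unfold tm; infer_instance

section
variable {d : ℕ} {n : Fin d → ℕ} {φ : (j : Fin d) → EuclideanSpace ℝ (Fin (n j)) → ℂ} {f : EE n → ℂ}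

lemma MC_meas (hφ : ∀ j, Continuous (φ j)) (hf : Continuous f) {Ω : Type*} [MeasurableSpace Ω] {g : Ω → Fin d → ℝ}
    {h : Ω → EE n} (hg : Measurable g) (hh : Measurable h) : Measurable fun ω => MC φ f (g ω) (h ω) := by
  unfold MC PK
  have : StronglyMeasurable fun p : Ω × EE n => f p.2 * ∏ j, (((g p.1 j ^ n j)⁻¹ : ℝ) : ℂ) * φ j ((g p.1 j)⁻¹ • (h p.1 - p.2) j) := by
    refine Measurable.stronglyMeasurable ?_
    refine (hf.measurable.comp measurable_snd).mul (Finset.measurable_prod _ fun j _ => ?_)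
    have hgj : Measurable fun p : Ω × EE n => g p.1 j := (measurable_pi_apply j).comp (hg.comp measurable_fst)
    refine Measurable.mul ?_ ?_
    · exact Complex.measurable_ofReal.comp (hgj.pow_const _).inv
    · refine (hφ j).measurable.comp (hgj.inv.smul ?_)
      exact ((measurable_pi_apply j).comp (hh.comp measurable_fst)).sub ((measurable_pi_apply j).comp measurable_snd)
  exact this.integral_prod_right.measurable

lemma MC_meas_gen (hφ : ∀ j, Continuous (φ j)) {Ω : Type*} [MeasurableSpace Ω] {F : Ω × EE n → ℂ} (hf : Measurable F) {g : Ω → Fin d → ℝ}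
    {h : Ω → EE n} (hg : Measurable g) (hh : Measurable h) : Measurable fun ω => MC φ (fun y => F (ω, y)) (g ω) (h ω) := by
  unfold MC PK
  have : StronglyMeasurable fun p : Ω × EE n => F (p.1, p.2) * ∏ j, (((g p.1 j ^ n j)⁻¹ : ℝ) : ℂ) * φ j ((g p.1 j)⁻¹ • (h p.1 - p.2) j) := by
    refine Measurable.stronglyMeasurable ?_
    refine Measurable.mul hf (Finset.measurable_prod _ fun j _ => ?_)
    have hgj : Measurable fun p : Ω × EE n => g p.1 j := (measurable_pi_apply j).comp (hg.comp measurable_fst)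
    refine Measurable.mul ?_ ?_
    · exact Complex.measurable_ofReal.comp (hgj.pow_const _).inv
    · refine (hφ j).measurable.comp (hgj.inv.smul ?_)
      exact ((measurable_pi_apply j).comp (hh.comp measurable_fst)).sub ((measurable_pi_apply j).comp measurable_snd)
  exact this.integral_prod_right.measurable

lemma MG_meas_gen {Ω : Type*} [MeasurableSpace Ω] (hφ : ∀ j, Continuous (φ j)) {F : Ω × EE n → ℂ} (hf : Measurable F) :
    Measurable fun p : Ω × EE n => MG φ (fun y => F (p.1, y)) p.2 := by
  have hT : Measurable fun T : Fin d → ℝ => (∏ j, (ENNReal.ofReal (T j))⁻¹ : ENNReal) :=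
    Finset.measurable_prod _ fun j _ => (measurable_pi_apply j).ennreal_ofReal.inv
  unfold MG
  have h0 : Measurable fun q : ((Ω × EE n) × (Fin d → ℝ)) × EE n => F (q.1.1.1, q.2) :=
    hf.comp (Measurable.prodMk (measurable_fst.comp (measurable_fst.comp measurable_fst)) measurable_snd)
  have h2 : Measurable fun q : (Ω × EE n) × (Fin d → ℝ) => q.1.2 := measurable_snd.comp measurable_fst
  have h3 : Measurable fun q : (Ω × EE n) × (Fin d → ℝ) => MC φ (fun y => F (q.1.1, y)) q.2 q.1.2 := MC_meas_gen hφ h0 measurable_snd h2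
  have h1 : Measurable fun p : (Ω × EE n) × (Fin d → ℝ) => ‖MC φ (fun y => F (p.1.1, y)) p.2 p.1.2‖ₑ^2 * (∏ j, (ENNReal.ofReal (p.2 j))⁻¹) :=
    (h3.enorm.pow_const 2).mul (hT.comp measurable_snd)
  exact Measurable.lintegral_prod_right' (ν := tm d) h1

lemma tw_meas : Measurable fun T : Fin d → ℝ => (∏ j, (ENNReal.ofReal (T j))⁻¹ : ENNReal) :=
  Finset.measurable_prod _ fun j _ => (measurable_pi_apply j).ennreal_ofReal.inv

lemma MG_meas (hφ : ∀ j, Continuous (φ j)) (hf : Continuous f) : Measurable (MG φ f) := by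
  unfold MG
  have h1 : Measurable fun p : EE n × (Fin d → ℝ) => ‖MC φ f p.2 p.1‖ₑ^2 * (∏ j, (ENNReal.ofReal (p.2 j))⁻¹) :=
    ((MC_meas hφ hf measurable_snd measurable_fst).enorm.pow_const 2).mul (tw_meas.comp measurable_snd)
  exact Measurable.lintegral_prod_right' (ν := tm d) h1

lemma PK_int (hi : ∀ j, Integrable (φ j)) {T : Fin d → ℝ} (hT : ∀ j, 0 < T j) (x : EE n) : Integrable fun y => PK φ T (x - y) := by
  unfold PK
  have := Integrable.fintype_prod_dep (f := fun j (z : EuclideanSpace ℝ (Fin (n j))) => (((T j ^ n j)⁻¹ : ℝ) : ℂ) * φ j ((T j)⁻¹ • (x j - z))) (μ := fun _ => volume)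
    (fun j => (((integrable_comp_smul_iff volume (φ j) (inv_ne_zero (hT j).ne')).2 (hi j)).comp_sub_left (x j)).const_mul _)
  exact this

end

section step
variable {d : ℕ} {n : Fin (d+1) → ℕ} {φ : (j : Fin (d+1)) → EuclideanSpace ℝ (Fin (n j)) → ℂ} {f : EE n → ℂ} {B : ℝ}

lemma cont_cons (hf : Continuous f) : Continuous fun p : EuclideanSpace ℝ (Fin (n 0)) × EE (fun j : Fin d => n j.succ) => f (Fin.cons p.1 p.2) := by
  refine hf.comp (continuous_pi fun i => ?_)
  refine Fin.cases ?_ (fun j => ?_) i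
  · simpa using continuous_fst
  · have : Continuous fun p : EuclideanSpace ℝ (Fin (n 0)) × EE (fun j : Fin d => n j.succ) => p.2 j := (continuous_apply j).comp continuous_snd
    exact this

lemma MC_step (hφ : ∀ j, Continuous (φ j)) (hi : ∀ j, Integrable (φ j)) (hf : Continuous f) (hB : ∀ x, ‖f x‖ ≤ B) {t : ℝ} (ht : 0 < t)
    {T : Fin d → ℝ} (hT : ∀ j, 0 < T j) (x0 : EuclideanSpace ℝ (Fin (n 0))) (x : EE (fun j : Fin d => n j.succ)) :
    MC φ f (Fin.cons t T) (Fin.cons x0 x) =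
      MC (fun j => φ j.succ) (fun y => cv (fun y0 => f (Fin.cons y0 y)) (φ 0) t x0) T x := by
  unfold MC
  have hT' : ∀ j, 0 < (Fin.cons t T : Fin (d+1) → ℝ) j := fun j => Fin.cases (by simpa using ht) (fun j => by simpa using hT j) j
  have hintg : Integrable fun y => f y * PK φ (Fin.cons t T) (Fin.cons x0 x - y) :=
    (PK_int hi hT' _).bdd_mul hf.aestronglyMeasurable (Filter.Eventually.of_forall hB)
  have := integral_cons (fun _ => volume) hintg
  refine this.trans ?_
  refine integral_congr_ae (Filter.Eventually.of_forall fun y => ?_)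
  show ∫ a, _ = cv _ _ _ _ * _
  unfold cv
  rw [← integral_mul_const]
  refine integral_congr_ae (Filter.Eventually.of_forall fun a => ?_)
  simp only [PK, Fin.prod_univ_succ, Fin.cons_zero, Fin.cons_succ, Pi.sub_apply]
  ring

lemma g_cont (hφ : ∀ j, Continuous (φ j)) (hi : ∀ j, Integrable (φ j)) (hf : Continuous f) (hB : ∀ x, ‖f x‖ ≤ B) {t : ℝ} (ht : 0 < t)
    (x0 : EuclideanSpace ℝ (Fin (n 0))) : Continuous fun y : EE (fun j : Fin d => n j.succ) => cv (fun y0 => f (Fin.cons y0 y)) (φ 0) t x0 := by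
  unfold cv
  have h1 : Integrable fun y => (φ 0) (t⁻¹ • (x0 - y)) :=
    ((integrable_comp_smul_iff volume (φ 0) (inv_ne_zero ht.ne')).2 (hi 0)).comp_sub_left x0
  have hc := cont_cons hf
  refine continuous_of_dominated (bound := fun y => B * ‖(((t^n 0)⁻¹ : ℝ) : ℂ) * (φ 0) (t⁻¹ • (x0 - y))‖) (fun y => ?_) (fun y => ?_) ((h1.const_mul _).norm.const_mul B) ?_
  · have h2 : Continuous fun a => f (Fin.cons a y) := hc.comp (continuous_id.prodMk continuous_const)
    have h3 : Continuous fun y => (φ 0) (t⁻¹ • (x0 - y)) := (hφ 0).comp (by fun_prop)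
    exact (h2.mul (continuous_const.mul h3)).aestronglyMeasurable
  · refine Filter.Eventually.of_forall fun a => ?_
    rw [norm_mul]
    gcongr
    exact hB _
  · refine Filter.Eventually.of_forall fun a => ?_
    have h2 : Continuous fun y => f (Fin.cons a y) := hc.comp (continuous_const.prodMk continuous_id)
    exact h2.mul continuous_const

lemma g_meas (hφ : ∀ j, Continuous (φ j)) (hf : Continuous f) : Measurable fun p : (ℝ × EuclideanSpace ℝ (Fin (n 0))) × EE (fun j : Fin d => n j.succ) => 
    cv (fun y0 => f (Fin.cons y0 p.2)) (φ 0) p.1.1 p.1.2 := by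
  unfold cv
  have h2 : Measurable fun q : ((ℝ × EuclideanSpace ℝ (Fin (n 0))) × EE (fun j : Fin d => n j.succ)) × EuclideanSpace ℝ (Fin (n 0)) =>
     f (Fin.cons q.2 q.1.2) := hf.measurable.comp (meas_cons (X := fun j => EuclideanSpace ℝ (Fin (n j))) measurable_snd (measurable_snd.comp measurable_fst))
  have : StronglyMeasurable fun q : ((ℝ × EuclideanSpace ℝ (Fin (n 0))) × EE (fun j : Fin d => n j.succ)) × EuclideanSpace ℝ (Fin (n 0)) =>
     f (Fin.cons q.2 q.1.2) * ((((q.1.1.1^n 0)⁻¹ : ℝ) : ℂ) * (φ 0) (q.1.1.1⁻¹ • (q.1.1.2 - q.2))) := by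
    refine Measurable.stronglyMeasurable ?_
    refine h2.mul (Measurable.mul (Complex.measurable_ofReal.comp (by fun_prop)) ((hφ 0).measurable.comp (by fun_prop)))
  exact this.integral_prod_right.measurable

lemma MG_step (hφ : ∀ j, Continuous (φ j)) (hi : ∀ j, Integrable (φ j)) (hf : Continuous f) (hB : ∀ x, ‖f x‖ ≤ B)
    (x0 : EuclideanSpace ℝ (Fin (n 0))) (x : EE (fun j : Fin d => n j.succ)) :
    MG φ f (Fin.cons x0 x) =
      ∫⁻ t in Set.Ioi (0:ℝ), (MG (fun j => φ j.succ) (fun y => cv (fun y0 => f (Fin.cons y0 y)) (φ 0) t x0) x) * (ENNReal.ofReal t)⁻¹ := by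
  have hm : Measurable fun T : Fin (d+1) → ℝ => ‖MC φ f T (Fin.cons x0 x)‖ₑ^2 * (∏ j, (ENNReal.ofReal (T j))⁻¹) :=
    ((MC_meas hφ hf measurable_id measurable_const).enorm.pow_const 2).mul tw_meas
  have := lintegral_cons (fun _ => volume.restrict (Set.Ioi (0:ℝ))) hm
  refine this.trans ?_
  refine setLIntegral_congr_fun measurableSet_Ioi fun t ht => ?_
  have ht : 0 < t := ht
  unfold MG
  have hm2 : Measurable fun T : Fin d → ℝ => ‖MC (fun j => φ j.succ) (fun y => cv (fun y0 => f (Fin.cons y0 y)) (φ 0) t x0) T x‖ₑ^2 * (∏ j, (ENNReal.ofReal (T j))⁻¹) :=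
    ((MC_meas (fun j => hφ j.succ) (g_cont hφ hi hf hB ht x0) measurable_id measurable_const).enorm.pow_const 2).mul tw_meas
  rw [← lintegral_mul_const _ hm2]
  have ha : ∀ᵐ T ∂(tm d), ∀ j, 0 < T j := by
    rw [← tm_eq]
    have : MeasurableSet {T : Fin d → ℝ | ∀ j, 0 < T j} := by
      have : {T : Fin d → ℝ | ∀ j, 0 < T j} = Set.univ.pi fun _ => Set.Ioi 0 := by ext; simp
      rw [this]
      exact MeasurableSet.univ_pi fun _ => measurableSet_Ioi
    exact ae_restrict_mem this
  refine lintegral_congr_ae ?_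
  filter_upwards [ha] with T hT
  simp only [MC_step hφ hi hf hB ht hT x0 x, Fin.prod_univ_succ, Fin.cons_zero, Fin.cons_succ]
  ring

end step

section ton
variable {X Y : Type*} [MeasurableSpace X] [MeasurableSpace Y] {τ : Measure ℝ} {μ : Measure X} {ν : Measure Y} [SFinite τ] [SFinite μ] [SFinite ν]
  {H : (ℝ × X) × Y → ENNReal} {w : X × Y → ENNReal} {i : ℝ → ENNReal}

lemma ton0 (hH : Measurable H) (hw : Measurable w) (hi : Measurable i) (a : X) :
    ∫⁻ y, (∫⁻ t, H ((t, a), y) * i t ∂τ) * w (a, y) ∂ν = ∫⁻ t, (∫⁻ y, H ((t, a), y) * w (a, y) ∂ν) * i t ∂τ := by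
  have e1 : ∀ y, (∫⁻ t, H ((t, a), y) * i t ∂τ) * w (a, y) = ∫⁻ t, H ((t, a), y) * i t * w (a, y) ∂τ := by
    intro y
    rw [lintegral_mul_const]
    fun_prop
  have e2 : ∀ t, (∫⁻ y, H ((t, a), y) * w (a, y) ∂ν) * i t = ∫⁻ y, H ((t, a), y) * w (a, y) * i t ∂ν := by
    intro t
    rw [lintegral_mul_const]
    fun_prop
  simp_rw [e1, e2]
  rw [lintegral_lintegral_swap (by fun_prop)]
  refine lintegral_congr fun t => lintegral_congr fun y => ?_
  ring

lemma ton1 (hH : Measurable H) (hw : Measurable w) (hi : Measurable i) :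
    ∫⁻ a, ∫⁻ y, (∫⁻ t, H ((t, a), y) * i t ∂τ) * w (a, y) ∂ν ∂μ = ∫⁻ a, ∫⁻ t, (∫⁻ y, H ((t, a), y) * w (a, y) ∂ν) * i t ∂τ ∂μ :=
  lintegral_congr fun a => ton0 hH hw hi a

lemma ton2 (hH : Measurable H) (hw : Measurable w) (hi : Measurable i) (C : ENNReal) :
    ∫⁻ a, ∫⁻ t, (C * ∫⁻ y, H ((t, a), y) * w (a, y) ∂ν) * i t ∂τ ∂μ = C * ∫⁻ y, ∫⁻ a, (∫⁻ t, H ((t, a), y) * i t ∂τ) * w (a, y) ∂μ ∂ν := by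
  have m1 : Measurable fun q : (Y × X) × ℝ => H ((q.2, q.1.2), q.1.1) * i q.2 := by fun_prop
  have m2 : Measurable fun q : Y × X => (∫⁻ t, H ((t, q.2), q.1) * i t ∂τ) := Measurable.lintegral_prod_right' (ν := τ) m1
  have m3 : Measurable fun q : Y × X => (∫⁻ t, H ((t, q.2), q.1) * i t ∂τ) * w (q.2, q.1) := m2.mul (by fun_prop)
  have m4 : Measurable fun q : X × Y => (∫⁻ t, H ((t, q.1), q.2) * i t ∂τ) * w (q.1, q.2) := m3.comp measurable_swap
  have sw : ∫⁻ y, ∫⁻ a, (∫⁻ t, H ((t, a), y) * i t ∂τ) * w (a, y) ∂μ ∂ν = ∫⁻ a, ∫⁻ y, (∫⁻ t, H ((t, a), y) * i t ∂τ) * w (a, y) ∂ν ∂μ :=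
    lintegral_lintegral_swap m3.aemeasurable
  rw [sw, ← lintegral_const_mul _ (Measurable.lintegral_prod_right' (ν := ν) m4)]
  refine lintegral_congr fun a => ?_
  simp only
  rw [ton0 hH hw hi a]
  have m5 : Measurable fun q : ℝ × Y => H ((q.1, a), q.2) * w (a, q.2) := by fun_prop
  have m6 : Measurable fun t => ∫⁻ y, H ((t, a), y) * w (a, y) ∂ν := Measurable.lintegral_prod_right' (ν := ν) m5
  have m7 : Measurable fun t => (∫⁻ y, H ((t, a), y) * w (a, y) ∂ν) * i t := m6.mul hi
  rw [← lintegral_const_mul _ m7]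
  refine lintegral_congr fun t => ?_
  ring

end ton

theorem iter : ∀ (d : ℕ) (n : Fin d → ℕ) (φ : (j : Fin d) → EuclideanSpace ℝ (Fin (n j)) → ℂ) (hφ : ∀ j, Continuous (φ j))
    (hi : ∀ j, Integrable (φ j)) (C : Fin d → ENNReal) (w : EE n → ENNReal) (hw : Measurable w)
    (hg : ∀ j x, Good (φ j) (C j) (fun s => w (Function.update x j s)))
    (f : EE n → ℂ) (hf : Continuous f) (B : ℝ) (hB : ∀ x, ‖f x‖ ≤ B),
    ∫⁻ x, MG φ f x * w x ≤ (∏ j, C j) * ∫⁻ x, ‖f x‖ₑ^2 * w x := by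
  intro d
  induction d with
  | zero =>
    intro n φ hφ hi C w hw hg f hf B hB
    rw [Finset.univ_eq_empty, Finset.prod_empty, one_mul]
    refine lintegral_mono fun x => ?_
    gcongr
    unfold MG MC tm PK
    rw [Measure.pi_of_empty]
    simp only [Finset.univ_eq_empty, Finset.prod_empty, mul_one, lintegral_dirac]
    rw [Measure.volume_pi_eq_dirac x, integral_dirac]
  | succ d ih =>
    intro n φ hφ hi C w hw hg f hf B hB
    have m1 : Measurable fun x => MG φ f x * w x := (MG_meas hφ hf).mul hw
    have m2 : Measurable fun x => ‖f x‖ₑ^2 * w x := (hf.measurable.enorm.pow_const 2).mul hw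
    have e1 := lintegral_cons (fun j => (volume : Measure (EuclideanSpace ℝ (Fin (n j))))) m1
    have e2 := lintegral_cons (fun j => (volume : Measure (EuclideanSpace ℝ (Fin (n j))))) m2
    refine (le_of_eq e1).trans (le_trans ?_ (mul_le_mul' le_rfl (le_of_eq e2.symm)))
    set n' : Fin d → ℕ := fun j => n j.succ with hn'
    set φ' : (j : Fin d) → EuclideanSpace ℝ (Fin (n' j)) → ℂ := fun j => φ j.succ with hφ'
    have mw : Measurable fun p : EuclideanSpace ℝ (Fin (n 0)) × EE n' => w (Fin.cons p.1 p.2) :=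
      hw.comp (meas_cons (X := fun j => EuclideanSpace ℝ (Fin (n j))) measurable_fst measurable_snd)
    have mg := g_meas hφ hf
    have mf : Measurable fun p : EuclideanSpace ℝ (Fin (n 0)) × EE n' => f (Fin.cons p.1 p.2) := (cont_cons hf).measurable
    have mi : Measurable fun t : ℝ => (ENNReal.ofReal t)⁻¹ := ENNReal.measurable_ofReal.inv
    have mH : Measurable fun p : (ℝ × EuclideanSpace ℝ (Fin (n 0))) × EE n' => MG φ' (fun y => cv (fun y0 => f (Fin.cons y0 y)) (φ 0) p.1.1 p.1.2) p.2 :=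
      MG_meas_gen (φ := φ') (fun j => hφ j.succ) (F := fun p : (ℝ × EuclideanSpace ℝ (Fin (n 0))) × EE n' => cv (fun y0 => f (Fin.cons y0 p.2)) (φ 0) p.1.1 p.1.2) mg
    rw [Fin.prod_univ_succ]
    calc ∫⁻ x0, ∫⁻ x : EE n', MG φ f (Fin.cons x0 x) * w (Fin.cons x0 x)
        = ∫⁻ x0, ∫⁻ x : EE n', (∫⁻ t in Set.Ioi (0:ℝ), (MG φ' (fun y => cv (fun y0 => f (Fin.cons y0 y)) (φ 0) t x0) x) * (ENNReal.ofReal t)⁻¹) * w (Fin.cons x0 x) := by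
          refine lintegral_congr fun x0 => lintegral_congr fun x => ?_
          rw [MG_step hφ hi hf hB x0 x]
      _ = ∫⁻ x0, ∫⁻ t in Set.Ioi (0:ℝ), (∫⁻ x : EE n', (MG φ' (fun y => cv (fun y0 => f (Fin.cons y0 y)) (φ 0) t x0) x) * w (Fin.cons x0 x)) * (ENNReal.ofReal t)⁻¹ := 
          ton1 (τ := volume.restrict (Set.Ioi (0:ℝ))) (μ := volume) (ν := volume) mH mw mi
      _ ≤ ∫⁻ x0, ∫⁻ t in Set.Ioi (0:ℝ), ((∏ j : Fin d, C j.succ) * ∫⁻ x : EE n', ‖cv (fun y0 => f (Fin.cons y0 x)) (φ 0) t x0‖ₑ^2 * w (Fin.cons x0 x)) * (ENNReal.ofReal t)⁻¹ := by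
          refine lintegral_mono fun x0 => setLIntegral_mono' measurableSet_Ioi fun t ht => ?_
          refine mul_le_mul' ?_ le_rfl
          refine ih n' φ' (fun j => hφ j.succ) (fun j => hi j.succ) (fun j => C j.succ) (fun x => w (Fin.cons x0 x)) (mw.comp measurable_prodMk_left) ?_ _ (g_cont hφ hi hf hB ht x0) (B * ∫ y, ‖φ 0 y‖) ?_
          · intro j x
            have := hg j.succ (Fin.cons x0 x)
            simpa only [Fin.cons_update] using this
          · intro y
            have hc : Continuous fun y0 => f (Fin.cons y0 y) := (cont_cons hf).comp (continuous_id.prodMk continuous_const)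
            exact cv_norm_le hc (fun _ => hB _) (hi 0) ht x0
      _ = (∏ j : Fin d, C j.succ) * ∫⁻ x : EE n', ∫⁻ x0, (∫⁻ t in Set.Ioi (0:ℝ), ‖cv (fun y0 => f (Fin.cons y0 x)) (φ 0) t x0‖ₑ^2 * (ENNReal.ofReal t)⁻¹) * w (Fin.cons x0 x) := by
          exact ton2 (τ := volume.restrict (Set.Ioi (0:ℝ))) (μ := volume) (ν := volume) (mg.enorm.pow_const 2) mw mi _
      _ ≤ (∏ j : Fin d, C j.succ) * ∫⁻ x : EE n', C 0 * ∫⁻ x0, ‖f (Fin.cons x0 x)‖ₑ^2 * w (Fin.cons x0 x) := by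
          gcongr with x
          have hc : Continuous fun y0 => f (Fin.cons y0 x) := (cont_cons hf).comp (continuous_id.prodMk continuous_const)
          have := hg 0 (Fin.cons 0 x) _ hc ⟨B, fun _ => hB _⟩
          simpa only [Fin.update_cons_zero] using this
      _ = _ := by
          have m3 : Measurable fun p : EE n' × EuclideanSpace ℝ (Fin (n 0)) => ‖f (Fin.cons p.2 p.1)‖ₑ^2 * w (Fin.cons p.2 p.1) :=
            ((mf.comp measurable_swap).enorm.pow_const 2).mul (mw.comp measurable_swap)
          rw [lintegral_const_mul _ (Measurable.lintegral_prod_right' (ν := volume) m3), lintegral_lintegral_swap m3.aemeasurable, ← mul_assoc, mul_comm (C 0)]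
          rfl

end LP

open MeasureTheory
set_option linter.all false
namespace LP

section NN
variable {X : Type*} [MeasurableSpace X] {μ : Measure X}

/-- `L^q` norm of `ENNReal` functions -/
noncomputable def NN (μ : Measure X) (q : ℝ) (h : X → ENNReal) : ENNReal := (∫⁻ x, h x ^ q ∂μ) ^ (1/q)

lemma NN_mono {q : ℝ} (hq : 0 < q) {g h : X → ENNReal} (hgh : ∀ x, g x ≤ h x) : NN μ q g ≤ NN μ q h := by
  unfold NN; gcongr; exact hgh _

lemma NN_const_mul {q : ℝ} (hq : 0 < q) (c : ENNReal) {h : X → ENNReal} (hh : Measurable h) : NN μ q (fun x => c * h x) = c * NN μ q h := by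
  unfold NN
  simp_rw [ENNReal.mul_rpow_of_nonneg _ _ hq.le]
  rw [lintegral_const_mul _ (hh.pow_const _), ENNReal.mul_rpow_of_nonneg _ _ (by positivity), ← ENNReal.rpow_mul, mul_one_div_cancel hq.ne', ENNReal.rpow_one]

lemma NN_sum {ι : Type*} {q : ℝ} (hq : 1 ≤ q) (s : Finset ι) {h : ι → X → ENNReal} (hh : ∀ i, Measurable (h i)) :
    NN μ q (fun x => ∑ i ∈ s, h i x) ≤ ∑ i ∈ s, NN μ q (h i) := by
  classical
  have hq0 : 0 < q := by linarith
  induction s using Finset.induction with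
  | empty => simp [NN, hq0]
  | insert a s ha ih =>
    simp only [Finset.sum_insert ha]
    refine le_trans ?_ (add_le_add le_rfl ih)
    exact ENNReal.lintegral_Lp_add_le (hh a).aemeasurable (Finset.measurable_sum s fun i _ => hh i).aemeasurable hq

lemma NN_tsum {q : ℝ} (hq : 1 ≤ q) {h : ℕ → X → ENNReal} (hh : ∀ i, Measurable (h i)) :
    NN μ q (fun x => ∑' i, h i x) ≤ ∑' i, NN μ q (h i) := by
  have hq0 : 0 < q := by linarith
  have hm : ∀ N, Measurable fun x => ∑ i ∈ Finset.range N, h i x := fun N => Finset.measurable_sum _ fun i _ => hh i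
  have mono : ∀ x, Monotone fun N => ∑ i ∈ Finset.range N, h i x := fun x N M hNM =>
    Finset.sum_le_sum_of_subset (Finset.range_mono hNM)
  have e : ∀ x, (∑' i, h i x)^q = ⨆ N, (∑ i ∈ Finset.range N, h i x)^q := by
    intro x
    rw [ENNReal.tsum_eq_iSup_nat]
    exact (ENNReal.orderIsoRpow q hq0).map_iSup _
  unfold NN
  simp_rw [e]
  rw [lintegral_iSup (fun N => (hm N).pow_const q) (fun N M hNM x => by simp only; gcongr)]
  have e2 := (ENNReal.orderIsoRpow (1/q) (by positivity)).map_iSup (fun N => ∫⁻ x, (∑ i ∈ Finset.range N, h i x)^q ∂μ)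
  simp only [ENNReal.orderIsoRpow_apply] at e2
  rw [e2]
  refine iSup_le fun N => ?_
  exact (NN_sum hq (Finset.range N) hh).trans (ENNReal.sum_le_tsum _)

/-- Rubio de Francia iteration -/
lemma rdf {q : ℝ} (hq : 1 ≤ q) {B : ℝ} (hB : 0 < B) (M : (X → ENNReal) → X → ENNReal) (hM : ∀ h, Measurable h → Measurable (M h))
    (hs : ∀ (c : ℕ → ENNReal) (g : ℕ → X → ENNReal), (∀ i, Measurable (g i)) → ∀ x, M (fun x => ∑' i, c i * g i x) x ≤ ∑' i, c i * M (g i) x)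
    (hN : ∀ h, Measurable h → NN μ q (M h) ≤ ENNReal.ofReal B * NN μ q h) {h : X → ENNReal} (hh : Measurable h) :
    ∃ W : X → ENNReal, Measurable W ∧ (∀ x, h x ≤ W x) ∧ NN μ q W ≤ 2 * NN μ q h ∧ ∀ x, M W x ≤ ENNReal.ofReal (2*B) * W x := by
  have hq0 : 0 < q := by linarith
  set c : ENNReal := ENNReal.ofReal (2*B) with hc
  have hc0 : c ≠ 0 := by rw [hc]; simp; linarith
  have hct : c ≠ ⊤ := ENNReal.ofReal_ne_top
  have hmi : ∀ i, Measurable (M^[i] h) := by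
    intro i
    induction i with
    | zero => exact hh
    | succ i ih => rw [Function.iterate_succ_apply']; exact hM _ ih
  refine ⟨fun x => ∑' i, c⁻¹^i * M^[i] h x, Measurable.ennreal_tsum fun i => (hmi i).const_mul _, fun x => ?_, ?_, fun x => ?_⟩
  · refine le_trans ?_ (ENNReal.le_tsum 0)
    simp
  · refine (NN_tsum hq fun i => (hmi i).const_mul _).trans ?_
    have hb : ∀ i, NN μ q (M^[i] h) ≤ ENNReal.ofReal B ^ i * NN μ q h := by
      intro i
      induction i with
      | zero => simp
      | succ i ih =>
        rw [Function.iterate_succ_apply']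
        refine (hN _ (hmi i)).trans ?_
        rw [pow_succ', mul_assoc]
        gcongr
    have h2 : c⁻¹ * ENNReal.ofReal B = 2⁻¹ := by
      rw [hc, ENNReal.ofReal_mul (by norm_num), ENNReal.mul_inv (by simp) (by simp), mul_assoc, ENNReal.inv_mul_cancel (by simpa using hB) ENNReal.ofReal_ne_top]
      simp
    calc ∑' i, NN μ q (fun x => c⁻¹^i * M^[i] h x) ≤ ∑' i, (2⁻¹:ENNReal)^i * NN μ q h := by
          refine ENNReal.tsum_le_tsum fun i => ?_
          rw [NN_const_mul hq0 _ (hmi i), ← h2, mul_pow, mul_assoc]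
          gcongr
          exact hb i
      _ = _ := by
          rw [ENNReal.tsum_mul_right, ENNReal.tsum_geometric, ENNReal.one_sub_inv_two, inv_inv]
  · refine (hs _ _ hmi x).trans ?_
    calc ∑' i, c⁻¹^i * M (M^[i] h) x = c * ∑' i, c⁻¹^(i+1) * M^[i+1] h x := by
          rw [← ENNReal.tsum_mul_left]
          congr 1; funext i
          rw [Function.iterate_succ_apply', pow_succ', ← mul_assoc, ← mul_assoc, ENNReal.mul_inv_cancel hc0 hct, one_mul]
      _ ≤ _ := by
          gcongr
          exact ENNReal.tsum_comp_le_tsum_of_injective (add_left_injective 1) fun i => c⁻¹^i * M^[i] h x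

end NN

section
variable {d : ℕ} {n : Fin d → ℕ}

lemma slice_le {F G : EE n → ENNReal} (hF : Measurable F) (hG : Measurable G) (j : Fin d) (c : ENNReal)
    (h : ∀ x, ∫⁻ s, F (Function.update x j s) ≤ c * ∫⁻ s, G (Function.update x j s)) : ∫⁻ x, F x ≤ c * ∫⁻ x, G x := by
  rw [← lintegral_const_mul _ hG, volume_pi, lintegral_eq_lmarginal_univ 0, lintegral_eq_lmarginal_univ 0]
  refine lmarginal_le_of_subset (s := {j}) (Finset.subset_univ _) hF (hG.const_mul c) ?_ 0
  intro x
  rw [lmarginal_singleton, lmarginal_singleton]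
  refine (h x).trans (le_of_eq ?_)
  have : Measurable fun s => G (Function.update x j s) := hG.comp (measurable_update x)
  rw [← lintegral_const_mul _ this]

/-- directional dyadic maximal function -/
noncomputable def DM (j : Fin d) (α : Fin (n j) → Bool) (h : EE n → ENNReal) (x : EE n) : ENNReal :=
  ⨆ k : ℤ, (grid (n j) α).A k (fun s => h (Function.update x j s)) (x j)

lemma DM_update (j : Fin d) (α : Fin (n j) → Bool) (h : EE n → ENNReal) (x : EE n) (s) :
    DM j α h (Function.update x j s) = ⨆ k : ℤ, (grid (n j) α).A k (fun s => h (Function.update x j s)) s := by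
  unfold DM; simp

lemma DM_meas (j : Fin d) (α : Fin (n j) → Bool) {h : EE n → ENNReal} (hh : Measurable h) : Measurable (DM j α h) := by
  unfold DM
  refine Measurable.iSup fun k => ?_
  set S := grid (n j) α
  unfold DySys.A
  refine Measurable.const_mul ?_ _
  have hs : MeasurableSet {p : EE n × EuclideanSpace ℝ (Fin (n j)) | p.2 ∈ S.cell k (p.1 j)} :=
    by
    have hm : Measurable fun p : EE n × EuclideanSpace ℝ (Fin (n j)) => (p.1 j, p.2) := ((measurable_pi_apply j).comp measurable_fst).prodMk measurable_snd
    exact hm (S.meas_rel k)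
  have hu : Measurable fun p : EE n × EuclideanSpace ℝ (Fin (n j)) => Function.update p.1 j p.2 := measurable_update'
  have : (fun x : EE n => ∫⁻ y in S.cell k (x j), h (Function.update x j y))
      = fun x => ∫⁻ y, ({p : EE n × EuclideanSpace ℝ (Fin (n j)) | p.2 ∈ S.cell k (p.1 j)}.indicator (fun p => h (Function.update p.1 j p.2))) (x, y) := by
    funext x
    rw [← lintegral_indicator (S.meas_cell k _)]
    rfl
  rw [this]
  exact Measurable.lintegral_prod_right' (ν := volume) ((hh.comp hu).indicator hs)

lemma DM_NN {q : ℝ} (hq : 1 < q) (j : Fin d) (α : Fin (n j) → Bool) {h : EE n → ENNReal} (hh : Measurable h) :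
    NN volume q (DM j α h) ≤ ENNReal.ofReal (q/(q-1)) * NN volume q h := by
  have hq0 : 0 < q := by linarith
  have := slice_le ((DM_meas j α hh).pow_const q) (hh.pow_const q) j (ENNReal.ofReal (q / (q-1)) ^ q) (fun x => by
    simp_rw [DM_update]
    exact (grid (n j) α).doob hq (hh.comp (measurable_update x)))
  unfold NN
  calc _ ≤ (ENNReal.ofReal (q / (q-1)) ^ q * ∫⁻ x, h x ^ q)^(1/q) := by gcongr
    _ = _ := by rw [ENNReal.mul_rpow_of_nonneg _ _ (by positivity), ← ENNReal.rpow_mul, mul_one_div_cancel hq0.ne', ENNReal.rpow_one]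

lemma DM_sub (j : Fin d) (α : Fin (n j) → Bool) (c : ℕ → ENNReal) (g : ℕ → EE n → ENNReal) (hg : ∀ i, Measurable (g i)) (x : EE n) :
    DM j α (fun x => ∑' i, c i * g i x) x ≤ ∑' i, c i * DM j α (g i) x := by
  refine iSup_le fun k => ?_
  have hm : ∀ i, Measurable fun s => g i (Function.update x j s) := fun i => (hg i).comp (measurable_update x)
  have : (grid (n j) α).A k (fun s => ∑' i, c i * g i (Function.update x j s)) (x j) = ∑' i, c i * (grid (n j) α).A k (fun s => g i (Function.update x j s)) (x j) := by
    unfold DySys.A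
    rw [lintegral_tsum fun i => ((hm i).const_mul _).aemeasurable, ← ENNReal.tsum_mul_left]
    congr 1; funext i
    rw [lintegral_const_mul _ (hm i)]; ring
  rw [this]
  refine ENNReal.tsum_le_tsum fun i => ?_
  gcongr
  exact le_iSup (fun k => (grid (n j) α).A k (fun s => g i (Function.update x j s)) (x j)) k

/-- sum of directional maximal functions -/
noncomputable def SM (h : EE n → ENNReal) (x : EE n) : ENNReal := ∑ p : (Σ j : Fin d, Fin (n j) → Bool), DM p.1 p.2 h x

/-- its norm bound -/
noncomputable def Bq (n : Fin d → ℕ) (q : ℝ) : ℝ := ∑ p : (Σ j : Fin d, Fin (n j) → Bool), (q/(q-1)) + 1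

theorem RdF {q : ℝ} (hq : 1 < q) {h : EE n → ENNReal} (hh : Measurable h) (hp : ∀ x, 0 < h x) :
    ∃ W : EE n → ENNReal, Measurable W ∧ (∀ x, h x ≤ W x) ∧ NN volume q W ≤ 2 * NN volume q h ∧
      ∀ j x, EA1 (fun s => W (Function.update x j s)) (2 * Bq n q) := by
  have hq0 : 0 < q := by linarith
  have hqq : 0 ≤ q/(q-1) := div_nonneg hq0.le (by linarith)
  have hB : 0 < Bq n q := by
    unfold Bq
    have : 0 ≤ ∑ p : (Σ j : Fin d, Fin (n j) → Bool), (q/(q-1)) := Finset.sum_nonneg fun _ _ => hqq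
    linarith
  have hs : ∀ (c : ℕ → ENNReal) (g : ℕ → EE n → ENNReal), (∀ i, Measurable (g i)) → ∀ x, SM (fun x => ∑' i, c i * g i x) x ≤ ∑' i, c i * SM (g i) x := by
    intro c g hg x
    unfold SM
    refine (Finset.sum_le_sum fun p _ => DM_sub p.1 p.2 c g hg x).trans (le_of_eq ?_)
    rw [← Summable.tsum_finsetSum (fun _ _ => ENNReal.summable)]
    congr 1; funext i
    rw [Finset.mul_sum]
  have hN : ∀ h : EE n → ENNReal, Measurable h → NN volume q (SM h) ≤ ENNReal.ofReal (Bq n q) * NN volume q h := by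
    intro h hh
    have hm : ∀ p : (Σ j : Fin d, Fin (n j) → Bool), Measurable (DM p.1 p.2 h) := fun p => DM_meas p.1 p.2 hh
    have h0 := NN_sum (μ := (volume : Measure (EE n))) hq.le Finset.univ (h := fun p : (Σ j : Fin d, Fin (n j) → Bool) => DM p.1 p.2 h) hm
    refine le_trans h0 ?_
    refine (Finset.sum_le_sum fun p _ => DM_NN hq p.1 p.2 hh).trans ?_
    rw [← Finset.sum_mul, ← ENNReal.ofReal_sum_of_nonneg fun _ _ => hqq]
    gcongr
    unfold Bq; linarith
  have hMm : ∀ h : EE n → ENNReal, Measurable h → Measurable (SM h) := fun h hh => Finset.measurable_sum _ fun p _ => DM_meas p.1 p.2 hh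
  obtain ⟨W, hW, h1, h2, h3⟩ := rdf (μ := (volume : Measure (EE n))) hq.le hB SM hMm hs hN hh
  refine ⟨W, hW, h1, h2, fun j x => ⟨hW.comp (measurable_update x), fun s => (hp _).trans_le (h1 _), by linarith, fun α k s => ?_⟩⟩
  refine le_trans ?_ (h3 (Function.update x j s))
  unfold SM
  refine le_trans ?_ (Finset.single_le_sum (f := fun p : (Σ j : Fin d, Fin (n j) → Bool) => DM p.1 p.2 W (Function.update x j s)) (fun _ _ => zero_le) (Finset.mem_univ ⟨j, α⟩))
  rw [DM_update]
  exact le_iSup (fun k => (grid (n j) α).A k (fun s => W (Function.update x j s)) s) k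

end
end LP

open MeasureTheory
set_option linter.all false
namespace LP

section
variable {X : Type*} [MeasurableSpace X] {μ : Measure X} [SigmaFinite μ]

lemma make_pos {q : ℝ} (hq : 1 ≤ q) {h : X → ENNReal} (hh : Measurable h) (h0 : NN μ q h ≠ 0) :
    ∃ g : X → ENNReal, Measurable g ∧ (∀ x, 0 < g x) ∧ (∀ x, h x ≤ g x) ∧ NN μ q g ≤ 2 * NN μ q h := by
  have hq0 : 0 < q := by linarith
  have hne : (NN μ q h)^q ≠ 0 := by
    intro h1
    rw [ENNReal.rpow_eq_zero_iff] at h1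
    rcases h1 with h1 | h1
    · exact h0 h1.1
    · linarith [h1.2]
  obtain ⟨g, hg, hgm, hgl⟩ := exists_pos_lintegral_lt_of_sigmaFinite μ hne
  have hm : Measurable fun x => (g x : ENNReal)^(1/q) := (measurable_coe_nnreal_ennreal.comp hgm).pow_const _
  have hgp : ∀ x, 0 < (g x : ENNReal)^(1/q) := fun x => ENNReal.rpow_pos (by exact_mod_cast hg x) (by simp)
  refine ⟨fun x => h x + (g x : ENNReal)^(1/q), hh.add hm, fun x => (hgp x).trans_le le_add_self, fun x => le_self_add, ?_⟩
  refine (ENNReal.lintegral_Lp_add_le hh.aemeasurable hm.aemeasurable hq).trans ?_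
  rw [two_mul]
  refine add_le_add le_rfl ?_
  simp_rw [← ENNReal.rpow_mul, one_div_mul_cancel hq0.ne', ENNReal.rpow_one]
  calc (∫⁻ a, (g a : ENNReal) ∂μ)^(1/q) ≤ ((NN μ q h)^q)^(1/q) := by gcongr
    _ = _ := by rw [← ENNReal.rpow_mul, mul_one_div_cancel hq0.ne', ENNReal.rpow_one]

theorem extrap_gt {r q : ℝ} (hrq : r.HolderConjugate q) {G F : X → ENNReal} (hG : Measurable G) (hF : Measurable F) {C : ENNReal}
    (H : ∀ h : X → ENNReal, Measurable h → (∀ x, 0 < h x) → ∃ W : X → ENNReal, Measurable W ∧ (∀ x, h x ≤ W x) ∧ NN μ q W ≤ 2 * NN μ q h ∧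
      ∫⁻ x, G x * W x ∂μ ≤ C * ∫⁻ x, F x * W x ∂μ) : NN μ r G ≤ 4 * C * NN μ r F := by
  have hr1 := hrq.lt
  have hr0 : 0 < r := by linarith
  have hq1 := hrq.symm.lt
  have hq0 : 0 < q := by linarith
  have dual : ∀ h : X → ENNReal, Measurable h → NN μ q h ≠ 0 → ∫⁻ x, G x * h x ∂μ ≤ 4 * C * NN μ r F * NN μ q h := by
    intro h hh h0
    obtain ⟨g, hg, hg0, hhg, hgn⟩ := make_pos hq1.le hh h0
    obtain ⟨W, hW, hgW, hWn, hGW⟩ := H g hg hg0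
    calc ∫⁻ x, G x * h x ∂μ ≤ ∫⁻ x, G x * W x ∂μ := lintegral_mono fun x => mul_le_mul' le_rfl ((hhg x).trans (hgW x))
      _ ≤ C * ∫⁻ x, F x * W x ∂μ := hGW
      _ ≤ C * (NN μ r F * NN μ q W) := by
          gcongr
          exact ENNReal.lintegral_mul_le_Lp_mul_Lq μ hrq hF.aemeasurable hW.aemeasurable
      _ ≤ C * (NN μ r F * (2 * (2 * NN μ q h))) := by
          gcongr
          exact hWn.trans (by gcongr)
      _ = _ := by ring
  set GN : ℕ → X → ENNReal := fun N => (spanningSets μ N).indicator (fun x => min (G x) N) with hGN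
  have mGN : ∀ N, Measurable (GN N) := fun N => (hG.min measurable_const).indicator (measurableSet_spanningSets μ N)
  have leG : ∀ N x, GN N x ≤ G x := by
    intro N x
    simp only [hGN, Set.indicator]
    split_ifs
    · exact min_le_left _ _
    · exact zero_le
  have mono : Monotone GN := by
    intro N M hNM x
    simp only [hGN, Set.indicator]
    split_ifs with h1 h2
    · gcongr
    · exact absurd (monotone_spanningSets μ hNM h1) h2
    · exact zero_le
    · exact le_rfl
  have sup : ∀ x, G x = ⨆ N, GN N x := by
    intro x
    refine le_antisymm ?_ (iSup_le fun N => leG N x)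
    refine le_of_forall_lt fun c hc => ?_
    obtain ⟨c', hcc', hc'⟩ := exists_between hc
    obtain ⟨N, hN⟩ := ENNReal.exists_nat_gt hc'.ne_top
    refine hcc'.trans_le (le_trans ?_ (le_iSup _ (max N (spanningSetsIndex μ x))))
    have hx : x ∈ spanningSets μ (max N (spanningSetsIndex μ x)) := monotone_spanningSets μ (le_max_right _ _) (mem_spanningSetsIndex μ x)
    simp only [hGN, Set.indicator_of_mem hx]
    refine le_min hc'.le (hN.le.trans ?_)
    exact_mod_cast le_max_left _ _
  have key : ∀ N, NN μ r (GN N) ≤ 4 * C * NN μ r F := by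
    intro N
    have hfin : ∫⁻ x, GN N x ^ r ∂μ ≠ ⊤ := by
      have : ∀ x, GN N x ^ r ≤ (spanningSets μ N).indicator (fun _ => (N:ENNReal)^r) x := by
        intro x
        simp only [hGN, Set.indicator]
        split_ifs
        · gcongr; exact min_le_right _ _
        · simp [hr0]
      refine ((lintegral_mono this).trans_lt ?_).ne
      rw [lintegral_indicator (measurableSet_spanningSets μ N), setLIntegral_const]
      exact ENNReal.mul_lt_top (ENNReal.rpow_lt_top_of_nonneg hr0.le (by simp)) (measure_spanningSets_lt_top μ N)
    have hqr : (r-1)*q = r := by have := hrq.sub_one_mul_conj; exact this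
    have e1 : NN μ q (fun x => GN N x ^ (r-1)) = (∫⁻ x, GN N x ^ r ∂μ)^(1/q) := by
      unfold NN; simp_rw [← ENNReal.rpow_mul, hqr]
    by_cases hz : ∫⁻ x, GN N x ^ r ∂μ = 0
    · unfold NN; rw [hz, ENNReal.zero_rpow_of_pos (by positivity)]; exact zero_le
    have hz' : (∫⁻ x, GN N x ^ r ∂μ)^(1/q) ≠ 0 := by
      rw [Ne, ENNReal.rpow_eq_zero_iff]; push Not
      exact ⟨fun h => absurd h hz, fun h => absurd h hfin⟩
    have ht' : (∫⁻ x, GN N x ^ r ∂μ)^(1/q) ≠ ⊤ := ENNReal.rpow_ne_top_of_nonneg (by positivity) hfin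
    have h1 := dual _ ((mGN N).pow_const (r-1)) (by rw [e1]; exact hz')
    rw [e1] at h1
    have h2 : ∫⁻ x, GN N x ^ r ∂μ ≤ ∫⁻ x, G x * GN N x ^ (r-1) ∂μ := by
      refine lintegral_mono fun x => ?_
      calc GN N x ^ r = GN N x ^ (1 + (r-1)) := by congr 1; ring
        _ = GN N x * GN N x ^ (r-1) := by rw [ENNReal.rpow_add_of_nonneg _ _ (by norm_num) (by linarith), ENNReal.rpow_one]
        _ ≤ _ := mul_le_mul' (leG N x) le_rfl
    have h3 := h2.trans h1
    have e3 : ∫⁻ x, GN N x ^ r ∂μ = NN μ r (GN N) * (∫⁻ x, GN N x ^ r ∂μ)^(1/q) := by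
      unfold NN
      rw [← ENNReal.rpow_add _ _ hz hfin, one_div, one_div, hrq.inv_add_inv_eq_one, ENNReal.rpow_one]
    have h4 := le_trans (le_of_eq e3.symm) h3
    exact (ENNReal.mul_le_mul_iff_left hz' ht').1 h4
  have e : ∀ x, G x ^ r = ⨆ N, GN N x ^ r := by
    intro x
    rw [sup x]
    exact (ENNReal.orderIsoRpow r hr0).map_iSup _
  unfold NN
  simp_rw [e]
  rw [lintegral_iSup (fun N => (mGN N).pow_const r) (fun N M hNM x => by simp only; gcongr; exact mono hNM x)]
  have e2 := (ENNReal.orderIsoRpow (1/r) (by positivity)).map_iSup (fun N => ∫⁻ x, (GN N x)^r ∂μ)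
  simp only [ENNReal.orderIsoRpow_apply] at e2
  rw [e2]
  exact iSup_le fun N => key N

theorem extrap_lt {p : ℝ} (hp1 : 1 < p) (hp2 : p < 2) {G F : X → ENNReal} (hG : Measurable G) (hF : Measurable F) {C : ENNReal}
    (hF0 : ∫⁻ x, F x ^ p ∂μ ≠ 0) (hFt : ∫⁻ x, F x ^ p ∂μ ≠ ⊤)
    (H : ∀ h : X → ENNReal, Measurable h → (∀ x, 0 < h x) → ∃ W : X → ENNReal, Measurable W ∧ (∀ x, h x ≤ W x) ∧ NN μ p W ≤ 2 * NN μ p h ∧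
      ∫⁻ x, G x * W x ^ (-(2-p)) ∂μ ≤ C * ∫⁻ x, F x ^ 2 * W x ^ (-(2-p)) ∂μ) : 
    ∫⁻ x, G x ^ (p/2) ∂μ ≤ C^(p/2) * (4^p)^((2-p)/2) * ∫⁻ x, F x ^ p ∂μ := by
  have hp0 : 0 < p := by linarith
  have hN0 : NN μ p F ≠ 0 := by
    unfold NN; rw [Ne, ENNReal.rpow_eq_zero_iff]; push Not
    exact ⟨fun h => absurd h hF0, fun h => absurd h hFt⟩
  obtain ⟨g, hg, hg0, hFg, hgn⟩ := make_pos hp1.le hF hN0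
  obtain ⟨W, hW, hgW, hWn, hGW⟩ := H g hg hg0
  have hW4 : ∫⁻ x, W x ^ p ∂μ ≤ 4^p * ∫⁻ x, F x ^ p ∂μ := by
    have h1 : NN μ p W ≤ 4 * NN μ p F := hWn.trans (by
      calc 2 * NN μ p g ≤ 2 * (2 * NN μ p F) := by gcongr
        _ = _ := by ring)
    have h2 := ENNReal.rpow_le_rpow h1 hp0.le
    rw [ENNReal.mul_rpow_of_nonneg _ _ hp0.le] at h2
    unfold NN at h2
    rwa [← ENNReal.rpow_mul, ← ENNReal.rpow_mul, one_div_mul_cancel hp0.ne', ENNReal.rpow_one, ENNReal.rpow_one] at h2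
  have hWf : ∀ᵐ x ∂μ, W x < ⊤ := by
    have : ∫⁻ x, W x ^ p ∂μ ≠ ⊤ := (hW4.trans_lt (ENNReal.mul_lt_top (ENNReal.rpow_lt_top_of_nonneg hp0.le (by simp)) hFt.lt_top)).ne
    filter_upwards [ae_lt_top (hW.pow_const p) this] with x hx
    by_contra h
    rw [not_lt, top_le_iff] at h
    rw [h, ENNReal.top_rpow_of_pos hp0] at hx
    exact lt_irrefl _ hx
  have hconj : (2/p).HolderConjugate (2/(2-p)) := by
    rw [Real.holderConjugate_iff]
    refine ⟨by rw [lt_div_iff₀ hp0]; linarith, ?_⟩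
    rw [inv_div, inv_div]; ring
  have hWpos : ∀ x, 0 < W x := fun x => (hg0 x).trans_le (hgW x)
  have h1 : ∫⁻ x, G x ^ (p/2) ∂μ = ∫⁻ x, ((fun x => (G x * W x ^ (-(2-p)))^(p/2)) * (fun x => (W x ^ (2-p))^(p/2))) x ∂μ := by
    refine lintegral_congr_ae ?_
    filter_upwards [hWf] with x hx
    show _ = (G x * W x ^ (-(2-p)))^(p/2) * (W x ^ (2-p))^(p/2)
    rw [← ENNReal.mul_rpow_of_nonneg _ _ (by positivity), mul_assoc, ← ENNReal.rpow_add _ _ (hWpos x).ne' hx.ne]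
    simp
  have mA : Measurable fun x => G x * W x ^ (-(2-p)) := hG.mul (hW.pow_const _)
  rw [h1]
  refine (ENNReal.lintegral_mul_le_Lp_mul_Lq μ hconj (mA.pow_const _).aemeasurable ((hW.pow_const _).pow_const _).aemeasurable).trans ?_
  have e1 : ∀ y : ENNReal, (y^(p/2))^(2/p) = y := fun y => by
    rw [← ENNReal.rpow_mul, div_mul_div_comm, mul_comm p 2, div_self (by positivity), ENNReal.rpow_one]
  have h2p : 2 - p ≠ 0 := by linarith
  have e2 : ∀ y : ENNReal, ((y^(2-p))^(p/2))^(2/(2-p)) = y^p := fun y => by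
    rw [← ENNReal.rpow_mul, ← ENNReal.rpow_mul]; congr 1; field_simp
  simp_rw [e1, e2, one_div_div]
  have h3 : ∫⁻ x, F x ^ 2 * W x ^ (-(2-p)) ∂μ ≤ ∫⁻ x, F x ^ p ∂μ := by
    refine lintegral_mono_ae ?_
    filter_upwards [hWf] with x hx
    have hFW : F x ≤ W x := (hFg x).trans (hgW x)
    by_cases h0 : F x = 0
    · simp [h0]
    have hFt : F x ≠ ⊤ := (hFW.trans_lt hx).ne
    calc F x ^ 2 * W x ^ (-(2-p)) ≤ F x ^ (2:ℝ) * F x ^ (-(2-p)) := by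
          rw [ENNReal.rpow_two]
          refine mul_le_mul' le_rfl ?_
          rw [ENNReal.rpow_neg, ENNReal.rpow_neg, ENNReal.inv_le_inv]
          exact ENNReal.rpow_le_rpow hFW (by linarith)
      _ = F x ^ p := by
          rw [← ENNReal.rpow_add _ _ h0 hFt]; congr 1; ring
  calc _ ≤ (C * ∫⁻ x, F x ^ p ∂μ)^(p/2) * (4^p * ∫⁻ x, F x ^ p ∂μ)^((2-p)/2) := by
        have : 0 ≤ (2-p)/2 := by linarith
        gcongr
        exact hGW.trans (by gcongr)
    _ = _ := by
        have h5 : 0 ≤ (2-p)/2 := by linarith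
        rw [ENNReal.mul_rpow_of_nonneg _ _ (by positivity), ENNReal.mul_rpow_of_nonneg _ _ h5]
        rw [mul_mul_mul_comm, ← ENNReal.rpow_add _ _ hF0 hFt]
        rw [show p/2 + (2-p)/2 = 1 by ring, ENNReal.rpow_one]

end
end LP

open MeasureTheory
set_option linter.all false
namespace LP

lemma EA1_one {n : ℕ} : EA1 (fun _ : EuclideanSpace ℝ (Fin n) => (1:ENNReal)) 1 := by
  refine ⟨measurable_const, fun _ => one_pos, zero_le_one, fun α k x => ?_⟩
  unfold DySys.A
  rw [setLIntegral_const, one_mul, ENNReal.ofReal_one, one_mul, DySys.vol, mul_comm]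
  exact ENNReal.mul_inv_le_one _

lemma mkKer {n : ℕ} {φ : EuclideanSpace ℝ (Fin n) → ℂ} (hsmooth : ContDiff ℝ (⊤ : ℕ∞) φ)
    (hbound : ∀ k : ℕ, ∃ C : ℝ, ∀ x, ‖iteratedFDeriv ℝ k φ x‖ ≤ C * (1 + ‖x‖) ^ (-(n : ℝ) - 1/2 - k))
    (hmean : (∫ x, φ x) = 0) : ∃ K, Ker φ K := by
  obtain ⟨C0, h0⟩ := hbound 0
  obtain ⟨C1, h1⟩ := hbound 1
  refine ⟨max (max C0 C1) 0, hsmooth.differentiable (by simp), le_max_right _ _, fun x => ?_, fun x => ?_, hmean⟩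
  · have h := h0 x
    rw [norm_iteratedFDeriv_zero, Nat.cast_zero, sub_zero] at h
    refine h.trans ?_
    have : 0 ≤ (1 + ‖x‖) ^ (-(n : ℝ) - 1/2) := by positivity
    exact mul_le_mul_of_nonneg_right ((le_max_left _ _).trans (le_max_left _ _)) this
  · have h := h1 x
    rw [norm_iteratedFDeriv_one, Nat.cast_one] at h
    refine h.trans ?_
    have : 0 ≤ (1 + ‖x‖) ^ (-(n : ℝ) - 1/2 - 1) := by positivity
    exact mul_le_mul_of_nonneg_right ((le_max_right _ _).trans (le_max_left _ _)) this

lemma prod_ne_top {d : ℕ} (c : Fin d → ℝ) : (∏ j, ENNReal.ofReal (c j)) ≠ ⊤ :=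
  ENNReal.prod_ne_top fun _ _ => ENNReal.ofReal_ne_top

section
variable {d : ℕ} {n : Fin d → ℕ} {φ : (j : Fin d) → EuclideanSpace ℝ (Fin (n j)) → ℂ} {K : Fin d → ℝ}

lemma Ker.cont {n : ℕ} {φ : EuclideanSpace ℝ (Fin n) → ℂ} {K : ℝ} (h : Ker φ K) : Continuous φ := h.hd.continuous
lemma Ker.int {n : ℕ} {φ : EuclideanSpace ℝ (Fin n) → ℂ} {K : ℝ} (h : Ker φ K) : Integrable φ := phi_int h.cont h.hK h.h0

theorem core_eq (hK : ∀ j, Ker (φ j) (K j)) {f : EE n → ℂ} (hf : Continuous f) (B : ℝ) (hB : ∀ x, ‖f x‖ ≤ B) :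
    ∫⁻ x, MG φ f x ≤ (∏ j, ENNReal.ofReal (CI (n j) (K j) 1)) * ∫⁻ x, ‖f x‖ₑ^2 := by
  have := iter d n φ (fun j => (hK j).cont) (fun j => (hK j).int) (fun j => ENNReal.ofReal (CI (n j) (K j) 1)) (fun _ => 1) measurable_const
    (fun j x => good_I (hK j) EA1_one) f hf B hB
  simpa using this

theorem core_gt (hK : ∀ j, Ker (φ j) (K j)) {r q : ℝ} (hrq : r.HolderConjugate q) {f : EE n → ℂ} (hf : Continuous f) (B : ℝ) (hB : ∀ x, ‖f x‖ ≤ B) :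
    NN volume r (MG φ f) ≤ 4 * (∏ j, ENNReal.ofReal (CI (n j) (K j) (2 * Bq n q))) * NN volume r (fun x => ‖f x‖ₑ^2) := by
  have hF : Measurable fun x => ‖f x‖ₑ^2 := hf.measurable.enorm.pow_const 2
  refine extrap_gt hrq (MG_meas (fun j => (hK j).cont) hf) hF ?_
  intro h hh hp
  obtain ⟨W, hW, hhW, hWn, hE⟩ := RdF hrq.symm.lt hh hp
  refine ⟨W, hW, hhW, hWn, ?_⟩
  exact iter d n φ (fun j => (hK j).cont) (fun j => (hK j).int) (fun j => ENNReal.ofReal (CI (n j) (K j) (2 * Bq n q))) W hW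
    (fun j x => good_I (hK j) (hE j x)) f hf B hB

theorem core_lt (hK : ∀ j, Ker (φ j) (K j)) {p : ℝ} (hp1 : 1 < p) (hp2 : p < 2) {f : EE n → ℂ} (hf : Continuous f) (B : ℝ) (hB : ∀ x, ‖f x‖ ≤ B)
    (hFt : ∫⁻ x, ‖f x‖ₑ ^ p ≠ ⊤) :
    ∫⁻ x, MG φ f x ^ (p/2) ≤ (∏ j, ENNReal.ofReal (CII (n j) (K j) (2 * Bq n p) (2-p)))^(p/2) * (4^p)^((2-p)/2) * ∫⁻ x, ‖f x‖ₑ ^ p := by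
  have hF : Measurable fun x => ‖f x‖ₑ := hf.measurable.enorm
  by_cases h0 : ∫⁻ x, ‖f x‖ₑ ^ p = 0
  · rw [lintegral_eq_zero_iff (hF.pow_const p)] at h0
    have h1 : ∀ᵐ x, f x = 0 := by
      filter_upwards [h0] with x hx
      have : ‖f x‖ₑ ^ p = 0 := hx
      rw [ENNReal.rpow_eq_zero_iff] at this
      rcases this with h | h
      · simpa using h.1
      · linarith [h.2]
    have h2 : ∀ T x, MC φ f T x = 0 := by
      intro T x
      unfold MC
      rw [integral_eq_zero_of_ae]
      filter_upwards [h1] with y hy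
      simp [hy]
    have h3 : ∀ x, MG φ f x = 0 := by
      intro x; unfold MG; simp [h2]
    have hp : 0 < p/2 := by linarith
    simp_rw [h3, ENNReal.zero_rpow_of_pos hp]
    simp
  refine extrap_lt hp1 hp2 (MG_meas (fun j => (hK j).cont) hf) hF h0 hFt ?_
  intro h hh hp
  obtain ⟨W, hW, hhW, hWn, hE⟩ := RdF hp1 hh hp
  refine ⟨W, hW, hhW, hWn, ?_⟩
  exact iter d n φ (fun j => (hK j).cont) (fun j => (hK j).int) (fun j => ENNReal.ofReal (CII (n j) (K j) (2 * Bq n p) (2-p))) (fun x => W x ^ (-(2-p))) (hW.pow_const _)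
    (fun j x => good_II (hK j) (by linarith) (by linarith) (hE j x)) f hf B hB

theorem core (hK : ∀ j, Ker (φ j) (K j)) {p : ℝ} (hp1 : 1 < p) : ∃ C : ENNReal, C ≠ ⊤ ∧ ∀ f : EE n → ℂ, Continuous f → ∀ B : ℝ, (∀ x, ‖f x‖ ≤ B) →
    (∫⁻ x, ‖f x‖ₑ ^ p ≠ ⊤) → (∫⁻ x, MG φ f x ^ (p/2))^(1/p) ≤ C * (∫⁻ x, ‖f x‖ₑ ^ p)^(1/p) := by
  have hp0 : 0 < p := by linarith
  have hpi : 0 ≤ 1/p := by positivity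
  rcases lt_trichotomy p 2 with h | h | h
  · refine ⟨((∏ j, ENNReal.ofReal (CII (n j) (K j) (2 * Bq n p) (2-p)))^(p/2) * (4^p)^((2-p)/2))^(1/p), ?_, ?_⟩
    · refine ENNReal.rpow_ne_top_of_nonneg hpi (ENNReal.mul_ne_top ?_ ?_)
      · exact ENNReal.rpow_ne_top_of_nonneg (by positivity) (prod_ne_top _)
      · exact ENNReal.rpow_ne_top_of_nonneg (by linarith) (ENNReal.rpow_ne_top_of_nonneg hp0.le (by simp))
    · intro f hf B hB ht
      rw [← ENNReal.mul_rpow_of_nonneg _ _ hpi]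
      exact ENNReal.rpow_le_rpow (core_lt hK hp1 h hf B hB ht) hpi
  · refine ⟨((∏ j, ENNReal.ofReal (CI (n j) (K j) 1)))^(1/p), ENNReal.rpow_ne_top_of_nonneg hpi (prod_ne_top _), ?_⟩
    intro f hf B hB ht
    rw [← ENNReal.mul_rpow_of_nonneg _ _ hpi]
    refine ENNReal.rpow_le_rpow ?_ hpi
    subst h
    have := core_eq hK hf B hB
    simp_rw [div_self (two_ne_zero (α := ℝ)), ENNReal.rpow_one, ENNReal.rpow_two]
    exact this
  · have hr : 1 < p/2 := by linarith
    have hrq := Real.HolderConjugate.conjExponent hr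
    set q := (p/2).conjExponent
    refine ⟨(4 * (∏ j, ENNReal.ofReal (CI (n j) (K j) (2 * Bq n q))))^((1:ℝ)/2), ?_, ?_⟩
    · exact ENNReal.rpow_ne_top_of_nonneg (by norm_num) (ENNReal.mul_ne_top (by simp) (prod_ne_top _))
    · intro f hf B hB ht
      have h1 := ENNReal.rpow_le_rpow (core_gt hK hrq hf B hB) (z := (1:ℝ)/2) (by norm_num)
      rw [ENNReal.mul_rpow_of_nonneg _ _ (by norm_num)] at h1
      unfold NN at h1
      rw [← ENNReal.rpow_mul, ← ENNReal.rpow_mul] at h1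
      have e1 : 1/(p/2) * (1/2) = 1/p := by field_simp
      have e2 : ∀ y : ENNReal, (y^2)^(p/2) = y^p := fun y => by
        rw [← ENNReal.rpow_two, ← ENNReal.rpow_mul]; congr 1; ring
      simp_rw [e1, e2] at h1
      exact h1

lemma MG_eq (f : EE n → ℂ) (x : EE n) : (∫⁻ T in {T : Fin d → ℝ | ∀ j, 0 < T j},
              ENNReal.ofReal
                (‖MeasureTheory.convolution f
                    (fun y => ∏ j, (((T j ^ n j)⁻¹ : ℝ) : ℂ) * φ j ((T j)⁻¹ • y j))
                    (ContinuousLinearMap.mul ℂ ℂ) volume x‖ ^ 2 / ∏ j, T j)) = MG φ f x := by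
  unfold MG
  rw [← tm_eq]
  have hm : MeasurableSet {T : Fin d → ℝ | ∀ j, 0 < T j} := by
    have : {T : Fin d → ℝ | ∀ j, 0 < T j} = Set.univ.pi fun _ => Set.Ioi 0 := by ext; simp
    rw [this]
    exact MeasurableSet.univ_pi fun _ => measurableSet_Ioi
  refine setLIntegral_congr_fun hm fun T hT => ?_
  have hT' : ∀ j, 0 < T j := hT
  have e : MeasureTheory.convolution f
                    (fun y => ∏ j, (((T j ^ n j)⁻¹ : ℝ) : ℂ) * φ j ((T j)⁻¹ • y j))
                    (ContinuousLinearMap.mul ℂ ℂ) volume x = MC φ f T x := by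
    unfold MeasureTheory.convolution MC PK
    rfl
  show ENNReal.ofReal _ = _
  rw [e, ENNReal.ofReal_div_of_pos (Finset.prod_pos fun j _ => hT' j), ENNReal.ofReal_prod_of_nonneg (fun j _ => (hT' j).le),
    ENNReal.ofReal_pow (norm_nonneg _), ofReal_norm, div_eq_mul_inv]
  congr 1
  exact ENNReal.prod_inv_distrib (fun i _ j _ _ => Or.inr (by simp))
end

end LP

theorem littlewood_paley_multi_parameter
    (d : ℕ) (hd : 1 ≤ d) (n : Fin d → ℕ) (hn : ∀ j, 1 ≤ n j)
    (φ : (j : Fin d) → EuclideanSpace ℝ (Fin (n j)) → ℂ)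
    (hsmooth : ∀ j, ContDiff ℝ (⊤ : ℕ∞) (φ j))
    (hbound : ∀ j, ∀ k : ℕ, ∃ C : ℝ, ∀ x,
      ‖iteratedFDeriv ℝ k (φ j) x‖ ≤ C * (1 + ‖x‖) ^ (-(n j : ℝ) - 1/2 - k))
    (hmean : ∀ j, (∫ x, φ j x) = 0) :
    ∀ p : ℝ, 1 < p → ∃ Cp : ℝ,
      ∀ f : SchwartzMap ((j : Fin d) → EuclideanSpace ℝ (Fin (n j))) ℂ,
        (∫⁻ x : (j : Fin d) → EuclideanSpace ℝ (Fin (n j)),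
            (∫⁻ T in {T : Fin d → ℝ | ∀ j, 0 < T j},
              ENNReal.ofReal
                (‖MeasureTheory.convolution (⇑f)
                    (fun y => ∏ j, (((T j ^ n j)⁻¹ : ℝ) : ℂ) * φ j ((T j)⁻¹ • y j))
                    (ContinuousLinearMap.mul ℂ ℂ) volume x‖ ^ 2 / ∏ j, T j)) ^ (p / 2)) ^ (1 / p)
          ≤ ENNReal.ofReal Cp * eLpNorm (⇑f) (ENNReal.ofReal p) volume := by
  intro p hp
  have hp0 : 0 < p := by linarith
  choose K hK using fun j => LP.mkKer (hsmooth j) (hbound j) (hmean j)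
  obtain ⟨C, hC, H⟩ := LP.core hK hp
  refine ⟨C.toReal, fun f => ?_⟩
  have hne : ENNReal.ofReal p ≠ 0 := by simpa using hp0
  have e : eLpNorm (⇑f) (ENNReal.ofReal p) volume = (∫⁻ x, ‖f x‖ₑ ^ p)^(1/p) := by
    rw [eLpNorm_eq_lintegral_rpow_enorm_toReal hne ENNReal.ofReal_ne_top, ENNReal.toReal_ofReal hp0.le]
  have hfin : ∫⁻ x, ‖f x‖ₑ ^ p ≠ ⊤ := by
    have h1 := (f.memLp (ENNReal.ofReal p) volume).2
    intro h
    rw [e, h, ENNReal.top_rpow_of_pos (by positivity)] at h1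
    exact lt_irrefl _ h1
  rw [ENNReal.ofReal_toReal hC, e]
  simp_rw [LP.MG_eq]
  have hB : ∃ B : ℝ, ∀ x, ‖f x‖ ≤ B := by
    obtain ⟨B, hB⟩ := f.decay 0 0
    exact ⟨B, fun x => by simpa using hB.2 x⟩
  obtain ⟨B, hB⟩ := hB
  exact H f f.continuous B hB hfin
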